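/- Let k and r be positive integers and let G be a multigraph all of whose degrees lie in {rk, rk+2, …, rk+2k} and such that r·|V(G)| is even. If G is (3k−3)-edge-connected or contains 2k−2 edge-disjoint spanning trees, then G can be edge-decomposed into k spanning subgraphs each of whose vertex degrees lie in {r, r+2}. -/

import Mathlib

open Finset

variable {V E : Type*}

/-- Degree of `v` in the sub-multigraph given by the edge set `S`,
where `ends e` gives the two endpoints of edge `e` (loops count twice). -/
def mdeg [DecidableEq V] (ends : E → V × V) (S : Finset E) (v : V) : ℕ :=
  (S.filter fun e => (ends e).1 = v).card + (S.filter fun e => (ends e).2 = v).card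

/-- Number of edges with exactly one end in the vertex set `X`. -/
def cutCard [Fintype E] [DecidableEq V] (ends : E → V × V) (X : Finset V) : ℕ :=
  (univ.filter fun e : E =>
    ((ends e).1 ∈ X ∧ (ends e).2 ∉ X) ∨ ((ends e).1 ∉ X ∧ (ends e).2 ∈ X)).card

/-- `lam`-edge-connectedness: every edge cut has at least `lam` edges. -/
def EdgeConn [Fintype V] [Fintype E] [DecidableEq V] (ends : E → V × V) (lam : ℕ) : Prop :=
  ∀ X : Finset V, X.Nonempty → X ≠ univ → lam ≤ cutCard ends X

/-- The edge set `T` is a spanning tree: it connects all vertices and has `|V| - 1` edges. -/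
def IsSpanningTree [Fintype V] [DecidableEq V] (ends : E → V × V) (T : Finset E) : Prop :=
  (∀ a b : V,
    Relation.ReflTransGen (fun u w => ∃ e ∈ T, ends e = (u, w) ∨ ends e = (w, u)) a b) ∧
  T.card + 1 = Fintype.card V

/-- `m`-tree-connectedness: there are `m` pairwise edge-disjoint spanning trees. -/
def TreeConn [Fintype V] [DecidableEq V] (ends : E → V × V) (m : ℕ) : Prop :=
  ∃ Ts : Fin m → Finset E,
    (∀ i j, i ≠ j → Disjoint (Ts i) (Ts j)) ∧ ∀ i, IsSpanningTree ends (Ts i)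

open Finset
namespace FR

/-- Distance of `n` to the nearest multiple of `2 * k`. -/
def nd (k n : ℤ) : ℤ := min (n % (2 * k)) (2 * k - n % (2 * k))

theorem nd_le_abs {k : ℤ} (hk : 2 ≤ k) (n q : ℤ) : nd k n ≤ |n - 2 * k * q| := by
  unfold nd
  have h1 := Int.emod_add_mul_ediv n (2 * k)
  have h2 := Int.emod_nonneg n (show (2 * k) ≠ 0 by omega)
  have h3 := Int.emod_lt_of_pos n (show 0 < (2 * k) by omega)
  set a := n % (2 * k)
  set b := n / (2 * k)
  have h4 : n - 2 * k * q = a + 2 * k * (b - q) := by rw [← h1]; ring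
  rw [h4]
  rcases lt_trichotomy (b - q) 0 with h | h | h
  · have : 2 * k * (b - q) ≤ 2 * k * (-1) := by
      apply mul_le_mul_of_nonneg_left <;> omega
    rw [abs_of_nonpos (by omega)]
    have := min_le_right a (2 * k - a)
    omega
  · rw [h, mul_zero, add_zero, abs_of_nonneg h2]
    exact min_le_left _ _
  · have : 2 * k * 1 ≤ 2 * k * (b - q) := by
      apply mul_le_mul_of_nonneg_left <;> omega
    rw [abs_of_nonneg (by omega)]
    have := min_le_left a (2 * k - a)
    omega

theorem nd_spec {k : ℤ} (hk : 2 ≤ k) (n : ℤ) :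
    0 ≤ nd k n ∧ nd k n ≤ k ∧ ∃ q, (n = 2 * k * q + nd k n ∨ n = 2 * k * q - nd k n) := by
  unfold nd
  have h1 := Int.emod_add_mul_ediv n (2 * k)
  have h2 := Int.emod_nonneg n (show (2 * k) ≠ 0 by omega)
  have h3 := Int.emod_lt_of_pos n (show 0 < (2 * k) by omega)
  set a := n % (2 * k)
  set b := n / (2 * k)
  rcases le_total a (2 * k - a) with h | h
  · rw [min_eq_left h]
    refine ⟨h2, by omega, b, Or.inl (by omega)⟩
  · rw [min_eq_right h]
    refine ⟨by omega, by omega, b + 1, Or.inr ?_⟩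
    rw [mul_add]; omega

theorem nd_nonneg {k : ℤ} (hk : 2 ≤ k) (n : ℤ) : 0 ≤ nd k n := (nd_spec hk n).1
theorem nd_le {k : ℤ} (hk : 2 ≤ k) (n : ℤ) : nd k n ≤ k := (nd_spec hk n).2.1

theorem nd_congr {k : ℤ} {a b : ℤ} (h : 2 * k ∣ a - b) : nd k a = nd k b := by
  unfold nd
  rw [Int.emod_eq_emod_iff_emod_sub_eq_zero.2 (Int.emod_eq_zero_of_dvd h)]

theorem nd_par {k : ℤ} (hk : 2 ≤ k) (n : ℤ) : 2 ∣ nd k n - n := by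
  obtain ⟨-, -, q, h | h⟩ := nd_spec hk n
  · exact ⟨-(k * q), by linarith⟩
  · exact ⟨nd k n - k * q, by linarith⟩

theorem nd_triangle {k : ℤ} (hk : 2 ≤ k) (a b : ℤ) : nd k (a + b) ≤ nd k a + nd k b := by
  obtain ⟨ha, -, q, h⟩ := nd_spec hk a
  obtain ⟨hb, -, q', h'⟩ := nd_spec hk b
  refine (nd_le_abs hk _ (q + q')).trans ?_
  have : 2 * k * (q + q') = 2 * k * q + 2 * k * q' := by ring
  rw [abs_le]
  rcases h with h | h <;> rcases h' with h' | h' <;> constructor <;> linarith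

theorem nd_neg {k : ℤ} (hk : 2 ≤ k) (a : ℤ) : nd k (-a) = nd k a := by
  have key : ∀ a, nd k (-a) ≤ nd k a := by
    intro a
    obtain ⟨ha, -, q, h⟩ := nd_spec hk a
    refine (nd_le_abs hk _ (-q)).trans ?_
    have : 2 * k * (-q) = - (2 * k * q) := by ring
    rw [abs_le]
    rcases h with h | h <;> constructor <;> linarith
  refine le_antisymm (key a) ?_
  have := key (-a); rwa [neg_neg] at this

theorem nd_zero {k : ℤ} (hk : 2 ≤ k) : nd k 0 = 0 := by
  have := nd_le_abs hk 0 0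
  have := nd_nonneg hk 0
  simp at *; omega

theorem nd_eq_zero {k : ℤ} (hk : 2 ≤ k) {n : ℤ} : nd k n = 0 ↔ 2 * k ∣ n := by
  constructor
  · intro h
    obtain ⟨-, -, q, h' | h'⟩ := nd_spec hk n <;> exact ⟨q, by linarith⟩
  · intro h
    rw [nd_congr (b := 0) (by simpa using h), nd_zero hk]

theorem nd_small {k : ℤ} (hk : 2 ≤ k) {n : ℤ} (h0 : 0 ≤ n) (h1 : n ≤ k) : nd k n = n := by
  unfold nd
  rw [Int.emod_eq_of_lt h0 (by omega), min_eq_left (by omega)]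

theorem nd_one {k : ℤ} (hk : 2 ≤ k) : nd k 1 = 1 := nd_small hk (by omega) (by omega)

theorem nd_large {k : ℤ} (hk : 2 ≤ k) {n : ℤ} (h0 : k ≤ n) (h1 : n ≤ 2 * k) : nd k n = 2 * k - n := by
  rw [← nd_neg hk, nd_congr (b := 2 * k - n) ⟨-1, by ring⟩]
  exact nd_small hk (by omega) (by omega)

/-- going down by one changes the distance by exactly one -/
theorem nd_pred {k : ℤ} (hk : 2 ≤ k) (n : ℤ) :
    nd k (n - 1) = nd k n - 1 ∨ nd k (n - 1) = nd k n + 1 := by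
  have h1 := nd_triangle hk (n - 1) 1
  have h2 := nd_triangle hk n (-1)
  rw [nd_neg hk, nd_one hk] at h2
  rw [nd_one hk] at h1
  have h3 := nd_par hk n
  have h4 := nd_par hk (n - 1)
  have e1 : n - 1 + 1 = n := by ring
  have e2 : n + -1 = n - 1 := by ring
  rw [e1] at h1
  rw [e2] at h2
  omega

theorem nd_succ {k : ℤ} (hk : 2 ≤ k) (n : ℤ) :
    nd k (n + 1) = nd k n - 1 ∨ nd k (n + 1) = nd k n + 1 := by
  have := nd_pred hk (n + 1)
  have e1 : n + 1 - 1 = n := by ring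
  rw [e1] at this; omega

theorem pos_dvd {k : ℤ} (hk : 2 ≤ k) {n : ℤ} (h : nd k (n - 1) < nd k n) :
    2 * k ∣ n - nd k n := by
  obtain ⟨h0, hle, q, h' | h'⟩ := nd_spec hk n
  · exact ⟨q, by linarith⟩
  · by_cases hkk : nd k n = k
    · exact ⟨q - 1, by rw [mul_sub]; linarith⟩
    · exfalso
      have : nd k (n - 1) = nd k n + 1 := by
        have e : nd k (n - 1) = nd k (-(nd k n + 1)) := nd_congr ⟨q, by linarith⟩
        rw [e, nd_neg hk, nd_small hk] <;> omega
      omega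

theorem nonpos_dvd {k : ℤ} (hk : 2 ≤ k) {n : ℤ} (h : ¬ nd k (n - 1) < nd k n) :
    2 * k ∣ n + nd k n := by
  obtain ⟨h0, hle, q, h' | h'⟩ := nd_spec hk n
  · by_cases hz : nd k n = 0
    · exact ⟨q, by linarith⟩
    · exfalso
      have : nd k (n - 1) = nd k n - 1 := by
        have e : nd k (n - 1) = nd k (nd k n - 1) := nd_congr ⟨q, by linarith⟩
        rw [e, nd_small hk] <;> omega
      omega
  · exact ⟨q, by linarith⟩

/-- from a nonpositive nonzero residue, one can go up -/
theorem nonpos_succ {k : ℤ} (hk : 2 ≤ k) {n : ℤ} (h : ¬ nd k (n - 1) < nd k n) (h0 : nd k n ≠ 0) :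
    nd k (n + 1) = nd k n - 1 ∧ ¬ nd k (n + 1 - 1) < nd k (n + 1) := by
  obtain ⟨q, hq⟩ := nonpos_dvd hk h
  have h1 := nd_nonneg hk n
  have h2 := nd_le hk n
  have e : nd k (n + 1) = nd k (-(nd k n - 1)) := nd_congr ⟨q, by linarith⟩
  rw [nd_neg hk, nd_small (n := nd k n - 1) hk (by omega) (by omega)] at e
  have e1 : n + 1 - 1 = n := by ring
  rw [e1]
  omega

/-- splitting a quantity -/
theorem split {V : Type*} [DecidableEq V] (s : Finset V) (c : V → ℤ) (hc : ∀ v ∈ s, 0 ≤ c v) (F : ℤ) (h0 : 0 ≤ F)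
    (h1 : F ≤ ∑ v ∈ s, c v) : ∃ g : V → ℤ, (∀ v ∈ s, 0 ≤ g v ∧ g v ≤ c v) ∧ ∑ v ∈ s, g v = F := by
  induction s using Finset.induction_on generalizing F with
  | empty => simp at h1; exact ⟨fun _ => 0, by simp, by simp; omega⟩
  | insert a s ha ih =>
    rw [Finset.sum_insert ha] at h1
    have hs : 0 ≤ ∑ v ∈ s, c v := Finset.sum_nonneg fun v hv => hc v (mem_insert_of_mem hv)
    have hca := hc a (mem_insert_self _ _)
    obtain ⟨g, hg, hgs⟩ := ih (fun v hv => hc v (mem_insert_of_mem hv)) (F - min F (c a))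
      (by omega) (by omega)
    refine ⟨fun v => if v = a then min F (c a) else g v, ?_, ?_⟩
    · intro v hv
      by_cases hva : v = a
      · subst hva; simp; omega
      · simp [hva]; exact hg v ((mem_insert.1 hv).resolve_left hva)
    · rw [Finset.sum_insert ha]
      simp only [if_true]
      rw [Finset.sum_congr rfl (g := g) (fun v hv => by
        have : v ≠ a := fun h => ha (h ▸ hv)
        simp [this]), hgs]
      ring

end FR

open Finset
set_option linter.unusedSectionVars false
namespace FR

/-- number of edges between two vertex sets -/
def ee {V : Type*} (μ : V → V → ℤ) (A B : Finset V) : ℤ := ∑ u ∈ A, ∑ w ∈ B, μ u w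

/-- an instance of the orientation problem: `o` edges from the root, `i` edges to the root,
`φ` edges to a free vertex, `t` prescribed net outflow modulo `2k`. -/
structure Inst (V : Type*) where
  Q : Finset V
  μ : V → V → ℤ
  o : V → ℤ
  i : V → ℤ
  φ : V → ℤ
  t : V → ℤ

section
variable {V : Type*} [DecidableEq V]

def dl (v u : V) : ℤ := if u = v then 1 else 0
def ed (u w x y : V) : ℤ := (if x = u ∧ y = w then 1 else 0) + (if x = w ∧ y = u then 1 else 0)

theorem ed_symm (u w x y : V) : ed u w x y = ed u w y x := by
  unfold ed
  rw [add_comm]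
  simp only [and_comm]

theorem ed_nonneg (u w x y : V) : 0 ≤ ed u w x y := by
  unfold ed; split_ifs <;> norm_num

theorem ed_diag {u w : V} (h : u ≠ w) (x : V) : ed u w x x = 0 := by
  unfold ed
  rw [if_neg, if_neg]
  · rfl
  · rintro ⟨rfl, rfl⟩; exact h rfl
  · rintro ⟨rfl, rfl⟩; exact h rfl

theorem ed_le {u w : V} (h : u ≠ w) {μ : V → V → ℤ} (hs : ∀ x y, μ x y = μ y x)
    (h0 : ∀ x y, 0 ≤ μ x y) (h1 : 1 ≤ μ u w) (x y : V) : ed u w x y ≤ μ x y := by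
  unfold ed
  have := h0 x y
  split_ifs with h2 h3 h3
  · exact absurd (h2.1.symm.trans h3.1) h
  · rw [h2.1, h2.2]; simpa using h1
  · rw [h3.1, h3.2, hs]; simpa using h1
  · simpa using this

theorem sum_dl (A : Finset V) (v : V) : ∑ u ∈ A, dl v u = if v ∈ A then 1 else 0 := by
  unfold dl; rw [Finset.sum_ite_eq']

theorem ee_ed (A B : Finset V) (u w : V) :
    ee (ed u w) A B = (if u ∈ A ∧ w ∈ B then 1 else 0) + (if w ∈ A ∧ u ∈ B then 1 else 0) := by
  have key : ∀ a b : V, ∑ x ∈ A, ∑ y ∈ B, (if x = a ∧ y = b then (1:ℤ) else 0)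
      = if a ∈ A ∧ b ∈ B then 1 else 0 := by
    intro a b
    have : ∀ x y : V, (if x = a ∧ y = b then (1:ℤ) else 0) = if x = a then (if y = b then 1 else 0) else 0 := by
      intro x y; by_cases h : x = a <;> simp [h]
    simp only [this]
    have : ∀ x : V, ∑ y ∈ B, (if x = a then (if y = b then (1:ℤ) else 0) else 0)
       = if x = a then (if b ∈ B then 1 else 0) else 0 := by
      intro x
      by_cases h : x = a <;> simp [h]
    simp only [this]
    rw [Finset.sum_ite_eq']
    by_cases h : a ∈ A <;> simp [h]
  unfold ee ed
  simp only [Finset.sum_add_distrib, key]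

theorem ee_add (μ ν : V → V → ℤ) (A B : Finset V) :
    ee (fun x y => μ x y + ν x y) A B = ee μ A B + ee ν A B := by
  simp [ee, Finset.sum_add_distrib]

theorem ee_sub (μ ν : V → V → ℤ) (A B : Finset V) :
    ee (fun x y => μ x y - ν x y) A B = ee μ A B - ee ν A B := by
  simp [ee, Finset.sum_sub_distrib]

theorem ee_union_left (μ : V → V → ℤ) {A B : Finset V} (C : Finset V) (h : Disjoint A B) :
    ee μ (A ∪ B) C = ee μ A C + ee μ B C := Finset.sum_union h

theorem ee_union_right (μ : V → V → ℤ) (A : Finset V) {B C : Finset V} (h : Disjoint B C) :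
    ee μ A (B ∪ C) = ee μ A B + ee μ A C := by
  unfold ee
  rw [← Finset.sum_add_distrib]
  exact Finset.sum_congr rfl fun x _ => Finset.sum_union h

theorem ee_comm {μ : V → V → ℤ} (hs : ∀ x y, μ x y = μ y x) (A B : Finset V) :
    ee μ A B = ee μ B A := by
  unfold ee
  rw [Finset.sum_comm]
  exact Finset.sum_congr rfl fun x _ => Finset.sum_congr rfl fun y _ => hs _ _

theorem ee_nonneg {μ : V → V → ℤ} (h0 : ∀ x y, 0 ≤ μ x y) (A B : Finset V) : 0 ≤ ee μ A B :=
  Finset.sum_nonneg fun _ _ => Finset.sum_nonneg fun _ _ => h0 _ _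

theorem ee_empty_left (μ : V → V → ℤ) (B : Finset V) : ee μ ∅ B = 0 := by simp [ee]
theorem ee_empty_right (μ : V → V → ℤ) (B : Finset V) : ee μ B ∅ = 0 := by simp [ee]
theorem ee_singleton_left (μ : V → V → ℤ) (v : V) (B : Finset V) : ee μ {v} B = ∑ w ∈ B, μ v w := by simp [ee]
theorem ee_singleton_right (μ : V → V → ℤ) (v : V) (B : Finset V) : ee μ B {v} = ∑ w ∈ B, μ w v := by simp [ee]

theorem ee_even {μ : V → V → ℤ} (hs : ∀ x y, μ x y = μ y x) (hd : ∀ x, μ x x = 0) (A : Finset V) :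
    2 ∣ ee μ A A := by
  induction A using Finset.induction_on with
  | empty => simp [ee]
  | insert a A ha ih =>
    have hdj : Disjoint {a} A := by simpa using ha
    rw [Finset.insert_eq, ee_union_left _ _ hdj, ee_union_right _ _ hdj, ee_union_right _ _ hdj,
      ee_comm hs A {a}, ee_singleton_left μ a {a}]
    simp only [Finset.sum_singleton, hd]
    omega

/-- total of a vertex function -/
def sm (g : V → ℤ) (A : Finset V) : ℤ := ∑ u ∈ A, g u

theorem sm_union (g : V → ℤ) {A B : Finset V} (h : Disjoint A B) : sm g (A ∪ B) = sm g A + sm g B :=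
  Finset.sum_union h
theorem sm_singleton (g : V → ℤ) (v : V) : sm g {v} = g v := by simp [sm]
theorem sm_empty (g : V → ℤ) : sm g ∅ = 0 := by simp [sm]
theorem sm_add (g h : V → ℤ) (A : Finset V) : sm (fun x => g x + h x) A = sm g A + sm h A := by
  simp [sm, Finset.sum_add_distrib]
theorem sm_sub (g h : V → ℤ) (A : Finset V) : sm (fun x => g x - h x) A = sm g A - sm h A := by
  simp [sm, Finset.sum_sub_distrib]
theorem sm_zero (A : Finset V) : sm (fun _ => 0) A = 0 := by simp [sm]
theorem sm_dl (A : Finset V) (v : V) : sm (dl v) A = if v ∈ A then 1 else 0 := sum_dl A v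
theorem sm_congr {g h : V → ℤ} {A : Finset V} (H : ∀ v ∈ A, g v = h v) : sm g A = sm h A :=
  Finset.sum_congr rfl H
theorem sm_nonneg {g : V → ℤ} {A : Finset V} (H : ∀ v ∈ A, 0 ≤ g v) : 0 ≤ sm g A :=
  Finset.sum_nonneg H
theorem sm_mono {g : V → ℤ} {A B : Finset V} (hAB : A ⊆ B) (H : ∀ v ∈ B, 0 ≤ g v) : sm g A ≤ sm g B :=
  Finset.sum_le_sum_of_subset_of_nonneg hAB fun v hv _ => H v hv
theorem sm_le {g : V → ℤ} {A : Finset V} {v : V} (hv : v ∈ A) (H : ∀ v ∈ A, 0 ≤ g v) : g v ≤ sm g A := by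
  rw [← sm_singleton g v]; exact sm_mono (by simpa using hv) H
theorem sm_pos {g : V → ℤ} {A : Finset V} (H : 0 < sm g A) : ∃ v ∈ A, 0 < g v := by
  by_contra h; push Not at h
  exact absurd (Finset.sum_nonpos h) (not_le.2 H)
theorem sm_zero_of {g : V → ℤ} {A : Finset V} (H : ∀ v ∈ A, g v = 0) : sm g A = 0 :=
  Finset.sum_eq_zero H
theorem sm_insert (g : V → ℤ) {A : Finset V} {a : V} (h : a ∉ A) : sm g (insert a A) = g a + sm g A :=
  Finset.sum_insert h
theorem sm_sdiff (g : V → ℤ) {A B : Finset V} (h : A ⊆ B) : sm g (B \ A) = sm g B - sm g A := by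
  have := Finset.sum_sdiff (f := g) h
  unfold sm; omega

namespace Inst

def dd (I : Inst V) (A : Finset V) : ℤ :=
  ee I.μ A (I.Q \ A) + sm I.o A + sm I.i A + sm I.φ A

def tt (I : Inst V) (A : Finset V) : ℤ := sm I.t A

structure Ok (I : Inst V) : Prop where
  symm : ∀ x y, I.μ x y = I.μ y x
  nn : ∀ x y, 0 ≤ I.μ x y
  diag : ∀ x, I.μ x x = 0
  o0 : ∀ v ∈ I.Q, 0 ≤ I.o v
  i0 : ∀ v ∈ I.Q, 0 ≤ I.i v
  φ0 : ∀ v ∈ I.Q, 0 ≤ I.φ v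
  par : ∀ v ∈ I.Q, 2 ∣ I.dd {v} - I.t v

def FeasW (I : Inst V) (r : V → ℤ) (f : V → V → ℤ) (p : V → ℤ) : Prop :=
  (∀ u ∈ I.Q, ∀ v ∈ I.Q, 0 ≤ f u v ∧ f u v + f v u = I.μ u v) ∧
  (∀ v ∈ I.Q, 0 ≤ p v ∧ p v ≤ I.φ v) ∧
  ∀ v ∈ I.Q, r v = ∑ u ∈ I.Q, f v u + p v + I.i v

def Feas (I : Inst V) (r : V → ℤ) : Prop := ∃ f p, I.FeasW r f p

def Good (k : ℤ) (I : Inst V) (S : Finset V) : Prop :=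
  ∃ r, I.Feas r ∧ (∀ v ∈ I.Q, 2 * k ∣ 2 * r v - I.dd {v} - I.t v) ∧ ∀ v ∈ I.Q, v ∈ S → 1 ≤ r v

def size (I : Inst V) : ℤ := ∑ v ∈ I.Q, (I.dd {v} + 1)

theorem tt_singleton (I : Inst V) (v : V) : I.tt {v} = I.t v := sm_singleton _ _
theorem tt_empty (I : Inst V) : I.tt ∅ = 0 := sm_empty _
theorem tt_union (I : Inst V) {A B : Finset V} (h : Disjoint A B) : I.tt (A ∪ B) = I.tt A + I.tt B := sm_union _ h
theorem tt_sdiff (I : Inst V) {A B : Finset V} (h : A ⊆ B) : I.tt (B \ A) = I.tt B - I.tt A := sm_sdiff _ h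
theorem dd_empty (I : Inst V) : I.dd ∅ = 0 := by simp [dd, ee, sm]

theorem dd_nonneg {I : Inst V} (h : I.Ok) {A : Finset V} (hA : A ⊆ I.Q) : 0 ≤ I.dd A := by
  have h1 := ee_nonneg h.nn A (I.Q \ A)
  have h2 := sm_nonneg fun v hv => h.o0 v (hA hv)
  have h3 := sm_nonneg fun v hv => h.i0 v (hA hv)
  have h4 := sm_nonneg fun v hv => h.φ0 v (hA hv)
  unfold dd; omega

theorem dd_union {I : Inst V} (h : I.Ok) {A B : Finset V} (hA : A ⊆ I.Q) (hB : B ⊆ I.Q) (hd : Disjoint A B) :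
    I.dd (A ∪ B) = I.dd A + I.dd B - 2 * ee I.μ A B := by
  have e1 : I.Q \ A = (I.Q \ (A ∪ B)) ∪ B := by
    ext x; simp only [mem_sdiff, mem_union]
    have : x ∈ B → x ∈ I.Q := fun h => hB h
    have : x ∈ A → x ∈ B → False := fun h h' => Finset.disjoint_left.1 hd h h'
    tauto
  have e2 : I.Q \ B = (I.Q \ (A ∪ B)) ∪ A := by
    ext x; simp only [mem_sdiff, mem_union]
    have : x ∈ A → x ∈ I.Q := fun h => hA h
    have : x ∈ A → x ∈ B → False := fun h h' => Finset.disjoint_left.1 hd h h'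
    tauto
  have d1 : Disjoint (I.Q \ (A ∪ B)) B := by
    rw [Finset.disjoint_left]; intro x; simp only [mem_sdiff, mem_union]; tauto
  have d2 : Disjoint (I.Q \ (A ∪ B)) A := by
    rw [Finset.disjoint_left]; intro x; simp only [mem_sdiff, mem_union]; tauto
  unfold dd
  rw [e1, e2, ee_union_right _ _ d1, ee_union_right _ _ d2, ee_union_left _ _ hd, sm_union _ hd,
    sm_union _ hd, sm_union _ hd, ee_comm h.symm B A]
  ring

theorem dd_par {I : Inst V} (h : I.Ok) {A : Finset V} (hA : A ⊆ I.Q) : 2 ∣ I.dd A - I.tt A := by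
  induction A using Finset.induction_on with
  | empty => simp [dd_empty, tt_empty]
  | insert a A ha ih =>
    have hdj : Disjoint {a} A := by simpa using ha
    have h1 : a ∈ I.Q := hA (mem_insert_self _ _)
    have h2 : A ⊆ I.Q := fun x hx => hA (mem_insert_of_mem hx)
    rw [Finset.insert_eq, dd_union h (by simpa using h1) h2 hdj, tt_union _ hdj, tt_singleton]
    have := ih h2
    have := h.par a h1
    omega

/-- sum of degrees -/
theorem sum_dd {I : Inst V} (h : I.Ok) {A : Finset V} (hA : A ⊆ I.Q) :
    ∑ v ∈ A, I.dd {v} = I.dd A + ee I.μ A A := by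
  induction A using Finset.induction_on with
  | empty => simp [dd_empty, ee]
  | insert a A ha ih =>
    have hdj : Disjoint {a} A := by simpa using ha
    have h1 : a ∈ I.Q := hA (mem_insert_self _ _)
    have h2 : A ⊆ I.Q := fun x hx => hA (mem_insert_of_mem hx)
    rw [Finset.sum_insert ha, Finset.insert_eq, dd_union h (by simpa using h1) h2 hdj, ih h2]
    rw [ee_union_left _ _ hdj, ee_union_right _ _ hdj, ee_union_right _ _ hdj,
      ee_comm h.symm A {a}, ee_singleton_left I.μ a {a}]
    simp only [Finset.sum_singleton, h.diag]
    omega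

theorem size_nonneg {I : Inst V} (h : I.Ok) : 0 ≤ I.size :=
  Finset.sum_nonneg fun v hv => by
    have := dd_nonneg h (A := {v}) (by simpa using hv)
    omega

/-- total out-degree -/
theorem sum_r {I : Inst V} (h : I.Ok) {r f p} (hF : I.FeasW r f p) :
    2 * sm r I.Q = ee I.μ I.Q I.Q + 2 * sm p I.Q + 2 * sm I.i I.Q := by
  have h1 : sm r I.Q = ∑ v ∈ I.Q, ∑ u ∈ I.Q, f v u + sm p I.Q + sm I.i I.Q := by
    unfold sm
    rw [Finset.sum_congr rfl hF.2.2, Finset.sum_add_distrib, Finset.sum_add_distrib]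
  have h2 : ∑ v ∈ I.Q, ∑ u ∈ I.Q, f v u + ∑ v ∈ I.Q, ∑ u ∈ I.Q, f v u = ee I.μ I.Q I.Q := by
    have hc : ∑ v ∈ I.Q, ∑ u ∈ I.Q, f v u = ∑ v ∈ I.Q, ∑ u ∈ I.Q, f u v := Finset.sum_comm
    nth_rewrite 2 [hc]
    unfold ee
    rw [← Finset.sum_add_distrib]
    refine Finset.sum_congr rfl fun v hv => ?_
    rw [← Finset.sum_add_distrib]
    refine Finset.sum_congr rfl fun u hu => ?_
    have := (hF.1 v hv u hu).2
    omega
  omega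

end Inst
end
end FR

open Finset
set_option linter.unusedSectionVars false
namespace FR
namespace Inst
variable {V : Type*} [DecidableEq V]

theorem dd_restrict {I J : Inst V} (hμ : J.μ = I.μ) (hQ : J.Q ⊆ I.Q)
    (hb : ∀ v ∈ J.Q, J.o v + J.i v + J.φ v = I.o v + I.i v + I.φ v + ∑ w ∈ I.Q \ J.Q, I.μ v w)
    {C : Finset V} (hC : C ⊆ J.Q) : J.dd C = I.dd C := by
  have e1 : I.Q \ C = (J.Q \ C) ∪ (I.Q \ J.Q) := by
    ext x; simp only [mem_sdiff, mem_union]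
    have : x ∈ J.Q → x ∈ I.Q := fun h => hQ h
    have : x ∈ C → x ∈ J.Q := fun h => hC h
    tauto
  have d1 : Disjoint (J.Q \ C) (I.Q \ J.Q) := by
    rw [Finset.disjoint_left]; intro x; simp only [mem_sdiff]; tauto
  have h1 : sm J.o C + sm J.i C + sm J.φ C = sm I.o C + sm I.i C + sm I.φ C + ee I.μ C (I.Q \ J.Q) := by
    unfold sm ee
    rw [← sum_add_distrib, ← sum_add_distrib, ← sum_add_distrib, ← sum_add_distrib, ← sum_add_distrib]
    exact Finset.sum_congr rfl fun v hv => hb v (hC hv)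
  unfold dd
  rw [e1, ee_union_right _ _ d1, hμ]
  omega

theorem ok_restrict {I J : Inst V} (h : I.Ok) (hμ : J.μ = I.μ) (hQ : J.Q ⊆ I.Q) (ht : ∀ v ∈ J.Q, J.t v = I.t v)
    (hb : ∀ v ∈ J.Q, J.o v + J.i v + J.φ v = I.o v + I.i v + I.φ v + ∑ w ∈ I.Q \ J.Q, I.μ v w)
    (ho : ∀ v ∈ J.Q, 0 ≤ J.o v) (hi : ∀ v ∈ J.Q, 0 ≤ J.i v) (hφ : ∀ v ∈ J.Q, 0 ≤ J.φ v) : J.Ok where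
  symm := by rw [hμ]; exact h.symm
  nn := by rw [hμ]; exact h.nn
  diag := by rw [hμ]; exact h.diag
  o0 := ho
  i0 := hi
  φ0 := hφ
  par := fun v hv => by
    rw [dd_restrict hμ hQ hb (by simpa using hv), ht v hv]; exact h.par v (hQ hv)

theorem size_restrict {I J : Inst V} (h : I.Ok) (hμ : J.μ = I.μ) (hQ : J.Q ⊂ I.Q)
    (hb : ∀ v ∈ J.Q, J.o v + J.i v + J.φ v = I.o v + I.i v + I.φ v + ∑ w ∈ I.Q \ J.Q, I.μ v w) :
    J.size < I.size := by
  obtain ⟨v, hv, hv'⟩ := Finset.exists_of_ssubset hQ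
  unfold size
  rw [Finset.sum_congr rfl (g := fun v => I.dd {v} + 1) fun v hv => by
    rw [dd_restrict hμ hQ.1 hb (by simpa using hv)]]
  refine Finset.sum_lt_sum_of_subset hQ.1 hv hv' ?_ ?_
  · have := dd_nonneg h (A := {v}) (by simpa using hv); omega
  · intro u hu _
    have := dd_nonneg h (A := {u}) (by simpa using hu); omega

/-- contraction of `A` to its representative `a` -/
def con (I : Inst V) (A : Finset V) (a : V) : Inst V where
  Q := insert a (I.Q \ A)
  μ := fun u v => if u = a then (if v = a then 0 else ∑ x ∈ A, I.μ x v)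
    else if v = a then ∑ x ∈ A, I.μ u x else I.μ u v
  o := fun v => if v = a then sm I.o A else I.o v
  i := fun v => if v = a then sm I.i A else I.i v
  φ := fun v => if v = a then sm I.φ A else I.φ v
  t := fun v => if v = a then sm I.t A else I.t v

def ex (A : Finset V) (a : V) (B : Finset V) : Finset V := if a ∈ B then B ∪ A else B

theorem sm_con (g : V → ℤ) {A B : Finset V} {a : V} (ha : a ∈ A) (hd : ∀ x ∈ B, x ∈ A → x = a) :
    sm (fun v => if v = a then sm g A else g v) B = sm g (ex A a B) := by
  unfold ex
  split_ifs with h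
  · have e : B ∪ A = B.erase a ∪ A := by
      ext x; simp only [mem_union, mem_erase]; 
      by_cases hx : x = a
      · subst hx; simp [ha]
      · simp [hx]
    have d : Disjoint (B.erase a) A := by
      rw [disjoint_left]; intro x hx hx'
      rw [mem_erase] at hx; exact hx.1 (hd x hx.2 hx')
    rw [e, sm_union _ d, ← Finset.insert_erase h, sm_insert _ (by simp), Finset.insert_erase h]
    simp only [if_true]
    rw [add_comm]
    congr 1
    refine sm_congr fun v hv => ?_
    rw [if_neg (mem_erase.1 hv).1]
  · refine sm_congr fun v hv => ?_
    rw [if_neg]; rintro rfl; exact h hv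

theorem ex_sub {I : Inst V} {A B : Finset V} {a : V} (hA : A ⊆ I.Q) (hB : B ⊆ (I.con A a).Q) (ha : a ∈ A) :
    ex A a B ⊆ I.Q := by
  have h1 : B ⊆ I.Q := by
    intro x hx
    have := hB hx
    simp only [con, mem_insert, mem_sdiff] at this
    rcases this with rfl | h
    · exact hA ha
    · exact h.1
  unfold ex
  split_ifs
  · exact union_subset h1 hA
  · exact h1

theorem tt_con {I : Inst V} {A B : Finset V} {a : V} (ha : a ∈ A) (hB : B ⊆ (I.con A a).Q) :
    (I.con A a).tt B = I.tt (ex A a B) := by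
  refine sm_con _ ha fun x hx hxA => ?_
  have := hB hx
  simp only [con, mem_insert, mem_sdiff] at this
  tauto

theorem dd_con {I : Inst V} {A B : Finset V} {a : V} (hA : A ⊆ I.Q) (ha : a ∈ A) (hB : B ⊆ (I.con A a).Q) :
    (I.con A a).dd B = I.dd (ex A a B) := by
  have hd : ∀ x ∈ B, x ∈ A → x = a := by
    intro x hx hxA
    have := hB hx
    simp only [con, mem_insert, mem_sdiff] at this
    tauto
  have key : ee (I.con A a).μ B ((I.con A a).Q \ B) = ee I.μ (ex A a B) (I.Q \ ex A a B) := by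
    have l1 : ∀ B C, a ∉ B → a ∉ C → ee (I.con A a).μ B C = ee I.μ B C := by
      intro B C hB hC
      refine Finset.sum_congr rfl fun x hx => Finset.sum_congr rfl fun y hy => ?_
      have : x ≠ a := fun h => hB (h ▸ hx)
      have : y ≠ a := fun h => hC (h ▸ hy)
      simp [con, *]
    have l2 : ∀ C, a ∉ C → ee (I.con A a).μ {a} C = ee I.μ A C := by
      intro C hC
      rw [ee_singleton_left]
      unfold ee
      rw [Finset.sum_comm]
      refine Finset.sum_congr rfl fun y hy => ?_
      have : y ≠ a := fun h => hC (h ▸ hy)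
      simp [con, *]
    have l3 : ∀ C, a ∉ C → ee (I.con A a).μ C {a} = ee I.μ C A := by
      intro C hC
      rw [ee_singleton_right]
      unfold ee
      refine Finset.sum_congr rfl fun y hy => ?_
      have : y ≠ a := fun h => hC (h ▸ hy)
      simp [con, *]
    unfold ex
    split_ifs with h
    · have e1 : (I.con A a).Q \ B = I.Q \ (B ∪ A) := by
        ext x; simp only [con, mem_sdiff, mem_insert, mem_union]
        by_cases hx : x = a
        · subst hx; simp [h]
        · simp [hx]; tauto
      have e : B ∪ A = B.erase a ∪ A := by
        ext x; simp only [mem_union, mem_erase]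
        by_cases hx : x = a
        · subst hx; simp [ha]
        · simp [hx]
      have d : Disjoint (B.erase a) A := by
        rw [disjoint_left]; intro x hx hx'
        rw [mem_erase] at hx; exact hx.1 (hd x hx.2 hx')
      have hn : a ∉ I.Q \ (B ∪ A) := by simp [ha]
      rw [e1]
      conv_rhs => rw [show ee I.μ (B ∪ A) (I.Q \ (B ∪ A)) = ee I.μ (B.erase a ∪ A) (I.Q \ (B ∪ A)) by rw [e]]
      rw [ee_union_left _ _ d, ← l2 _ hn, ← l1 _ _ (by simp) hn, ← ee_union_left]
      · congr 1; rw [union_comm, ← insert_eq, insert_erase h]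
      · simp
    · have e1 : (I.con A a).Q \ B = ((I.Q \ A) \ B) ∪ {a} := by
        ext x; simp only [con, mem_sdiff, mem_insert, mem_union, mem_singleton]
        by_cases hx : x = a
        · subst hx; simp [h]
        · simp [hx]
      have e2 : I.Q \ B = ((I.Q \ A) \ B) ∪ A := by
        ext x; simp only [mem_sdiff, mem_union]
        have h1 : x ∈ A → x ∈ I.Q := fun h => hA h
        have h2 : x ∈ A → x ∉ B := fun h1 h2 => h (hd x h2 h1 ▸ h2)
        tauto
      rw [e1, e2, ee_union_right, ee_union_right, l1 _ _ h (by simp [ha]), l3 _ h]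
      · rw [disjoint_left]; intro x; simp only [mem_sdiff]; tauto
      · simp [ha]
  unfold dd
  rw [key]
  congr 1
  · congr 1
    · congr 1
      exact sm_con _ ha hd
    · exact sm_con _ ha hd
  · exact sm_con _ ha hd

theorem ok_con {I : Inst V} (h : I.Ok) {A : Finset V} {a : V} (hA : A ⊆ I.Q) (ha : a ∈ A) : (I.con A a).Ok where
  symm := by
    intro x y; simp only [con]
    split_ifs
    · rfl
    · exact sum_congr rfl fun u _ => h.symm _ _
    · exact sum_congr rfl fun u _ => h.symm _ _
    · exact h.symm _ _
  nn := by
    intro x y; simp only [con]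
    split_ifs
    · rfl
    · exact sum_nonneg fun u _ => h.nn _ _
    · exact sum_nonneg fun u _ => h.nn _ _
    · exact h.nn _ _
  diag := by
    intro x; simp only [con]
    split_ifs
    · rfl
    · exact h.diag _
  o0 := by
    intro v hv; simp only [con, mem_insert, mem_sdiff] at hv ⊢
    split_ifs with h1
    · exact sm_nonneg fun v hv => h.o0 v (hA hv)
    · exact h.o0 v (hv.resolve_left h1).1
  i0 := by
    intro v hv; simp only [con, mem_insert, mem_sdiff] at hv ⊢
    split_ifs with h1
    · exact sm_nonneg fun v hv => h.i0 v (hA hv)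
    · exact h.i0 v (hv.resolve_left h1).1
  φ0 := by
    intro v hv; simp only [con, mem_insert, mem_sdiff] at hv ⊢
    split_ifs with h1
    · exact sm_nonneg fun v hv => h.φ0 v (hA hv)
    · exact h.φ0 v (hv.resolve_left h1).1
  par := by
    intro v hv
    have hs : {v} ⊆ (I.con A a).Q := by simpa using hv
    rw [← tt_singleton, dd_con hA ha hs, tt_con ha hs]
    exact dd_par h (ex_sub hA hs ha)

theorem sum_con {I : Inst V} {A : Finset V} {a : V} (hA : A ⊆ I.Q) (ha : a ∈ A) (F : V → ℤ) :
    ∑ v ∈ (I.con A a).Q, F v = F a + ∑ v ∈ I.Q \ A, F v := by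
  simp only [con]; rw [sum_insert]; simp [ha]

theorem size_con {I : Inst V} (h : I.Ok) {A : Finset V} {a : V} (hA : A ⊆ I.Q) (ha : a ∈ A)
    (h2 : 2 ≤ A.card) : (I.con A a).size < I.size := by
  unfold size
  rw [sum_con hA ha]
  have e : ∑ v ∈ I.Q, (I.dd {v} + 1) = ∑ v ∈ I.Q \ A, (I.dd {v} + 1) + ∑ v ∈ A, (I.dd {v} + 1) :=
    (sum_sdiff hA).symm
  have e2 : ∑ v ∈ I.Q \ A, ((I.con A a).dd {v} + 1) = ∑ v ∈ I.Q \ A, (I.dd {v} + 1) := by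
    refine sum_congr rfl fun v hv => ?_
    have hva : a ≠ v := by rintro rfl; exact (mem_sdiff.1 hv).2 ha
    rw [dd_con hA ha (by simpa [con] using Or.inr (mem_sdiff.1 hv))]
    simp [ex, hva]
  rw [e, e2, dd_con hA ha (by simp [con]), sum_add_distrib (s := A), sum_dd h hA]
  have h3 : ex A a {a} = A := by simp [ex, ha]
  rw [h3]
  have := ee_nonneg h.nn A A
  simp only [sum_const, nsmul_eq_mul, mul_one]
  omega

end Inst
end FR

open Finset
set_option linter.unusedSectionVars false
namespace FR
namespace Inst
variable {V : Type*} [DecidableEq V]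

theorem glue {I : Inst V} (h : I.Ok) {A : Finset V} {a : V} (hA : A ⊆ I.Q) (ha : a ∈ A) {r1 : V → ℤ}
    (hF : (I.con A a).Feas r1) : ∃ o' i' : V → ℤ,
    (∀ v ∈ A, 0 ≤ o' v ∧ 0 ≤ i' v ∧
      o' v + i' v = I.o v + I.i v + I.φ v + ∑ w ∈ I.Q \ A, I.μ v w) ∧
    sm i' A = r1 a ∧
    ∀ t' r2, Feas ⟨A, I.μ, o', i', fun _ => 0, t'⟩ r2 → I.Feas (fun v => if v ∈ A then r2 v else r1 v) := by
  obtain ⟨f1, p1, h1, h2, h3⟩ := hF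
  have haQ : a ∈ (I.con A a).Q := by simp [con]
  have hQQ : ∀ v ∈ I.Q \ A, v ∈ (I.con A a).Q := fun v hv => by simp only [con, mem_insert]; exact Or.inr hv
  have hne : ∀ v ∈ I.Q \ A, v ≠ a := fun v hv e => (mem_sdiff.1 hv).2 (e ▸ ha)
  -- split the flow from outside
  have hg : ∀ v, ∃ g : V → ℤ, v ∈ I.Q \ A → (∀ u ∈ A, 0 ≤ g u ∧ g u ≤ I.μ v u) ∧ ∑ u ∈ A, g u = f1 v a := by
    intro v
    by_cases hv : v ∈ I.Q \ A
    · have e1 := h1 v (hQQ v hv) a haQ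
      have e2 := h1 a haQ v (hQQ v hv)
      have e3 : (I.con A a).μ v a = ∑ u ∈ A, I.μ v u := by simp [con, hne v hv]
      obtain ⟨g, hg, hg'⟩ := split A (I.μ v) (fun u _ => h.nn _ _) (f1 v a) e1.1 (by omega)
      exact ⟨g, fun _ => ⟨hg, hg'⟩⟩
    · exact ⟨fun _ => 0, fun h => absurd h hv⟩
  choose g hg using hg
  have e4 : (I.con A a).φ a = sm I.φ A := by simp [con]
  obtain ⟨q, hq, hq'⟩ := split A I.φ (fun u hu => h.φ0 u (hA hu)) (p1 a) (h2 a haQ).1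
    (by have := (h2 a haQ).2; unfold sm at e4; omega)
  refine ⟨fun u => I.o u + ∑ v ∈ I.Q \ A, g v u + (I.φ u - q u),
    fun u => I.i u + ∑ v ∈ I.Q \ A, (I.μ u v - g v u) + q u, ?_, ?_, ?_⟩
  · intro u hu
    have a1 := h.o0 u (hA hu)
    have a2 := h.i0 u (hA hu)
    have a3 := hq u hu
    have a4 : 0 ≤ ∑ v ∈ I.Q \ A, g v u := sum_nonneg fun v hv => ((hg v hv).1 u hu).1
    have a5 : 0 ≤ ∑ v ∈ I.Q \ A, (I.μ u v - g v u) := sum_nonneg fun v hv => by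
      have := ((hg v hv).1 u hu).2
      rw [h.symm] at this; omega
    beta_reduce
    refine ⟨by omega, by omega, ?_⟩
    rw [sum_sub_distrib]; ring
  · have h3a := h3 a haQ
    rw [sum_con hA ha] at h3a
    have b1 : f1 a a = 0 := by
      have := h1 a haQ a haQ
      simp only [con, if_true] at this; omega
    have b2 : (I.con A a).i a = sm I.i A := by simp [con]
    rw [h3a, b1, b2]
    unfold sm
    rw [sum_add_distrib, sum_add_distrib, hq', sum_comm]
    have : ∑ v ∈ I.Q \ A, ∑ u ∈ A, (I.μ u v - g v u) = ∑ v ∈ I.Q \ A, f1 a v := by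
      refine sum_congr rfl fun v hv => ?_
      have e1 := (h1 a haQ v (hQQ v hv)).2
      have e3 : (I.con A a).μ a v = ∑ u ∈ A, I.μ u v := by simp [con, hne v hv]
      rw [sum_sub_distrib, (hg v hv).2]; omega
    rw [this]; ring
  · rintro t' r2 ⟨f2, p2, k1, k2, k3⟩
    simp only at k1 k2 k3
    refine ⟨fun u v => if u ∈ A then (if v ∈ A then f2 u v else I.μ u v - g v u)
      else (if v ∈ A then g u v else f1 u v), fun v => if v ∈ A then q v else p1 v, ?_, ?_, ?_⟩
    · intro u hu v hv
      by_cases hu' : u ∈ A <;> by_cases hv' : v ∈ A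
      · simp only [hu', hv', if_true]; exact k1 u hu' v hv'
      · simp only [hu', hv', if_true, if_false]
        have := (hg v (mem_sdiff.2 ⟨hv, hv'⟩)).1 u hu'
        have := h.symm u v
        omega
      · simp only [hu', hv', if_true, if_false]
        have := (hg u (mem_sdiff.2 ⟨hu, hu'⟩)).1 v hv'
        have := h.symm u v
        omega
      · simp only [hu', hv', if_false]
        have hu := mem_sdiff.2 ⟨hu, hu'⟩
        have hv := mem_sdiff.2 ⟨hv, hv'⟩
        have := h1 u (hQQ u hu) v (hQQ v hv)
        simpa [con, hne u hu, hne v hv] using this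
    · intro v hv
      by_cases hv' : v ∈ A
      · simp only [hv', if_true]; exact hq v hv'
      · have hv := mem_sdiff.2 ⟨hv, hv'⟩
        have := h2 v (hQQ v hv)
        simpa [con, hne v hv, hv'] using this
    · intro v hv
      have hS : ∀ F : V → ℤ, ∑ u ∈ I.Q, F u = ∑ u ∈ I.Q \ A, F u + ∑ u ∈ A, F u := fun F => (sum_sdiff hA).symm
      rw [hS]
      by_cases hv' : v ∈ A
      · simp only [hv', if_true]
        rw [sum_congr rfl (g := fun u => I.μ v u - g u v) (s₁ := I.Q \ A) (fun u hu => by simp [(mem_sdiff.1 hu).2]),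
          sum_congr rfl (g := fun u => f2 v u) (s₁ := A) (fun u hu => by simp [hu]), k3 v hv']
        have := k2 v hv'
        omega
      · simp only [hv', if_false]
        have hv := mem_sdiff.2 ⟨hv, hv'⟩
        rw [sum_congr rfl (g := fun u => f1 v u) (s₁ := I.Q \ A) (fun u hu => by simp [(mem_sdiff.1 hu).2]),
          sum_congr rfl (g := fun u => g v u) (s₁ := A) (fun u hu => by simp [hu]), (hg v hv).2,
          h3 v (hQQ v hv), sum_con hA ha]
        simp only [con, hne v hv, if_false]
        ring

/-- the sub-instance on `A` in which everything outside `A` is merged into the free vertex -/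
def sub (I : Inst V) (A : Finset V) : Inst V :=
  ⟨A, I.μ, I.o, I.i, fun v => I.φ v + ∑ w ∈ I.Q \ A, I.μ v w, I.t⟩

theorem free {I : Inst V} (h : I.Ok) {A : Finset V} (hA : A ⊆ I.Q) {r1 : V → ℤ}
    (hF : (I.sub A).Feas r1) : ∃ (o' i' : V → ℤ) (P : ℤ),
    (∀ v ∈ I.Q \ A, I.o v ≤ o' v ∧ I.i v ≤ i' v ∧ o' v + i' v = I.o v + I.i v + ∑ w ∈ A, I.μ v w) ∧
    sm o' (I.Q \ A) ≤ sm I.o (I.Q \ A) + P ∧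
    sm i' (I.Q \ A) ≤ sm I.i (I.Q \ A) + sm (I.sub A).φ A - P ∧
    2 * sm r1 A = ee I.μ A A + 2 * P + 2 * sm I.i A ∧
    0 ≤ P ∧ P ≤ sm (I.sub A).φ A ∧
    ∀ t' r2, Feas ⟨I.Q \ A, I.μ, o', i', I.φ, t'⟩ r2 → I.Feas (fun v => if v ∈ A then r1 v else r2 v) := by
  obtain ⟨f1, p1, hf⟩ := hF
  have hr := sum_r (I := I.sub A) ?_ hf
  obtain ⟨h1, h2, h3⟩ := hf
  simp only [sub] at h1 h2 h3 hr
  have hg : ∀ u, ∃ g : V → ℤ, u ∈ A → (∀ w ∈ I.Q \ A, 0 ≤ g w ∧ g w ≤ I.μ u w) ∧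
      ∑ w ∈ I.Q \ A, g w = p1 u - min (p1 u) (I.φ u) := by
    intro u
    by_cases hu : u ∈ A
    · have e1 := h2 u hu
      have e2 := h.φ0 u (hA hu)
      have e3 : 0 ≤ ∑ w ∈ I.Q \ A, I.μ u w := sum_nonneg fun w _ => h.nn _ _
      obtain ⟨g, hg, hg'⟩ := split (I.Q \ A) (I.μ u) (fun w _ => h.nn _ _) (p1 u - min (p1 u) (I.φ u))
        (by omega) (by omega)
      exact ⟨g, fun _ => ⟨hg, hg'⟩⟩
    · exact ⟨fun _ => 0, fun h => absurd h hu⟩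
  choose g hg using hg
  have hgs : ∑ w ∈ I.Q \ A, ∑ u ∈ A, g u w = ∑ u ∈ A, (p1 u - min (p1 u) (I.φ u)) := by
    rw [sum_comm]; exact sum_congr rfl fun u hu => (hg u hu).2
  refine ⟨fun w => I.o w + ∑ u ∈ A, g u w, fun w => I.i w + ∑ u ∈ A, (I.μ u w - g u w), sm p1 A,
    ?_, ?_, ?_, by omega, ?_, ?_, ?_⟩
  · intro w hw
    have a4 : 0 ≤ ∑ u ∈ A, g u w := sum_nonneg fun u hu => ((hg u hu).1 w hw).1
    have a5 : 0 ≤ ∑ u ∈ A, (I.μ u w - g u w) := sum_nonneg fun u hu => by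
      have := ((hg u hu).1 w hw).2
      omega
    beta_reduce
    refine ⟨by omega, by omega, ?_⟩
    rw [sum_sub_distrib, sum_congr rfl fun u _ => h.symm u w]; ring
  · rw [sm_add]
    have : ∑ u ∈ A, (p1 u - min (p1 u) (I.φ u)) ≤ ∑ u ∈ A, p1 u := sum_le_sum fun u hu => by
      have := h2 u hu; have := h.φ0 u (hA hu); omega
    have e : sm (fun w => ∑ u ∈ A, g u w) (I.Q \ A) = ∑ u ∈ A, (p1 u - min (p1 u) (I.φ u)) := hgs
    have e' : sm p1 A = ∑ u ∈ A, p1 u := rfl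
    omega
  · rw [sm_add]
    have e : sm (fun w => ∑ u ∈ A, (I.μ u w - g u w)) (I.Q \ A) =
        ∑ u ∈ A, (∑ w ∈ I.Q \ A, I.μ u w - (p1 u - min (p1 u) (I.φ u))) := by
      unfold sm
      simp only [sum_sub_distrib] at hgs ⊢
      rw [← hgs, sum_comm]
    rw [e]
    have : ∑ u ∈ A, (∑ w ∈ I.Q \ A, I.μ u w - (p1 u - min (p1 u) (I.φ u))) ≤ sm (I.sub A).φ A - sm p1 A := by
      unfold sm; rw [← sum_sub_distrib]
      exact sum_le_sum fun u hu => by simp only [sub]; omega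
    omega
  · exact sm_nonneg fun v hv => (h2 v hv).1
  · exact sum_le_sum fun v hv => (h2 v hv).2
  · rintro t' r2 ⟨f2, p2, k1, k2, k3⟩
    simp only at k1 k2 k3
    refine ⟨fun u v => if u ∈ A then (if v ∈ A then f1 u v else g u v)
      else (if v ∈ A then I.μ u v - g v u else f2 u v),
      fun v => if v ∈ A then min (p1 v) (I.φ v) else p2 v, ?_, ?_, ?_⟩
    · intro u hu v hv
      by_cases hu' : u ∈ A <;> by_cases hv' : v ∈ A
      · simp only [hu', hv', if_true]; exact h1 u hu' v hv'
      · simp only [hu', hv', if_true, if_false]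
        have := (hg u hu').1 v (mem_sdiff.2 ⟨hv, hv'⟩)
        have := h.symm u v
        omega
      · simp only [hu', hv', if_true, if_false]
        have := (hg v hv').1 u (mem_sdiff.2 ⟨hu, hu'⟩)
        have := h.symm u v
        omega
      · simp only [hu', hv', if_false]
        exact k1 u (mem_sdiff.2 ⟨hu, hu'⟩) v (mem_sdiff.2 ⟨hv, hv'⟩)
    · intro v hv
      by_cases hv' : v ∈ A
      · simp only [hv', if_true]
        have := h2 v hv'; have := h.φ0 v (hA hv'); omega
      · simp only [hv', if_false]
        exact k2 v (mem_sdiff.2 ⟨hv, hv'⟩)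
    · intro v hv
      have hS : ∀ F : V → ℤ, ∑ u ∈ I.Q, F u = ∑ u ∈ I.Q \ A, F u + ∑ u ∈ A, F u := fun F => (sum_sdiff hA).symm
      rw [hS]
      by_cases hv' : v ∈ A
      · simp only [hv', if_true]
        rw [sum_congr rfl (g := fun u => g v u) (s₁ := I.Q \ A) (fun u hu => by simp [(mem_sdiff.1 hu).2]),
          sum_congr rfl (g := fun u => f1 v u) (s₁ := A) (fun u hu => by simp [hu]), (hg v hv').2, h3 v hv']
        omega
      · simp only [hv', if_false]
        have hv := mem_sdiff.2 ⟨hv, hv'⟩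
        rw [sum_congr rfl (g := fun u => f2 v u) (s₁ := I.Q \ A) (fun u hu => by simp [(mem_sdiff.1 hu).2]),
          sum_congr rfl (g := fun u => I.μ u v - g u v) (s₁ := A) (fun u hu => by simp [hu, h.symm v u]),
          k3 v hv]
        ring
  · refine ok_restrict h rfl hA (fun _ _ => rfl) ?_ (fun v hv => h.o0 v (hA hv)) (fun v hv => h.i0 v (hA hv)) ?_
    · intro v hv; simp only [sub]; ring
    · intro v hv; simp only [sub]
      have := h.φ0 v (hA hv)
      have : 0 ≤ ∑ w ∈ I.Q \ A, I.μ v w := sum_nonneg fun w _ => h.nn _ _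
      omega

theorem ok_sub {I : Inst V} (h : I.Ok) {A : Finset V} (hA : A ⊆ I.Q) : (I.sub A).Ok := by
  refine ok_restrict h rfl hA (fun _ _ => rfl) ?_ (fun v hv => h.o0 v (hA hv)) (fun v hv => h.i0 v (hA hv)) ?_
  · intro v hv; simp only [sub]; ring
  · intro v hv; simp only [sub]
    have := h.φ0 v (hA hv)
    have : 0 ≤ ∑ w ∈ I.Q \ A, I.μ v w := sum_nonneg fun w _ => h.nn _ _
    omega

theorem dd_sub {I : Inst V} {A C : Finset V} (hA : A ⊆ I.Q) (hC : C ⊆ A) : (I.sub A).dd C = I.dd C :=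
  dd_restrict (I := I) (J := I.sub A) rfl hA (fun v _ => by simp only [sub]; ring) hC

theorem size_sub {I : Inst V} (h : I.Ok) {A : Finset V} (hA : A ⊂ I.Q) : (I.sub A).size < I.size :=
  size_restrict (I := I) (J := I.sub A) h rfl hA (fun v _ => by simp only [sub]; ring)

end Inst
end FR

open Finset
set_option linter.unusedSectionVars false
namespace FR
namespace Inst
variable {V : Type*} [DecidableEq V]

/-- indicator of a directed arc -/
def da (u w x y : V) : ℤ := if x = u ∧ y = w then 1 else 0
theorem ed_da (u w x y : V) : ed u w x y = da u w x y + da w u x y := rfl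
theorem da_flip (u w x y : V) : da u w y x = da w u x y := by unfold da; simp only [and_comm]
theorem da_nonneg (u w x y : V) : 0 ≤ da u w x y := by unfold da; split_ifs <;> norm_num
theorem da_le {f : V → V → ℤ} {u w x y : V} (h : 0 ≤ f x y) (h1 : 1 ≤ f u w) : da u w x y ≤ f x y := by
  unfold da; split_ifs with h2
  · rw [h2.1, h2.2]; exact h1
  · exact h
theorem sum_da {Q : Finset V} {u w : V} (hw : w ∈ Q) (x : V) : ∑ y ∈ Q, da u w x y = dl u x := by
  unfold da dl
  by_cases h : x = u
  · simp [h, hw]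
  · simp [h]
theorem dl_nonneg (u x : V) : 0 ≤ dl u x := by unfold dl; split_ifs <;> norm_num
theorem dl_le {g : V → ℤ} {u x : V} (h : 0 ≤ g x) (h1 : 1 ≤ g u) : dl u x ≤ g x := by
  unfold dl; split_ifs with h2
  · rw [h2]; exact h1
  · exact h

theorem ed2_le {u w w' : V} (hw : u ≠ w) (hw' : u ≠ w') (h : w ≠ w') {μ : V → V → ℤ} (hs : ∀ x y, μ x y = μ y x)
    (h0 : ∀ x y, 0 ≤ μ x y) (h1 : 1 ≤ μ u w) (h2 : 1 ≤ μ u w') (x y : V) :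
    ed u w x y + ed u w' x y ≤ μ x y := by
  have a1 := ed_le hw hs h0 h1 x y
  have a2 := ed_le hw' hs h0 h2 x y
  unfold ed at *
  by_cases c1 : x = u
  · subst c1
    by_cases c2 : y = w
    · subst c2; simp_all
    · simp_all
  · by_cases c2 : x = w
    · subst c2; simp_all
    · simp_all

structure Lft (I : Inst V) (v : V) (I' : Inst V) : Prop where
  Q : I'.Q = I.Q
  t : I'.t = I.t
  ok : I'.Ok
  feas : ∀ r, I'.Feas r → I.Feas (fun u => r u + dl v u)
  dle : ∀ A ⊆ I.Q, I'.dd A ≤ I.dd A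
  dge : ∀ A ⊆ I.Q, I.dd A ≤ I'.dd A + 2
  dv : I'.dd {v} = I.dd {v} - 2
  dw : ∀ u ∈ I.Q, u ≠ v → I'.dd {u} = I.dd {u}
  net : (∀ u ∈ I.Q, I.φ u = 0) → sm I'.i I.Q - sm I'.o I.Q = sm I.i I.Q - sm I.o I.Q
  φz : (∀ u ∈ I.Q, I.φ u = 0) → ∀ u ∈ I.Q, I'.φ u = 0
  iz : (∀ u ∈ I.Q, I.i u = 0) → ∀ u ∈ I.Q, I'.i u = 0
  ob : ∀ A ⊆ I.Q, 2 * sm I'.o A - I'.dd A ≤ 2 * sm I.o A - I.dd A + 2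
  oQ : sm I'.o I.Q ≤ sm I.o I.Q
  oQ2 : I.i v = 0 → 2 * sm I'.o I.Q - I'.dd I.Q ≤ 2 * sm I.o I.Q - I.dd I.Q

theorem par_of {I I' : Inst V} (h : I.Ok) {v : V} (ht : I'.t = I.t) (dv : I'.dd {v} = I.dd {v} - 2)
    (dw : ∀ u ∈ I.Q, u ≠ v → I'.dd {u} = I.dd {u}) : ∀ u ∈ I.Q, 2 ∣ I'.dd {u} - I'.t u := by
  intro u hu
  rw [ht]
  have := h.par u hu
  by_cases huv : u = v
  · subst huv; rw [dv]; omega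
  · rw [dw u hu huv]; exact this

theorem ne_of_mu {I : Inst V} (h : I.Ok) {v w : V} (h1 : 1 ≤ I.μ v w) : v ≠ w := by
  rintro rfl; rw [h.diag] at h1; omega

theorem lft_ww {I : Inst V} (h : I.Ok) {v w w' : V} (hv : v ∈ I.Q) (hw : w ∈ I.Q) (hw' : w' ∈ I.Q)
    (hn : w ≠ w') (h1 : 1 ≤ I.μ v w) (h2 : 1 ≤ I.μ v w') :
    Lft I v ⟨I.Q, fun x y => I.μ x y - ed v w x y - ed v w' x y + ed w w' x y, I.o, I.i, I.φ, I.t⟩ := by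
  have n1 := ne_of_mu h h1
  have n2 := ne_of_mu h h2
  set I' : Inst V := ⟨I.Q, fun x y => I.μ x y - ed v w x y - ed v w' x y + ed w w' x y, I.o, I.i, I.φ, I.t⟩ with hI'
  have D : ∀ A ⊆ I.Q, I'.dd A = I.dd A - (if v ∈ A ∧ w ∉ A ∧ w' ∉ A ∨ v ∉ A ∧ w ∈ A ∧ w' ∈ A then 2 else 0) := by
    intro A _
    unfold dd
    simp only [hI', ee_add, ee_sub, ee_ed, mem_sdiff, hv, hw, hw', true_and]
    by_cases c1 : v ∈ A <;> by_cases c2 : w ∈ A <;> by_cases c3 : w' ∈ A <;> simp [c1, c2, c3] <;> ring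
  have dv : I'.dd {v} = I.dd {v} - 2 := by
    rw [D _ (by simpa using hv)]; simp [n1.symm, n2.symm]
  have dw : ∀ u ∈ I.Q, u ≠ v → I'.dd {u} = I.dd {u} := by
    intro u hu huv
    rw [D _ (by simpa using hu), if_neg]
    · ring
    · simp only [mem_singleton]
      rintro (c | c)
      · exact huv c.1.symm
      · exact hn (c.2.1.trans c.2.2.symm)
  have hO : I'.Ok := by
    refine ⟨?_, ?_, ?_, h.o0, h.i0, h.φ0, par_of (I := I) h rfl dv dw⟩
    · intro x y; simp only [hI']; rw [h.symm x y, ed_symm v w, ed_symm v w', ed_symm w w']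
    · intro x y; simp only [hI']
      have := ed2_le n1 n2 hn h.symm h.nn h1 h2 x y
      have := ed_nonneg w w' x y
      omega
    · intro x; simp only [hI']; rw [h.diag, ed_diag n1, ed_diag n2, ed_diag hn]; rfl
  have feas1 : ∀ r f p, I'.FeasW r f p → ∀ a b, a ∈ I.Q → b ∈ I.Q → (∀ x y, ed a b x y = ed w w' x y) →
      (∀ x y, ed v a x y + ed v b x y = ed v w x y + ed v w' x y) →
      1 ≤ f a b → I.Feas (fun u => r u + dl v u) := by
    rintro r f p ⟨k1, k2, k3⟩ a b ha hb e1 e2 hf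
    refine ⟨fun x y => f x y - da a b x y + da a v x y + da v b x y, p, ?_, k2, ?_⟩
    · intro x hx y hy
      have b1 := k1 x hx y hy
      have b2 := da_le b1.1 hf
      have b3 := da_nonneg a v x y
      have b4 := da_nonneg v b x y
      beta_reduce
      refine ⟨by omega, ?_⟩
      have e1 := e1 x y
      have e2 := e2 x y
      simp only [da_flip _ _ x y, ed_da, hI'] at *
      omega
    · intro x hx
      have b1 := k3 x hx
      simp only [hI'] at b1
      simp only [sum_add_distrib, sum_sub_distrib]
      rw [sum_da hb, sum_da hv, sum_da hb]
      omega
  refine ⟨rfl, rfl, hO, ?_, ?_, ?_, dv, dw, fun _ => rfl, fun a => a, fun a => a, ?_, le_rfl, ?_⟩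
  · rintro r ⟨f, p, hF⟩
    have b1 := hF.1 w hw w' hw'
    have b2 := hF.1 w' hw' w hw
    have b3 : 1 ≤ I'.μ w w' := by
      have := ed2_le n1 n2 hn h.symm h.nn h1 h2 w w'
      have b4 : ed w w' w w' = 1 := by simp [ed, hn]
      simp only [hI']; omega
    by_cases c : 1 ≤ f w w'
    · exact feas1 r f p hF w w' hw hw' (fun _ _ => rfl) (fun _ _ => rfl) c
    · exact feas1 r f p hF w' w hw' hw (fun x y => by simp only [ed_da]; ring) (fun _ _ => by ring) (by omega)
  · intro A hA; rw [D A hA]; split_ifs <;> omega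
  · intro A hA; rw [D A hA]; split_ifs <;> omega
  · intro A hA; rw [D A hA]; simp only [hI']; split_ifs <;> omega
  · intro _; rw [D _ subset_rfl]; simp only [hI', hv, hw, hw']; simp

theorem lft_ow {I : Inst V} (h : I.Ok) {v w : V} (hv : v ∈ I.Q) (hw : w ∈ I.Q)
    (h1 : 1 ≤ I.μ v w) (h2 : 1 ≤ I.o v) :
    Lft I v ⟨I.Q, fun x y => I.μ x y - ed v w x y, fun x => I.o x - dl v x + dl w x, I.i, I.φ, I.t⟩ := by
  have n1 := ne_of_mu h h1
  set I' : Inst V := ⟨I.Q, fun x y => I.μ x y - ed v w x y, fun x => I.o x - dl v x + dl w x, I.i, I.φ, I.t⟩ with hI'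
  have D : ∀ A ⊆ I.Q, I'.dd A = I.dd A - (if v ∈ A ∧ w ∉ A then 2 else 0) := by
    intro A _
    unfold dd
    simp only [hI', ee_sub, ee_ed, mem_sdiff, hv, hw, true_and, sm_add, sm_sub, sm_dl]
    by_cases c1 : v ∈ A <;> by_cases c2 : w ∈ A <;> simp [c1, c2] <;> ring
  have dv : I'.dd {v} = I.dd {v} - 2 := by
    rw [D _ (by simpa using hv)]; simp [n1.symm]
  have dw : ∀ u ∈ I.Q, u ≠ v → I'.dd {u} = I.dd {u} := by
    intro u hu huv
    rw [D _ (by simpa using hu), if_neg]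
    · ring
    · simp only [mem_singleton]
      rintro c
      exact huv c.1.symm
  have hO : I'.Ok := by
    refine ⟨?_, ?_, ?_, ?_, h.i0, h.φ0, par_of (I := I) h rfl dv dw⟩
    · intro x y; simp only [hI']; rw [h.symm x y, ed_symm v w]
    · intro x y; simp only [hI']
      have := ed_le n1 h.symm h.nn h1 x y
      omega
    · intro x; simp only [hI']; rw [h.diag, ed_diag n1]; rfl
    · intro x hx; simp only [hI']
      have := dl_le (h.o0 x hx) h2
      have := dl_nonneg w x
      omega
  refine ⟨rfl, rfl, hO, ?_, ?_, ?_, dv, dw, ?_, fun a => a, fun a => a, ?_, ?_, ?_⟩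
  · rintro r ⟨f, p, k1, k2, k3⟩
    refine ⟨fun x y => f x y + da v w x y, p, ?_, k2, ?_⟩
    · intro x hx y hy
      have b1 := k1 x hx y hy
      have b3 := da_nonneg v w x y
      beta_reduce
      refine ⟨by omega, ?_⟩
      simp only [da_flip _ _ x y, ed_da, hI'] at *
      omega
    · intro x hx
      have b1 := k3 x hx
      simp only [hI'] at b1
      simp only [sum_add_distrib]
      rw [sum_da hw]
      omega
  · intro A hA; rw [D A hA]; split_ifs <;> omega
  · intro A hA; rw [D A hA]; split_ifs <;> omega
  · intro _; simp only [hI', sm_add, sm_sub, sm_dl, hv, hw]; simp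
  · intro A hA; rw [D A hA]; simp only [hI', sm_add, sm_sub, sm_dl]
    by_cases c1 : v ∈ A <;> by_cases c2 : w ∈ A <;> simp [c1, c2] <;> omega
  · simp only [hI', sm_add, sm_sub, sm_dl, hv, hw]; simp
  · intro _; rw [D _ subset_rfl]; simp only [hI', sm_add, sm_sub, sm_dl, hv, hw]; simp

theorem lft_iw {I : Inst V} (h : I.Ok) {v w : V} (hv : v ∈ I.Q) (hw : w ∈ I.Q)
    (h1 : 1 ≤ I.μ v w) (h2 : 1 ≤ I.i v) :
    Lft I v ⟨I.Q, fun x y => I.μ x y - ed v w x y, I.o, fun x => I.i x - dl v x + dl w x, I.φ, I.t⟩ := by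
  have n1 := ne_of_mu h h1
  set I' : Inst V := ⟨I.Q, fun x y => I.μ x y - ed v w x y, I.o, fun x => I.i x - dl v x + dl w x, I.φ, I.t⟩ with hI'
  have D : ∀ A ⊆ I.Q, I'.dd A = I.dd A - (if v ∈ A ∧ w ∉ A then 2 else 0) := by
    intro A _
    unfold dd
    simp only [hI', ee_sub, ee_ed, mem_sdiff, hv, hw, true_and, sm_add, sm_sub, sm_dl]
    by_cases c1 : v ∈ A <;> by_cases c2 : w ∈ A <;> simp [c1, c2] <;> ring
  have dv : I'.dd {v} = I.dd {v} - 2 := by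
    rw [D _ (by simpa using hv)]; simp [n1.symm]
  have dw : ∀ u ∈ I.Q, u ≠ v → I'.dd {u} = I.dd {u} := by
    intro u hu huv
    rw [D _ (by simpa using hu), if_neg]
    · ring
    · simp only [mem_singleton]
      rintro c
      exact huv c.1.symm
  have hO : I'.Ok := by
    refine ⟨?_, ?_, ?_, h.o0, ?_, h.φ0, par_of (I := I) h rfl dv dw⟩
    · intro x y; simp only [hI']; rw [h.symm x y, ed_symm v w]
    · intro x y; simp only [hI']
      have := ed_le n1 h.symm h.nn h1 x y
      omega
    · intro x; simp only [hI']; rw [h.diag, ed_diag n1]; rfl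
    · intro x hx; simp only [hI']
      have := dl_le (h.i0 x hx) h2
      have := dl_nonneg w x
      omega
  refine ⟨rfl, rfl, hO, ?_, ?_, ?_, dv, dw, ?_, fun a => a, fun a => ?_, ?_, le_rfl, ?_⟩
  · rintro r ⟨f, p, k1, k2, k3⟩
    refine ⟨fun x y => f x y + da w v x y, p, ?_, k2, ?_⟩
    · intro x hx y hy
      have b1 := k1 x hx y hy
      have b3 := da_nonneg w v x y
      beta_reduce
      refine ⟨by omega, ?_⟩
      simp only [da_flip _ _ x y, ed_da, hI'] at *
      omega
    · intro x hx
      have b1 := k3 x hx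
      simp only [hI'] at b1
      simp only [sum_add_distrib]
      rw [sum_da hv]
      omega
  · intro A hA; rw [D A hA]; split_ifs <;> omega
  · intro A hA; rw [D A hA]; split_ifs <;> omega
  · intro _; simp only [hI', sm_add, sm_sub, sm_dl, hv, hw]; simp
  · have := a v hv; omega
  · intro A hA; rw [D A hA]; simp only [hI']; split_ifs <;> omega
  · intro c; omega

theorem lft_xw {I : Inst V} (h : I.Ok) {v w : V} (hv : v ∈ I.Q) (hw : w ∈ I.Q)
    (h1 : 1 ≤ I.μ v w) (h2 : 1 ≤ I.φ v) :
    Lft I v ⟨I.Q, fun x y => I.μ x y - ed v w x y, I.o, I.i, fun x => I.φ x - dl v x + dl w x, I.t⟩ := by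
  have n1 := ne_of_mu h h1
  set I' : Inst V := ⟨I.Q, fun x y => I.μ x y - ed v w x y, I.o, I.i, fun x => I.φ x - dl v x + dl w x, I.t⟩ with hI'
  have D : ∀ A ⊆ I.Q, I'.dd A = I.dd A - (if v ∈ A ∧ w ∉ A then 2 else 0) := by
    intro A _
    unfold dd
    simp only [hI', ee_sub, ee_ed, mem_sdiff, hv, hw, true_and, sm_add, sm_sub, sm_dl]
    by_cases c1 : v ∈ A <;> by_cases c2 : w ∈ A <;> simp [c1, c2] <;> ring
  have dv : I'.dd {v} = I.dd {v} - 2 := by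
    rw [D _ (by simpa using hv)]; simp [n1.symm]
  have dw : ∀ u ∈ I.Q, u ≠ v → I'.dd {u} = I.dd {u} := by
    intro u hu huv
    rw [D _ (by simpa using hu), if_neg]
    · ring
    · simp only [mem_singleton]
      rintro c
      exact huv c.1.symm
  have hO : I'.Ok := by
    refine ⟨?_, ?_, ?_, h.o0, h.i0, ?_, par_of (I := I) h rfl dv dw⟩
    · intro x y; simp only [hI']; rw [h.symm x y, ed_symm v w]
    · intro x y; simp only [hI']
      have := ed_le n1 h.symm h.nn h1 x y
      omega
    · intro x; simp only [hI']; rw [h.diag, ed_diag n1]; rfl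
    · intro x hx; simp only [hI']
      have := dl_le (h.φ0 x hx) h2
      have := dl_nonneg w x
      omega
  have dvw : dl v w = 0 := by unfold dl; rw [if_neg n1.symm]
  have dwv : dl w v = 0 := by unfold dl; rw [if_neg n1]
  have dvv : dl v v = 1 := by unfold dl; simp
  have dww : dl w w = 1 := by unfold dl; simp
  refine ⟨rfl, rfl, hO, ?_, ?_, ?_, dv, dw, fun _ => rfl, fun a => ?_, fun a => a, ?_, le_rfl, ?_⟩
  · rintro r ⟨f, p, k1, k2, k3⟩
    by_cases c : 1 ≤ p w
    · refine ⟨fun x y => f x y + da w v x y, fun x => p x - dl w x + dl v x, ?_, ?_, ?_⟩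
      · intro x hx y hy
        have b1 := k1 x hx y hy
        have b3 := da_nonneg w v x y
        beta_reduce
        refine ⟨by omega, ?_⟩
        simp only [da_flip _ _ x y, ed_da, hI'] at *
        omega
      · intro x hx
        have b1 := k2 x hx
        beta_reduce
        have b2 := dl_le (k2 x hx).1 c
        have := dl_nonneg v x
        simp only [hI'] at b1
        omega
      · intro x hx
        have b1 := k3 x hx
        simp only [hI'] at b1
        simp only [sum_add_distrib]
        rw [sum_da hv]
        omega
    · refine ⟨fun x y => f x y + da v w x y, fun x => p x, ?_, ?_, ?_⟩
      · intro x hx y hy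
        have b1 := k1 x hx y hy
        have b3 := da_nonneg v w x y
        beta_reduce
        refine ⟨by omega, ?_⟩
        simp only [da_flip _ _ x y, ed_da, hI'] at *
        omega
      · intro x hx
        have b1 := k2 x hx
        beta_reduce
        have := dl_nonneg v x
        simp only [hI'] at b1
        by_cases hxw : x = w
        · have := h.φ0 x hx; subst hxw; omega
        · have : dl w x = 0 := by unfold dl; rw [if_neg hxw]
          omega
      · intro x hx
        have b1 := k3 x hx
        simp only [hI'] at b1
        simp only [sum_add_distrib]
        rw [sum_da hw]
        omega
  · intro A hA; rw [D A hA]; split_ifs <;> omega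
  · intro A hA; rw [D A hA]; split_ifs <;> omega
  · have := a v hv; omega
  · intro A hA; rw [D A hA]; simp only [hI']; split_ifs <;> omega
  · intro _; rw [D _ subset_rfl]; simp only [hI', hv, hw]; simp

/-- lifts using two special ends; `a b c` flag which of `o`, `i`, `φ` are used -/
theorem lft_sp {I : Inst V} (h : I.Ok) {v : V} (hv : v ∈ I.Q) (a b c : ℤ)
    (h0 : a = 1 ∧ b = 1 ∧ c = 0 ∨ a = 1 ∧ b = 0 ∧ c = 1 ∨ a = 0 ∧ b = 1 ∧ c = 1)
    (h1 : a ≤ I.o v) (h2 : b ≤ I.i v) (h3 : c ≤ I.φ v) :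
    Lft I v ⟨I.Q, I.μ, fun x => I.o x - a * dl v x, fun x => I.i x - b * dl v x,
      fun x => I.φ x - c * dl v x, I.t⟩ := by
  set I' : Inst V := ⟨I.Q, I.μ, fun x => I.o x - a * dl v x, fun x => I.i x - b * dl v x,
      fun x => I.φ x - c * dl v x, I.t⟩ with hI'
  have sd : ∀ (z : ℤ) (A : Finset V), sm (fun x => z * dl v x) A = if v ∈ A then z else 0 := by
    intro z A; unfold sm; rw [← mul_sum, sum_dl]; simp
  have D : ∀ A ⊆ I.Q, I'.dd A = I.dd A - (if v ∈ A then 2 else 0) := by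
    intro A _
    unfold dd
    simp only [hI', sm_sub, sd]
    split_ifs
    · omega
    · ring
  have dv : I'.dd {v} = I.dd {v} - 2 := by
    rw [D _ (by simpa using hv)]; simp
  have dw : ∀ u ∈ I.Q, u ≠ v → I'.dd {u} = I.dd {u} := by
    intro u hu huv
    rw [D _ (by simpa using hu), if_neg]
    · ring
    · simp only [mem_singleton]
      exact huv.symm
  have nn : ∀ (g : V → ℤ) (z : ℤ), (z = 0 ∨ z = 1) → z ≤ g v → (∀ x ∈ I.Q, 0 ≤ g x) → ∀ x ∈ I.Q, 0 ≤ g x - z * dl v x := by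
    intro g z hz hzv hg x hx
    have := hg x hx
    by_cases hxv : x = v
    · subst hxv; simp [dl]; omega
    · simp [dl, hxv]; omega
  have hO : I'.Ok := by
    refine ⟨h.symm, h.nn, h.diag, ?_, ?_, ?_, par_of (I := I) h rfl dv dw⟩
    · exact nn _ a (by omega) h1 h.o0
    · exact nn _ b (by omega) h2 h.i0
    · exact nn _ c (by omega) h3 h.φ0
  refine ⟨rfl, rfl, hO, ?_, ?_, ?_, dv, dw, ?_, ?_, ?_, ?_, ?_, ?_⟩
  · rintro r ⟨f, p, k1, k2, k3⟩
    refine ⟨f, fun x => p x + (1 - b) * dl v x, k1, ?_, ?_⟩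
    · intro x hx
      have b1 := k2 x hx
      simp only [hI'] at b1
      beta_reduce
      have := dl_nonneg v x
      rcases h0 with ⟨rfl, rfl, rfl⟩ | ⟨rfl, rfl, rfl⟩ | ⟨rfl, rfl, rfl⟩ <;> omega
    · intro x hx
      have b1 := k3 x hx
      simp only [hI'] at b1
      simp only
      rw [b1]; ring
  · intro A hA; rw [D A hA]; split_ifs <;> omega
  · intro A hA; rw [D A hA]; split_ifs <;> omega
  · intro z
    have := z v hv
    simp only [hI', sm_sub, sd, hv, if_true]; omega
  · intro z u hu
    have := z v hv
    have hc : c = 0 := by omega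
    simp only [hI', hc]; have := z u hu; omega
  · intro z u hu
    have := z v hv
    have hc : b = 0 := by omega
    simp only [hI', hc]; have := z u hu; omega
  · intro A hA; rw [D A hA]; simp only [hI', sm_sub, sd]; split_ifs <;> omega
  · simp only [hI', sm_sub, sd, hv, if_true]; omega
  · intro z; rw [D _ subset_rfl]; simp only [hI', sm_sub, sd, hv, if_true]; omega

/-- either a lift at `v` is possible, or `v` is isolated, or all edges at `v` go to the same place -/
theorem exists_lft {I : Inst V} (h : I.Ok) {v : V} (hv : v ∈ I.Q) :
    (∃ I', Lft I v I') ∨ (I.o v = 0 ∧ I.i v = 0 ∧ I.φ v = 0 ∧ ∃ w ∈ I.Q, w ≠ v ∧ I.μ v w = I.dd {v} ∧ 0 < I.dd {v}) ∨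
    ((∀ w ∈ I.Q, I.μ v w = 0) ∧ (I.dd {v} = I.o v ∨ I.dd {v} = I.i v ∨ I.dd {v} = I.φ v)) := by
  have hd : I.dd {v} = ∑ w ∈ I.Q \ {v}, I.μ v w + I.o v + I.i v + I.φ v := by
    simp [dd, ee_singleton_left, sm_singleton]
  have c1 := h.o0 v hv
  have c2 := h.i0 v hv
  have c3 := h.φ0 v hv
  by_cases hw : ∃ w ∈ I.Q, 1 ≤ I.μ v w
  · obtain ⟨w, hw, hw1⟩ := hw
    by_cases h1 : 1 ≤ I.o v
    · exact Or.inl ⟨_, lft_ow h hv hw hw1 h1⟩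
    by_cases h2 : 1 ≤ I.i v
    · exact Or.inl ⟨_, lft_iw h hv hw hw1 h2⟩
    by_cases h3 : 1 ≤ I.φ v
    · exact Or.inl ⟨_, lft_xw h hv hw hw1 h3⟩
    by_cases hw' : ∃ w' ∈ I.Q, w ≠ w' ∧ 1 ≤ I.μ v w'
    · obtain ⟨w', hw', hn, hw2⟩ := hw'
      exact Or.inl ⟨_, lft_ww h hv hw hw' hn hw1 hw2⟩
    · push Not at hw'
      have n1 := ne_of_mu h hw1
      have : ∑ w' ∈ I.Q \ {v}, I.μ v w' = I.μ v w := by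
        refine sum_eq_single w ?_ ?_
        · intro b hb hbw
          have := hw' b (mem_sdiff.1 hb).1 hbw.symm
          have := h.nn v b
          omega
        · intro hn; exact absurd (by simp [hw, n1.symm]) hn
      exact Or.inr (Or.inl ⟨by omega, by omega, by omega, w, hw, n1.symm, by omega, by omega⟩)
  · push Not at hw
    have hz : ∀ w ∈ I.Q, I.μ v w = 0 := fun w hww => by
      have := hw w hww; have := h.nn v w; omega
    have : ∑ w' ∈ I.Q \ {v}, I.μ v w' = 0 := sum_eq_zero fun b hb => hz b (mem_sdiff.1 hb).1
    by_cases h1 : 1 ≤ I.o v <;> by_cases h2 : 1 ≤ I.i v <;> by_cases h3 : 1 ≤ I.φ v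
    · exact Or.inl ⟨_, lft_sp h hv 1 1 0 (by simp) h1 h2 (by omega)⟩
    · exact Or.inl ⟨_, lft_sp h hv 1 1 0 (by simp) h1 h2 (by omega)⟩
    · exact Or.inl ⟨_, lft_sp h hv 1 0 1 (by simp) h1 (by omega) h3⟩
    · exact Or.inr (Or.inr ⟨hz, by omega⟩)
    · exact Or.inl ⟨_, lft_sp h hv 0 1 1 (by simp) (by omega) h2 h3⟩
    · exact Or.inr (Or.inr ⟨hz, by omega⟩)
    · exact Or.inr (Or.inr ⟨hz, by omega⟩)
    · exact Or.inr (Or.inr ⟨hz, by omega⟩)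

theorem Lft.size {I I' : Inst V} {v : V} (L : Lft I v I') (hv : v ∈ I.Q) : I'.size < I.size := by
  unfold Inst.size
  rw [L.Q]
  refine sum_lt_sum (fun u hu => ?_) ⟨v, hv, ?_⟩
  · have := L.dle {u} (by simpa using hu); omega
  · rw [L.dv]; omega

theorem Lft.good {I I' : Inst V} {v : V} {k : ℤ} {S S' : Finset V} (L : Lft I v I')
    (hS : ∀ u ∈ S, u ≠ v → u ∈ S') (hS2 : v ∈ S → v ∈ I.Q → ∀ r, I'.Feas r → 0 ≤ r v) (G : I'.Good k S') : I.Good k S := by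
  obtain ⟨r, hr, h1, h2⟩ := G
  refine ⟨_, L.feas r hr, ?_, ?_⟩
  · intro u hu
    have := h1 u (by rw [L.Q]; exact hu)
    rw [L.t] at this
    by_cases huv : u = v
    · subst huv
      rw [L.dv] at this
      have e : dl u u = 1 := by simp [dl]
      rw [e]
      convert this using 1; ring
    · rw [L.dw u hu huv] at this
      have e : dl v u = 0 := by simp [dl, huv]
      rw [e, add_zero]; exact this
  · intro u hu hus
    by_cases huv : u = v
    · subst huv
      have := hS2 hus hu r hr
      simp [dl]; omega
    · have := h2 u (by rw [L.Q]; exact hu) (hS u hus huv)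
      simpa [dl, huv] using this

theorem Feas.nonneg {I : Inst V} (h : I.Ok) {r : V → ℤ} (hr : I.Feas r) {v : V} (hv : v ∈ I.Q) : 0 ≤ r v := by
  obtain ⟨f, p, h1, h2, h3⟩ := hr
  rw [h3 v hv]
  have a1 := h.i0 v hv
  have a2 := (h2 v hv).1
  have a3 : 0 ≤ ∑ u ∈ I.Q, f v u := sum_nonneg fun u hu => (h1 v hv u hu).1
  omega

end Inst
end FR

open Finset
set_option linter.unusedSectionVars false
set_option linter.unnecessarySeqFocus false
namespace FR
namespace Inst
variable {V : Type*} [DecidableEq V]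

/-- an elementary operation `I → I'` with out-degree correction `dr` -/
structure Op (I I' : Inst V) (dr : V → ℤ) : Prop where
  Q : I'.Q = I.Q
  ok : I'.Ok
  feas : ∀ r, I'.Feas r → I.Feas (fun u => r u + dr u)
  bal : ∀ v ∈ I.Q, 2 * dr v = (I.dd {v} - I'.dd {v}) + (I.t v - I'.t v)

theorem Op.good {I I' : Inst V} {dr : V → ℤ} (O : Op I I' dr) (h0 : ∀ v, 0 ≤ dr v) {k : ℤ} {S S' : Finset V}
    (hS : ∀ u ∈ S, u ∈ S' ∨ 1 ≤ dr u) (G : I'.Good k S') : I.Good k S := by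
  obtain ⟨r, hr, h1, h2⟩ := G
  refine ⟨_, O.feas r hr, ?_, ?_⟩
  · intro u hu
    have := h1 u (by rw [O.Q]; exact hu)
    convert this using 1
    have := O.bal u hu
    linarith
  · intro u hu hus
    have hu' : u ∈ I'.Q := by rw [O.Q]; exact hu
    have := h0 u
    have := Feas.nonneg O.ok hr hu'
    rcases hS u hus with c | c
    · have := h2 u hu' c; omega
    · omega

theorem par_bal {I I' : Inst V} (h : I.Ok) {dr : V → ℤ}
    (bal : ∀ v ∈ I.Q, 2 * dr v = (I.dd {v} - I'.dd {v}) + (I.t v - I'.t v)) : ∀ v ∈ I.Q, 2 ∣ I'.dd {v} - I'.t v := by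
  intro v hv
  have := h.par v hv
  have := bal v hv
  omega

theorem size_lt_of {I I' : Inst V} (hQ : I'.Q = I.Q) {v : V} (hv : v ∈ I.Q) (h : I'.dd {v} < I.dd {v})
    (hd : ∀ A ⊆ I.Q, I'.dd A ≤ I.dd A) : I'.size < I.size := by
  unfold Inst.size
  rw [hQ]
  refine sum_lt_sum (fun u hu => ?_) ⟨v, hv, ?_⟩
  · have := hd {u} (by simpa using hu); omega
  · omega

theorem tt_add' (g h : V → ℤ) (A : Finset V) : sm (fun x => g x + h x) A = sm g A + sm h A := sm_add g h A

/-- delete an arc `u → w` -/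
def delA (I : Inst V) (u w : V) : Inst V :=
  ⟨I.Q, fun x y => I.μ x y - ed u w x y, I.o, I.i, I.φ, fun x => I.t x - dl u x + dl w x⟩

theorem tt_delA (I : Inst V) (u w : V) (A : Finset V) :
    (I.delA u w).tt A = I.tt A - (if u ∈ A then 1 else 0) + (if w ∈ A then 1 else 0) := by
  simp only [tt, delA, sm_add, sm_sub, sm_dl]

theorem dd_delA {I : Inst V} {u w : V} (hu : u ∈ I.Q) (hw : w ∈ I.Q) (A : Finset V) :
    (I.delA u w).dd A = I.dd A - (if u ∈ A ∧ w ∉ A then 1 else 0) - (if w ∈ A ∧ u ∉ A then 1 else 0) := by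
  unfold dd
  simp only [delA, ee_sub, ee_ed, mem_sdiff, hu, hw, true_and]
  ring

theorem op_delA {I : Inst V} (h : I.Ok) {u w : V} (hu : u ∈ I.Q) (hw : w ∈ I.Q) (h1 : 1 ≤ I.μ u w) :
    Op I (I.delA u w) (dl u) := by
  have n1 := ne_of_mu h h1
  have bal : ∀ v ∈ I.Q, 2 * dl u v = (I.dd {v} - (I.delA u w).dd {v}) + (I.t v - (I.delA u w).t v) := by
    intro v _
    rw [dd_delA hu hw]
    simp only [delA, dl, mem_singleton]
    by_cases c1 : v = u
    · subst c1; simp [n1, n1.symm]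
    · by_cases c2 : v = w
      · subst c2; simp [n1, n1.symm]
      · simp [Ne.symm c1, Ne.symm c2, c1, c2]
  refine ⟨rfl, ⟨?_, ?_, ?_, h.o0, h.i0, h.φ0, par_bal (I := I) h bal⟩, ?_, bal⟩
  · intro x y; simp only [delA]; rw [h.symm x y, ed_symm u w]
  · intro x y; simp only [delA]
    have := ed_le n1 h.symm h.nn h1 x y
    omega
  · intro x; simp only [delA]; rw [h.diag, ed_diag n1]; rfl
  · rintro r ⟨f, p, k1, k2, k3⟩
    refine ⟨fun x y => f x y + da u w x y, p, ?_, k2, ?_⟩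
    · intro x hx y hy
      have b1 := k1 x hx y hy
      have b3 := da_nonneg u w x y
      beta_reduce
      refine ⟨by omega, ?_⟩
      simp only [da_flip _ _ x y, ed_da, delA] at *
      omega
    · intro x hx
      have b1 := k3 x hx
      simp only [delA] at b1
      simp only [sum_add_distrib]
      rw [sum_da hw]
      omega

/-- delete an edge from `v` to the root -/
def delI (I : Inst V) (v : V) : Inst V :=
  ⟨I.Q, I.μ, I.o, fun x => I.i x - dl v x, I.φ, fun x => I.t x - dl v x⟩

theorem tt_delI (I : Inst V) (v : V) (A : Finset V) :
    (I.delI v).tt A = I.tt A - (if v ∈ A then 1 else 0) := by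
  simp only [tt, delI, sm_sub, sm_dl]

theorem dd_delI (I : Inst V) (v : V) (A : Finset V) :
    (I.delI v).dd A = I.dd A - (if v ∈ A then 1 else 0) := by
  unfold dd
  simp only [delI, sm_sub, sm_dl]
  ring

theorem op_delI {I : Inst V} (h : I.Ok) {v : V} (h1 : 1 ≤ I.i v) :
    Op I (I.delI v) (dl v) := by
  have bal : ∀ u ∈ I.Q, 2 * dl v u = (I.dd {u} - (I.delI v).dd {u}) + (I.t u - (I.delI v).t u) := by
    intro u _
    rw [dd_delI]
    simp only [delI, dl, mem_singleton]
    by_cases c1 : u = v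
    · subst c1; simp
    · simp [c1, Ne.symm c1]
  refine ⟨rfl, ⟨h.symm, h.nn, h.diag, h.o0, ?_, h.φ0, par_bal (I := I) h bal⟩, ?_, bal⟩
  · intro x hx; simp only [delI]
    have := dl_le (h.i0 x hx) h1
    omega
  · rintro r ⟨f, p, k1, k2, k3⟩
    refine ⟨f, p, k1, k2, ?_⟩
    intro x hx
    have b1 := k3 x hx
    simp only [delI] at b1
    simp only
    omega

/-- delete an edge from the root to `v` -/
def delO (I : Inst V) (v : V) : Inst V :=
  ⟨I.Q, I.μ, fun x => I.o x - dl v x, I.i, I.φ, fun x => I.t x + dl v x⟩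

theorem tt_delO (I : Inst V) (v : V) (A : Finset V) :
    (I.delO v).tt A = I.tt A + (if v ∈ A then 1 else 0) := by
  simp only [tt, delO, sm_add, sm_dl]

theorem dd_delO (I : Inst V) (v : V) (A : Finset V) :
    (I.delO v).dd A = I.dd A - (if v ∈ A then 1 else 0) := by
  unfold dd
  simp only [delO, sm_sub, sm_dl]
  ring

theorem op_delO {I : Inst V} (h : I.Ok) {v : V} (h1 : 1 ≤ I.o v) :
    Op I (I.delO v) (fun _ => 0) := by
  have bal : ∀ u ∈ I.Q, 2 * 0 = (I.dd {u} - (I.delO v).dd {u}) + (I.t u - (I.delO v).t u) := by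
    intro u _
    rw [dd_delO]
    simp only [delO, dl, mem_singleton]
    by_cases c1 : u = v
    · subst c1; simp
    · simp [c1, Ne.symm c1]
  refine ⟨rfl, ⟨h.symm, h.nn, h.diag, ?_, h.i0, h.φ0, par_bal (I := I) (dr := fun _ => 0) h bal⟩, ?_, bal⟩
  · intro x hx; simp only [delO]
    have := dl_le (h.o0 x hx) h1
    omega
  · rintro r ⟨f, p, k1, k2, k3⟩
    refine ⟨f, p, k1, k2, ?_⟩
    intro x hx
    have b1 := k3 x hx
    simp only [delO] at b1
    simp only
    omega

/-- delete an edge from `v` to the free vertex -/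
def delX (I : Inst V) (v : V) : Inst V :=
  ⟨I.Q, I.μ, I.o, I.i, fun x => I.φ x - dl v x, fun x => I.t x - dl v x⟩

theorem tt_delX (I : Inst V) (v : V) (A : Finset V) :
    (I.delX v).tt A = I.tt A - (if v ∈ A then 1 else 0) := by
  simp only [tt, delX, sm_sub, sm_dl]

theorem dd_delX (I : Inst V) (v : V) (A : Finset V) :
    (I.delX v).dd A = I.dd A - (if v ∈ A then 1 else 0) := by
  unfold dd
  simp only [delX, sm_sub, sm_dl]
  ring

theorem op_delX {I : Inst V} (h : I.Ok) {v : V} (h1 : 1 ≤ I.φ v) :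
    Op I (I.delX v) (dl v) := by
  have bal : ∀ u ∈ I.Q, 2 * dl v u = (I.dd {u} - (I.delX v).dd {u}) + (I.t u - (I.delX v).t u) := by
    intro u _
    rw [dd_delX]
    simp only [delX, dl, mem_singleton]
    by_cases c1 : u = v
    · subst c1; simp
    · simp [c1, Ne.symm c1]
  refine ⟨rfl, ⟨h.symm, h.nn, h.diag, h.o0, h.i0, ?_, par_bal (I := I) h bal⟩, ?_, bal⟩
  · intro x hx; simp only [delX]
    have := dl_le (h.φ0 x hx) h1
    omega
  · rintro r ⟨f, p, k1, k2, k3⟩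
    refine ⟨f, fun x => p x + dl v x, k1, ?_, ?_⟩
    · intro x hx
      have := k2 x hx
      have := dl_nonneg v x
      simp only [delX] at *
      omega
    intro x hx
    have b1 := k3 x hx
    simp only [delX] at b1
    simp only
    omega

/-- delete a path `w → v → root` -/
def delW (I : Inst V) (v w : V) : Inst V :=
  ⟨I.Q, fun x y => I.μ x y - ed v w x y, I.o, fun x => I.i x - dl v x, I.φ, fun x => I.t x - dl w x⟩

theorem tt_delW (I : Inst V) (v w : V) (A : Finset V) :
    (I.delW v w).tt A = I.tt A - (if w ∈ A then 1 else 0) := by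
  simp only [tt, delW, sm_sub, sm_dl]

theorem dd_delW {I : Inst V} {v w : V} (hv : v ∈ I.Q) (hw : w ∈ I.Q) (A : Finset V) :
    (I.delW v w).dd A = I.dd A - (if v ∈ A ∧ w ∉ A then 2 else 0) - (if w ∈ A then 1 else 0) := by
  unfold dd
  simp only [delW, ee_sub, ee_ed, mem_sdiff, hv, hw, true_and, sm_sub, sm_dl]
  by_cases c1 : v ∈ A <;> by_cases c2 : w ∈ A <;> simp [c1, c2] <;> ring

theorem op_delW {I : Inst V} (h : I.Ok) {v w : V} (hv : v ∈ I.Q) (hw : w ∈ I.Q) (h1 : 1 ≤ I.μ v w) (h2 : 1 ≤ I.i v) :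
    Op I (I.delW v w) (fun x => dl v x + dl w x) := by
  have n1 := ne_of_mu h h1
  have bal : ∀ u ∈ I.Q, 2 * (dl v u + dl w u) = (I.dd {u} - (I.delW v w).dd {u}) + (I.t u - (I.delW v w).t u) := by
    intro u _
    rw [dd_delW hv hw]
    simp only [delW, dl, mem_singleton]
    by_cases c1 : u = v
    · subst c1; simp [n1, n1.symm]
    · by_cases c2 : u = w
      · subst c2; simp [n1, n1.symm]
      · simp [Ne.symm c1, Ne.symm c2, c1, c2]
  refine ⟨rfl, ⟨?_, ?_, ?_, h.o0, ?_, h.φ0, par_bal (I := I) (dr := fun x => dl v x + dl w x) h bal⟩, ?_, bal⟩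
  · intro x y; simp only [delW]; rw [h.symm x y, ed_symm v w]
  · intro x y; simp only [delW]
    have := ed_le n1 h.symm h.nn h1 x y
    omega
  · intro x; simp only [delW]; rw [h.diag, ed_diag n1]; rfl
  · intro x hx; simp only [delW]
    have := dl_le (h.i0 x hx) h2
    omega
  · rintro r ⟨f, p, k1, k2, k3⟩
    refine ⟨fun x y => f x y + da w v x y, p, ?_, k2, ?_⟩
    · intro x hx y hy
      have b1 := k1 x hx y hy
      have b3 := da_nonneg w v x y
      beta_reduce
      refine ⟨by omega, ?_⟩
      simp only [da_flip _ _ x y, ed_da, delW] at *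
      omega
    · intro x hx
      have b1 := k3 x hx
      simp only [delW] at b1
      simp only [sum_add_distrib]
      rw [sum_da hv]
      omega

/-- lift two edges at the free vertex -/
def lftX (I : Inst V) (v w : V) : Inst V :=
  ⟨I.Q, fun x y => I.μ x y + ed v w x y, I.o, I.i, fun x => I.φ x - dl v x - dl w x, I.t⟩

theorem tt_lftX (I : Inst V) (v w : V) (A : Finset V) : (I.lftX v w).tt A = I.tt A := rfl

theorem dd_lftX {I : Inst V} {v w : V} (hv : v ∈ I.Q) (hw : w ∈ I.Q) (A : Finset V) :
    (I.lftX v w).dd A = I.dd A - (if v ∈ A ∧ w ∈ A then 2 else 0) := by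
  unfold dd
  simp only [lftX, ee_add, ee_ed, mem_sdiff, hv, hw, true_and, sm_sub, sm_dl]
  by_cases c1 : v ∈ A <;> by_cases c2 : w ∈ A <;> simp [c1, c2] <;> ring

theorem op_lftX {I : Inst V} (h : I.Ok) {v w : V} (hv : v ∈ I.Q) (hw : w ∈ I.Q) (n1 : v ≠ w)
    (h1 : 1 ≤ I.φ v) (h2 : 1 ≤ I.φ w) : Op I (I.lftX v w) (fun _ => 0) := by
  have bal : ∀ u ∈ I.Q, 2 * 0 = (I.dd {u} - (I.lftX v w).dd {u}) + (I.t u - (I.lftX v w).t u) := by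
    intro u _
    rw [dd_lftX hv hw, if_neg]
    · simp [lftX]
    · simp only [mem_singleton]; rintro ⟨rfl, e⟩; exact n1 e.symm
  have nv : dl v w = 0 := by simp [dl, n1.symm]
  have nw : dl w v = 0 := by simp [dl, n1]
  have vv : dl v v = 1 := by simp [dl]
  have ww : dl w w = 1 := by simp [dl]
  have hφ : ∀ x ∈ I.Q, 0 ≤ I.φ x - dl v x - dl w x := by
    intro x hx
    have := h.φ0 x hx
    by_cases c : x = v
    · subst c; omega
    · have : dl v x = 0 := by simp [dl, c]
      have := dl_le (h.φ0 x hx) h2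
      omega
  refine ⟨rfl, ⟨?_, ?_, ?_, h.o0, h.i0, hφ, par_bal (I := I) (dr := fun _ => 0) h bal⟩, ?_, bal⟩
  · intro x y; simp only [lftX]; rw [h.symm x y, ed_symm v w]
  · intro x y; simp only [lftX]
    have := h.nn x y
    have := ed_nonneg v w x y
    omega
  · intro x; simp only [lftX]; rw [h.diag, ed_diag n1]; rfl
  · rintro r ⟨f, p, k1, k2, k3⟩
    have key : ∀ a b, a ∈ I.Q → b ∈ I.Q → (∀ x y, ed a b x y = ed v w x y) → (∀ x, dl a x + dl b x = dl v x + dl w x) →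
        1 ≤ f a b → I.Feas (fun u => r u + 0) := by
      intro a b ha hb e1 e2 hf
      refine ⟨fun x y => f x y - da a b x y, fun x => p x + dl a x, ?_, ?_, ?_⟩
      · intro x hx y hy
        have b1 := k1 x hx y hy
        have b2 := da_le b1.1 hf
        beta_reduce
        refine ⟨by omega, ?_⟩
        have e1 := e1 x y
        simp only [da_flip _ _ x y, ed_da, lftX] at *
        omega
      · intro x hx
        have := k2 x hx
        have := e2 x
        have := dl_nonneg a x
        have := dl_nonneg b x
        simp only [lftX] at *
        omega
      · intro x hx
        have b1 := k3 x hx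
        simp only [lftX] at b1
        simp only [sum_sub_distrib]
        rw [sum_da hb]
        omega
    have b1 := k1 v hv w hw
    have b3 : 1 ≤ (I.lftX v w).μ v w := by
      have b4 : ed v w v w = 1 := by simp [ed, n1]
      have := h.nn v w
      simp only [lftX]; omega
    by_cases c : 1 ≤ f v w
    · exact key v w hv hw (fun _ _ => rfl) (fun _ => rfl) c
    · exact key w v hw hv (fun x y => by simp only [ed_da]; ring) (fun _ => by ring) (by omega)

/-- reversal of all orientations -/
def rev (I : Inst V) : Inst V := ⟨I.Q, I.μ, I.i, I.o, I.φ, fun x => - I.t x⟩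

theorem dd_rev (I : Inst V) (A : Finset V) : I.rev.dd A = I.dd A := by unfold dd; simp only [rev]; ring
theorem tt_rev (I : Inst V) (A : Finset V) : I.rev.tt A = - I.tt A := by simp [tt, rev, sm]

theorem ok_rev {I : Inst V} (h : I.Ok) : I.rev.Ok := by
  refine ⟨h.symm, h.nn, h.diag, h.i0, h.o0, h.φ0, ?_⟩
  intro v hv
  rw [dd_rev]
  have := h.par v hv
  simp only [rev]; omega

theorem dd_single {I : Inst V} (h : I.Ok) {v : V} (hv : v ∈ I.Q) :
    I.dd {v} = ∑ w ∈ I.Q, I.μ v w + I.o v + I.i v + I.φ v := by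
  have : ∑ w ∈ I.Q, I.μ v w = ∑ w ∈ I.Q \ {v}, I.μ v w := by
    rw [← sum_sdiff (s₁ := {v}) (s₂ := I.Q) (by simpa using hv)]; simp [h.diag]
  simp [dd, ee_singleton_left, sm_singleton, this]

theorem good_rev {I : Inst V} (h : I.Ok) {k : ℤ} (G : I.rev.Good k ∅) : I.Good k ∅ := by
  obtain ⟨r, ⟨f, p, k1, k2, k3⟩, h1, -⟩ := G
  refine ⟨fun v => I.dd {v} - r v, ⟨fun x y => f y x, fun x => I.φ x - p x, ?_, ?_, ?_⟩, ?_, by simp⟩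
  · intro x hx y hy
    have := k1 x hx y hy
    have := k1 y hy x hx
    simp only [rev] at *
    have := h.symm x y
    omega
  · intro x hx
    have := k2 x hx
    simp only [rev] at *
    omega
  · intro x hx
    have b := k3 x hx
    have : ∑ u ∈ I.Q, f x u + ∑ u ∈ I.Q, f u x = ∑ u ∈ I.Q, I.μ x u := by
      rw [← sum_add_distrib]; exact sum_congr rfl fun u hu => (k1 x hx u hu).2
    beta_reduce
    rw [dd_single h hx]
    simp only [rev] at *
    omega
  · intro v hv
    have := h1 v hv
    rw [dd_rev] at this
    simp only [rev] at this
    obtain ⟨c, hc⟩ := this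
    exact ⟨-c, by linarith⟩

end Inst
end FR

open Finset
set_option linter.unusedSectionVars false
set_option linter.unnecessarySeqFocus false
namespace FR
namespace Inst
variable {V : Type*} [DecidableEq V]

def ZOk (k : ℤ) (I : Inst V) (Z : Finset V) : Prop := Z = ∅ ∨ ∃ v, Z = {v} ∧ 2 * k ∣ I.t v

structure T0H (k : ℤ) (I : Inst V) (Z S : Finset V) : Prop where
  z : ZOk k I Z
  φz : ∀ u ∈ I.Q, I.φ u = 0
  c : ∀ A ⊆ I.Q, A.Nonempty → A ≠ I.Q → A ≠ Z → 2 * k - 2 + nd k (I.tt A) ≤ I.dd A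
  q : I.dd I.Q ≤ 2 * k - 2 + nd k (I.tt I.Q)
  net : 2 * k ∣ sm I.i I.Q - sm I.o I.Q - I.tt I.Q
  s : ∀ v ∈ I.Q, v ∈ S → v ∉ Z ∧ 2 * k + nd k (I.t v) ≤ I.dd {v}

structure MH (k : ℤ) (I : Inst V) (Z S : Finset V) : Prop where
  z : ZOk k I Z
  oQ : sm I.o I.Q ≤ k - 1
  iQ : sm I.i I.Q ≤ k - 1
  c : ∀ A ⊆ I.Q, A.Nonempty → A ≠ Z → 2 * k - 2 + nd k (I.tt A) ≤ I.dd A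
  e : ∀ v ∈ I.Q, v ∈ Z → 2 * (I.o v + I.i v) ≤ I.dd {v}
  s : ∀ v ∈ I.Q, v ∈ S → v ∉ Z ∧ 2 * k + nd k (I.t v) ≤ I.dd {v}

structure WH (k : ℤ) (I : Inst V) (Z S : Finset V) : Prop where
  z : ZOk k I Z
  iz : ∀ u ∈ I.Q, I.i u = 0
  oQ : sm I.o I.Q ≤ 2 * k - 1
  c : ∀ A ⊆ I.Q, A.Nonempty → A ≠ Z → 2 * k - 1 + nd k (I.tt A - 1) ≤ I.dd A
  b : ∀ A ⊆ I.Q, A.Nonempty → A ≠ I.Q → 2 * sm I.o A ≤ I.dd A + nd k (I.tt A)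
  bQ : (¬ nd k (I.tt I.Q - 1) < nd k (I.tt I.Q) ∨ Z.Nonempty) → 2 * sm I.o I.Q ≤ I.dd I.Q + nd k (I.tt I.Q)
  s : ∀ v ∈ I.Q, v ∈ S → v ∉ Z ∧ ¬ nd k (I.t v - 1) < nd k (I.t v)

def PT (V : Type*) [DecidableEq V] (k n : ℤ) : Prop := ∀ (I : Inst V) (Z S : Finset V), I.Ok → I.size < n → T0H k I Z S → I.Good k S
def PM (V : Type*) [DecidableEq V] (k n : ℤ) : Prop := ∀ (I : Inst V) (Z S : Finset V), I.Ok → I.size < n → MH k I Z S → I.Good k S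
def PW (V : Type*) [DecidableEq V] (k n : ℤ) : Prop := ∀ (I : Inst V) (Z S : Finset V), I.Ok → I.size < n → WH k I Z S → I.Good k S

/-! ### contraction bookkeeping -/

theorem mem_con {I : Inst V} {A : Finset V} {a x : V} : x ∈ (I.con A a).Q ↔ x = a ∨ (x ∈ I.Q ∧ x ∉ A) := by
  simp [con]

theorem ex_ne_Q {I : Inst V} {A B : Finset V} {a : V} (hA : A ⊆ I.Q) (ha : a ∈ A) (hB : B ⊆ (I.con A a).Q)
    (hn : B ≠ (I.con A a).Q) : ex A a B ≠ I.Q := by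
  intro h
  unfold ex at h
  split_ifs at h with h1
  · apply hn
    apply Subset.antisymm hB
    intro x hx
    rw [mem_con] at hx
    rcases hx with rfl | hx
    · exact h1
    · have : x ∈ B ∪ A := by rw [h]; exact hx.1
      rw [mem_union] at this
      tauto
  · exact h1 (h ▸ hA ha)

theorem ex_Q {I : Inst V} {A : Finset V} {a : V} (hA : A ⊆ I.Q) (ha : a ∈ A) : ex A a (I.con A a).Q = I.Q := by
  unfold ex
  rw [if_pos (by rw [mem_con]; exact Or.inl rfl)]
  ext x
  rw [mem_union, mem_con]
  have : x ∈ A → x ∈ I.Q := fun h => hA h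
  by_cases hx : x ∈ A
  · simp [hx, this hx]
  · simp only [hx, or_false, not_false_eq_true, and_true]
    constructor
    · rintro (rfl | h)
      · exact hA ha
      · exact h
    · exact Or.inr

theorem ex_ne {A B : Finset V} {a : V} (hB : B.Nonempty) : (ex A a B).Nonempty := by
  unfold ex
  split_ifs
  · exact hB.mono subset_union_left
  · exact hB

theorem ex_ne_Z {k : ℤ} {I : Inst V} {A B Z : Finset V} {a : V} (h2 : 2 ≤ A.card) (hB : B ⊆ (I.con A a).Q)
    (hne : B.Nonempty) (hZ : ZOk k I Z) (h : B ≠ Z \ A) : ex A a B ≠ Z := by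
  rcases hZ with rfl | ⟨v, rfl, -⟩
  · exact (ex_ne hne).ne_empty
  · intro h1
    unfold ex at h1
    split_ifs at h1 with h3
    · have : A ⊆ {v} := h1 ▸ subset_union_right
      have := card_le_card this
      rw [card_singleton] at this; omega
    · apply h
      subst h1
      have := mem_con.1 (hB (mem_singleton_self v))
      rw [mem_singleton] at h3
      rcases this with h4 | h4
      · exact absurd h4.symm h3
      · ext x; simp only [mem_singleton, mem_sdiff]
        constructor
        · rintro rfl; exact ⟨rfl, h4.2⟩
        · exact fun h => h.1

theorem zok_con {k : ℤ} {I : Inst V} {A Z : Finset V} {a : V} (ha : a ∈ A) (hZ : ZOk k I Z) : ZOk k (I.con A a) (Z \ A) := by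
  rcases hZ with rfl | ⟨v, rfl, h⟩
  · left; simp
  · by_cases hv : v ∈ A
    · left; simpa using hv
    · right
      refine ⟨v, by simpa using hv, ?_⟩
      have : v ≠ a := by rintro rfl; exact hv ha
      simpa [con, this] using h

theorem con_single {I : Inst V} {A : Finset V} {a v : V} (hA : A ⊆ I.Q) (ha : a ∈ A) (hv : v ∈ (I.con A a).Q) (hva : v ∉ A) :
    (I.con A a).dd {v} = I.dd {v} ∧ (I.con A a).t v = I.t v := by
  have h : v ≠ a := by rintro rfl; exact hva ha
  refine ⟨?_, ?_⟩
  · rw [dd_con hA ha (by simpa using hv)]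
    congr 1
    unfold ex; rw [if_neg]; simpa using h.symm
  · simp [con, h]

theorem con_self {I : Inst V} {A : Finset V} {a : V} (hA : A ⊆ I.Q) (ha : a ∈ A) :
    (I.con A a).dd {a} = I.dd A ∧ (I.con A a).t a = I.tt A := by
  refine ⟨?_, ?_⟩
  · rw [dd_con hA ha (by simp [con])]
    congr 1
    unfold ex; rw [if_pos (by simp)]; simpa using ha
  · simp [con, tt]

theorem con_o {I : Inst V} {A B : Finset V} {a : V} (ha : a ∈ A) (hB : B ⊆ (I.con A a).Q) :
    sm (I.con A a).o B = sm I.o (ex A a B) ∧ sm (I.con A a).i B = sm I.i (ex A a B) ∧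
    sm (I.con A a).φ B = sm I.φ (ex A a B) := by
  have : ∀ x ∈ B, x ∈ A → x = a := by
    intro x hx hxA
    have := mem_con.1 (hB hx)
    tauto
  exact ⟨sm_con _ ha this, sm_con _ ha this, sm_con _ ha this⟩

/-- instance on `A` with all boundary edges fixed to the root -/
def side (I : Inst V) (A : Finset V) (o' i' : V → ℤ) : Inst V := ⟨A, I.μ, o', i', fun _ => 0, I.t⟩

structure Side (I : Inst V) (A : Finset V) (o' i' : V → ℤ) : Prop where
  sub : A ⊆ I.Q
  ok : (I.side A o' i').Ok
  dd : ∀ C ⊆ A, (I.side A o' i').dd C = I.dd C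
  sz : A ≠ I.Q → (I.side A o' i').size < I.size
  sz' : (I.side A o' i').size ≤ I.size
  tot : sm o' A + sm i' A = I.dd A

theorem side_of {I : Inst V} (h : I.Ok) {A : Finset V} (hA : A ⊆ I.Q) {o' i' : V → ℤ}
    (H : ∀ v ∈ A, 0 ≤ o' v ∧ 0 ≤ i' v ∧
      o' v + i' v = I.o v + I.i v + I.φ v + ∑ w ∈ I.Q \ A, I.μ v w) : Side I A o' i' := by
  have hb : ∀ v ∈ (I.side A o' i').Q, (I.side A o' i').o v + (I.side A o' i').i v + (I.side A o' i').φ v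
      = I.o v + I.i v + I.φ v + ∑ w ∈ I.Q \ (I.side A o' i').Q, I.μ v w := by
    intro v hv
    have := (H v hv).2.2
    simp only [side, add_zero]; exact this
  have hdd : ∀ C ⊆ A, (I.side A o' i').dd C = I.dd C := fun C hC =>
    dd_restrict (I := I) (J := I.side A o' i') rfl hA hb hC
  have hs : A ≠ I.Q → (I.side A o' i').size < I.size := fun hne =>
    size_restrict h rfl (HasSubset.Subset.ssubset_of_ne hA hne) hb
  refine ⟨hA, ok_restrict h rfl hA (fun _ _ => rfl) hb (fun v hv => (H v hv).1) (fun v hv => (H v hv).2.1) (fun _ _ => le_rfl),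
    hdd, hs, ?_, ?_⟩
  · by_cases he : A = I.Q
    · subst he
      apply le_of_eq
      unfold size
      refine Finset.sum_congr rfl fun v hv => ?_
      rw [hdd {v} (by simpa [side] using hv)]
    · exact (hs he).le
  · rw [← hdd A Subset.rfl]
    unfold Inst.dd side
    simp [ee_empty_right, sm_zero]

theorem glue_good {I : Inst V} (h : I.Ok) {k : ℤ} {A S S1 : Finset V} {a : V} (hA : A ⊆ I.Q) (ha : a ∈ A)
    (hS : ∀ u ∈ S, u ∉ A → u ∈ S1) (G : (I.con A a).Good k S1)
    (HA : ∀ o' i' : V → ℤ, Side I A o' i' → (∀ v ∈ A, 0 ≤ o' v ∧ 0 ≤ i' v ∧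
      o' v + i' v = I.o v + I.i v + I.φ v + ∑ w ∈ I.Q \ A, I.μ v w) →
      2 * k ∣ sm i' A - sm o' A - I.tt A → (a ∈ S1 → 1 ≤ sm i' A) → (I.side A o' i').Good k S) : I.Good k S := by
  obtain ⟨r1, hr1, h1, h2⟩ := G
  obtain ⟨o', i', H1, H2, H3⟩ := glue h hA ha hr1
  have sd := side_of h hA H1
  have haq : a ∈ (I.con A a).Q := mem_con.2 (Or.inl rfl)
  obtain ⟨r2, hr2, h3, h4⟩ := HA o' i' sd H1 (by
      have := h1 a haq
      rw [(con_self hA ha).1, (con_self hA ha).2] at this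
      have e := sd.tot
      convert this using 1
      rw [← H2]; linarith) (by
      intro hs; rw [H2]; exact h2 a haq hs)
  refine ⟨_, H3 _ _ hr2, ?_, ?_⟩
  · intro v hv
    by_cases hvA : v ∈ A
    · simp only [hvA, if_true]
      have := h3 v hvA
      rw [sd.dd {v} (by simpa using hvA)] at this
      exact this
    · simp only [hvA, if_false]
      have hv' : v ∈ (I.con A a).Q := mem_con.2 (Or.inr ⟨hv, hvA⟩)
      have := h1 v hv'
      rw [(con_single hA ha hv' hvA).1, (con_single hA ha hv' hvA).2] at this
      exact this
  · intro v hv hvS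
    by_cases hvA : v ∈ A
    · simp only [hvA, if_true]
      exact h4 v hvA hvS
    · simp only [hvA, if_false]
      exact h2 v (mem_con.2 (Or.inr ⟨hv, hvA⟩)) (hS v hvS hvA)

/-- pendant vertex `v` attached to `w` only -/
theorem pend {I : Inst V} (h : I.Ok) {k : ℤ} {S S1 : Finset V} {v w : V} (hv : v ∈ I.Q) (hw : w ∈ I.Q) (hn : w ≠ v)
    (ho : I.o v = 0) (hi : I.i v = 0) (hφ : I.φ v = 0) (hm : I.μ v w = I.dd {v}) (c : ℤ) (hc0 : 0 ≤ c)
    (hc1 : c ≤ I.dd {v}) (hc : 2 * k ∣ 2 * c - I.dd {v} - I.t v)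
    (hS : ∀ u ∈ S, u ≠ v → u ≠ w → u ∈ S1) (hSv : v ∈ S → 1 ≤ c) (hSw : w ∈ S → 1 ≤ I.dd {v} - c)
    (G : (I.con {v, w} w).Good k S1) : I.Good k S := by
  have hA : ({v, w} : Finset V) ⊆ I.Q := by
    intro x; simp only [mem_insert, mem_singleton]; rintro (rfl | rfl) <;> assumption
  refine glue_good h hA (by simp) ?_ G ?_
  · intro u hu hu2
    simp only [mem_insert, mem_singleton, not_or] at hu2
    exact hS u hu hu2.1 hu2.2
  · intro o' i' sd H hnet _
    have hvA : v ∈ ({v, w} : Finset V) := by simp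
    have hwA : w ∈ ({v, w} : Finset V) := by simp
    have hsum : ∑ x ∈ I.Q, I.μ v x = I.μ v w + ∑ x ∈ I.Q \ {v, w}, I.μ v x := by
      rw [← Finset.sum_sdiff hA, Finset.sum_pair hn.symm, h.diag]; ring
    have hsv := dd_single h hv
    obtain ⟨a1, a2, a3⟩ := H v hvA
    obtain ⟨b1, b2, b3⟩ := H w hwA
    have ho' : o' v = 0 := by omega
    have hi' : i' v = 0 := by omega
    have sms : ∀ g : V → ℤ, sm g {v, w} = g v + g w := fun g => Finset.sum_pair hn.symm
    refine ⟨fun u => if u = v then c else I.dd {v} - c + i' w, ⟨fun x y => if x = v ∧ y = w then c else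
      if x = w ∧ y = v then I.dd {v} - c else 0, fun _ => 0, ?_, ?_, ?_⟩, ?_, ?_⟩
    · intro x hx y hy
      simp only [side, mem_insert, mem_singleton] at hx hy ⊢
      have hwv := h.symm w v
      have d1 := h.diag v
      have d2 := h.diag w
      rcases hx with rfl | rfl <;> rcases hy with rfl | rfl <;> simp [hn, hn.symm] <;> omega
    · intro x hx; simp [side]
    · intro x hx
      simp only [side, mem_insert, mem_singleton] at hx ⊢
      rw [Finset.sum_pair hn.symm]
      rcases hx with rfl | rfl <;> simp [hn, hn.symm] <;> omega
    · intro x hx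
      rw [sd.dd {x} (by simpa [side] using hx)]
      simp only [side, mem_insert, mem_singleton] at hx ⊢
      rcases hx with rfl | rfl
      · simpa using hc
      · rw [if_neg hn]
        rw [sms, sms, tt, sms] at hnet
        have e : I.dd {x} = I.dd {v} + o' x + i' x := by
          have e1 : ∑ y ∈ I.Q, I.μ x y = I.μ x v + ∑ y ∈ I.Q \ {v, x}, I.μ x y := by
            rw [← Finset.sum_sdiff hA, Finset.sum_pair hn.symm, h.diag]; ring
          have e2 := dd_single h hw
          have := h.symm v x
          omega
        rw [e]
        rw [ho', hi'] at hnet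
        obtain ⟨q, hq⟩ := dvd_sub hnet hc
        exact ⟨q, by linarith⟩
    · intro x hx hxS
      simp only [side, mem_insert, mem_singleton] at hx ⊢
      rcases hx with rfl | rfl
      · simpa using hSv hxS
      · rw [if_neg hn]
        have := hSw hxS
        omega

/-- removing a vertex with no neighbours in `Q` -/
theorem rem_iso {I : Inst V} (h : I.Ok) {k : ℤ} {S : Finset V} {v : V} (hv : v ∈ I.Q) (hm : ∀ w ∈ I.Q, I.μ v w = 0) (p : ℤ)
    (hp0 : 0 ≤ p) (hp1 : p ≤ I.φ v) (hp : 2 * k ∣ 2 * (p + I.i v) - I.dd {v} - I.t v) (hS : v ∈ S → 1 ≤ p + I.i v)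
    (G : (I.sub (I.Q \ {v})).Good k S) : I.Good k S := by
  obtain ⟨r, ⟨f, q, F1, F2, F3⟩, h1, h2⟩ := G
  have hsub : I.Q \ {v} ⊆ I.Q := sdiff_subset
  have hsym := h.symm
  have e0 : I.Q \ (I.Q \ {v}) = {v} := by
    ext x; simp only [mem_sdiff, mem_singleton]
    constructor
    · tauto
    · rintro rfl; exact ⟨hv, by tauto⟩
  have memsub : ∀ u, u ∈ I.Q → u ≠ v → u ∈ (I.sub (I.Q \ {v})).Q := by
    intro u hu hne; simp only [sub, mem_sdiff, mem_singleton]; exact ⟨hu, hne⟩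
  refine ⟨fun u => if u = v then p + I.i v else r u, ⟨fun x y => if x = v ∨ y = v then 0 else f x y,
    fun x => if x = v then p else q x, ?_, ?_, ?_⟩, ?_, ?_⟩
  · intro x hx y hy
    by_cases h3 : x = v
    · subst h3; simp [hm y hy]
    · by_cases h4 : y = v
      · subst h4; simp [hsym x y, hm x hx]
      · simpa [h3, h4, sub] using F1 x (memsub x hx h3) y (memsub y hy h4)
  · intro x hx
    by_cases h3 : x = v
    · subst h3; simp; exact ⟨hp0, hp1⟩
    · have := F2 x (memsub x hx h3)
      simp only [sub, e0, sum_singleton, hsym x v, hm x hx, add_zero] at this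
      simpa [h3] using this
  · intro x hx
    by_cases h3 : x = v
    · subst h3; simp
    · have := F3 x (memsub x hx h3)
      simp only [h3, if_false, false_or]
      rw [this]
      change ∑ u ∈ I.Q \ {v}, f x u + q x + I.i x = _
      congr 2
      rw [← Finset.sum_sdiff (s₁ := {v}) (s₂ := I.Q) (by simpa using hv)]
      simp only [sum_singleton, if_true, add_zero]
      refine Finset.sum_congr rfl fun y hy => ?_
      rw [if_neg]
      simpa using (mem_sdiff.1 hy).2
  · intro x hx
    by_cases h3 : x = v
    · subst h3; simpa using hp
    · have := h1 x (memsub x hx h3)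
      rw [dd_sub hsub (by simp [hx, h3])] at this
      simpa [h3, sub] using this
  · intro x hx hxS
    by_cases h3 : x = v
    · subst h3; simpa using hS hxS
    · simpa [h3] using h2 x (memsub x hx h3) hxS

/-- the residue condition at the last vertex is automatic -/
theorem last_res {I : Inst V} (h : I.Ok) {k : ℤ} {r f p} (hF : I.FeasW r f p) {x : V} (hx : x ∈ I.Q)
    (hnet : 2 * k ∣ 2 * sm p I.Q - sm I.φ I.Q + sm I.i I.Q - sm I.o I.Q - I.tt I.Q)
    (H : ∀ v ∈ I.Q, v ≠ x → 2 * k ∣ 2 * r v - I.dd {v} - I.t v) : 2 * k ∣ 2 * r x - I.dd {x} - I.t x := by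
  have h1 := sum_r h hF
  have h2 := sum_dd h (Subset.refl I.Q)
  have h3 : I.dd I.Q = sm I.o I.Q + sm I.i I.Q + sm I.φ I.Q := by
    unfold dd; simp [ee_empty_right]
  have h4 : ∑ v ∈ I.Q, (2 * r v - I.dd {v} - I.t v) = 2 * sm p I.Q - sm I.φ I.Q + sm I.i I.Q - sm I.o I.Q - I.tt I.Q := by
    rw [Finset.sum_sub_distrib, Finset.sum_sub_distrib, ← Finset.mul_sum, h2]
    unfold tt
    unfold sm at *
    linarith
  rw [← h4, ← Finset.sum_erase_add _ _ hx] at hnet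
  refine (Int.dvd_iff_dvd_of_dvd_add hnet).1 (Finset.dvd_sum fun v hv => ?_)
  exact H v (mem_of_mem_erase hv) (ne_of_mem_erase hv)

theorem dd_full (I : Inst V) : I.dd I.Q = sm I.o I.Q + sm I.i I.Q + sm I.φ I.Q := by
  unfold dd; simp [ee_empty_right]

/-- one-vertex instances -/
theorem good_one {I : Inst V} (h : I.Ok) {k : ℤ} {S : Finset V} {v : V} (hQ : I.Q = {v}) (p : ℤ) (hp0 : 0 ≤ p) (hp1 : p ≤ I.φ v)
    (hp : 2 * k ∣ 2 * (p + I.i v) - I.dd {v} - I.t v) (hS : v ∈ S → 1 ≤ p + I.i v) : I.Good k S := by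
  refine ⟨fun _ => p + I.i v, ⟨fun _ _ => 0, fun _ => p, ?_, ?_, ?_⟩, ?_, ?_⟩ <;> rw [hQ] <;>
    simp only [mem_singleton] <;> rintro x rfl
  · rintro y rfl; simp [h.diag]
  · exact ⟨hp0, hp1⟩
  · simp
  · exact hp
  · exact hS

theorem good_empty {I : Inst V} {k : ℤ} {S : Finset V} (hQ : I.Q = ∅) : I.Good k S :=
  ⟨fun _ => 0, ⟨fun _ _ => 0, fun _ => 0, by simp [hQ], by simp [hQ], by simp [hQ]⟩, by simp [hQ], by simp [hQ]⟩

end Inst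
end FR

open Finset
set_option linter.unusedSectionVars false
set_option linter.unnecessarySeqFocus false
namespace FR
namespace Inst
variable {V : Type*} [DecidableEq V]

theorem sub_Q (I : Inst V) (A : Finset V) : (I.sub A).Q = A := rfl
theorem side_Q (I : Inst V) (A : Finset V) (o' i' : V → ℤ) : (I.side A o' i').Q = A := rfl

theorem T0H.con {k : ℤ} {I : Inst V} {Z S A : Finset V} {a : V} (H : T0H k I Z S) (hA : A ⊆ I.Q) (ha : a ∈ A)
    (h2 : 2 ≤ A.card) : T0H k (I.con A a) (Z \ A) (S \ A) where
  z := zok_con ha H.z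
  φz := by
    intro u hu
    by_cases h : u = a
    · simp only [Inst.con, h, if_true]; exact sm_zero_of fun v hv => H.φz v (hA hv)
    · simp only [Inst.con, h, if_false]; exact H.φz u ((mem_con.1 hu).resolve_left h).1
  c := by
    intro B hB hne hnQ hnZ
    rw [tt_con ha hB, dd_con hA ha hB]
    exact H.c _ (ex_sub hA hB ha) (ex_ne hne) (ex_ne_Q hA ha hB hnQ) (ex_ne_Z h2 hB hne H.z hnZ)
  q := by
    rw [tt_con ha Subset.rfl, dd_con hA ha Subset.rfl, ex_Q hA ha]; exact H.q
  net := by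
    rw [tt_con ha Subset.rfl, (con_o ha Subset.rfl).1, (con_o ha Subset.rfl).2.1, ex_Q hA ha]; exact H.net
  s := by
    intro v hv hvS
    rw [mem_sdiff] at hvS
    rw [(con_single hA ha hv hvS.2).1, (con_single hA ha hv hvS.2).2]
    have := H.s v ((mem_con.1 hv).resolve_left (by rintro rfl; exact hvS.2 ha)).1 hvS.1
    exact ⟨fun h => this.1 (mem_sdiff.1 h).1, this.2⟩

theorem T0_tight {k n : ℤ} {I : Inst V} {Z S : Finset V} (hT : PT V k n) (h : I.Ok) (hs : I.size < n + 1)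
    (H : T0H k I Z S) {A : Finset V} (hA : A ⊆ I.Q) (hAQ : A ≠ I.Q) (h2 : 2 ≤ A.card)
    (ht : I.dd A ≤ 2 * k - 2 + nd k (I.tt A)) : I.Good k S := by
  obtain ⟨a, ha⟩ : A.Nonempty := by rw [← card_pos]; omega
  have hG : (I.con A a).Good k (S \ A) :=
    hT _ _ _ (ok_con h hA ha) (by have := size_con h hA ha h2; omega) (H.con hA ha h2)
  refine glue_good h hA ha (fun u hu hu' => mem_sdiff.2 ⟨hu, hu'⟩) hG ?_
  intro o' i' sd _ hnet _
  refine hT _ Z S sd.ok (by have := sd.sz hAQ; omega) ⟨H.z, fun _ _ => rfl, ?_, ?_, hnet, ?_⟩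
  · intro C hC hne _ hZ
    rw [sd.dd C hC]
    refine H.c C (hC.trans hA) hne ?_ hZ
    rintro rfl
    exact hAQ (Subset.antisymm hA hC)
  · rw [show (I.side A o' i').Q = A from rfl, sd.dd A Subset.rfl]; exact ht
  · intro v hv hvS
    rw [sd.dd {v} (singleton_subset_iff.2 hv)]
    exact H.s v (hA hv) hvS

theorem nd_add {k a b : ℤ} (h : 2 * k ∣ b) : nd k (a + b) = nd k a := nd_congr (by simpa using h)
theorem nd_sub {k a b : ℤ} (h : 2 * k ∣ b) : nd k (a - b) = nd k a := nd_congr (by simpa using h)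

theorem card_two {A : Finset V} (hne : A.Nonempty) (h : ∀ v, A ≠ {v}) : 2 ≤ A.card := by
  have h1 := card_pos.2 hne
  by_contra hc
  obtain ⟨v, hv⟩ := card_eq_one.1 (by omega : A.card = 1)
  exact h v hv

theorem ok_rem {I : Inst V} (_h : I.Ok) {v : V} (hv : v ∈ I.Q) :
    I.Q \ {v} ⊂ I.Q ∧ I.Q \ (I.Q \ {v}) = {v} := by
  refine ⟨?_, ?_⟩
  · rw [ssubset_iff_of_subset sdiff_subset]; exact ⟨v, hv, by simp⟩
  · ext x; simp only [mem_sdiff, mem_singleton]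
    constructor
    · tauto
    · rintro rfl; exact ⟨hv, by tauto⟩

/-- `d(Q) = d(Q - v) + d(v)` for a vertex without neighbours -/
theorem dd_iso {I : Inst V} (h : I.Ok) {v : V} (hv : v ∈ I.Q) (hm : ∀ w ∈ I.Q, I.μ v w = 0) :
    I.dd I.Q = I.dd (I.Q \ {v}) + I.dd {v} := by
  have e : (I.Q \ {v}) ∪ {v} = I.Q := sdiff_union_of_subset (by simpa using hv)
  have := dd_union h (A := I.Q \ {v}) (B := {v}) sdiff_subset (by simpa using hv) sdiff_disjoint
  rw [e, ee_comm h.symm, ee_singleton_left, Finset.sum_eq_zero (fun w hw => hm w (mem_sdiff.1 hw).1)] at this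
  omega

theorem pair_card {v w : V} (hn : w ≠ v) : 2 ≤ ({v, w} : Finset V).card := by
  rw [card_pair hn.symm]

theorem pair_sub {I : Inst V} {v w : V} (hv : v ∈ I.Q) (hw : w ∈ I.Q) : ({v, w} : Finset V) ⊆ I.Q := by
  intro x; simp only [mem_insert, mem_singleton]; rintro (rfl | rfl) <;> assumption

/-- dissolving a vertex whose degree need not be large -/
theorem T0_zstep {k n : ℤ} (hk : 2 ≤ k) {I : Inst V} {Z S : Finset V} (hT : PT V k n) (h : I.Ok) (hs : I.size < n + 1)
    (H : T0H k I Z S) (hQ : 2 ≤ I.Q.card)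
    (hslack : ∀ A ⊆ I.Q, A ≠ I.Q → 2 ≤ A.card → 2 * k + nd k (I.tt A) ≤ I.dd A)
    {v : V} (hv : v ∈ I.Q) (htv : 2 * k ∣ I.t v) (hvS : v ∉ S) (hZ : Z = ∅ ∨ Z = {v}) : I.Good k S := by
  have hkk := hk
  rcases exists_lft h hv with ⟨I', L⟩ | ⟨ho, hi, hφ, w, hw, hn, hm, hpos⟩ | ⟨hm, hd⟩
  · refine L.good (S' := S) (fun u hu _ => hu) (fun h => absurd h hvS) ?_
    refine hT I' {v} S L.ok (by have := L.size hv; omega) ⟨Or.inr ⟨v, rfl, by rw [L.t]; exact htv⟩, ?_, ?_, ?_, ?_, ?_⟩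
    · rw [L.Q]; exact L.φz H.φz
    · rw [L.Q]; intro A hA hne hAQ hAv
      rw [tt, L.t]
      change _ + nd k (I.tt A) ≤ _
      by_cases hc : ∃ u, A = {u}
      · obtain ⟨u, rfl⟩ := hc
        have huv : u ≠ v := fun h => hAv (by rw [h])
        rw [L.dw u (by simpa using hA) huv]
        refine H.c _ hA hne hAQ ?_
        rcases hZ with rfl | rfl
        · exact hne.ne_empty
        · exact hAv
      · push Not at hc
        have := hslack A hA hAQ (card_two hne hc)
        have := L.dge A hA
        omega
    · have := L.dle I.Q Subset.rfl
      have := H.q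
      rw [L.Q, tt, L.t]; unfold tt at this; omega
    · have := L.net H.φz
      rw [L.Q, tt, L.t, this]; exact H.net
    · rw [L.Q]; intro u hu huS
      have huv : u ≠ v := by rintro rfl; exact hvS huS
      rw [L.dw u hu huv, L.t]
      exact ⟨by simpa using huv, (H.s u hu huS).2⟩
  · have hpar := h.par v hv
    have h2 : 2 ∣ I.dd {v} := by
      have : (2:ℤ) ∣ I.t v := dvd_trans (dvd_mul_right 2 k) htv
      omega
    obtain ⟨c, hc⟩ := h2
    refine pend h hv hw hn ho hi hφ hm c (by omega) (by omega) ?_ (S1 := S \ {v, w}) ?_ (fun h => absurd h hvS) (fun _ => by omega) ?_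
    · rw [hc]; simpa using htv
    · intro u hu h1 h2; simp [hu, h1, h2]
    · exact hT _ _ _ (ok_con h (pair_sub hv hw) (by simp)) (by have := size_con h (pair_sub hv hw) (a := w) (by simp) (pair_card hn); omega)
        (H.con (pair_sub hv hw) (by simp) (pair_card hn))
  · have hdd := dd_iso h hv hm
    obtain ⟨hss, hco⟩ := ok_rem h hv
    have htt : I.tt (I.Q \ {v}) = I.tt I.Q - I.t v := by
      rw [tt_sdiff _ (by simpa using hv), tt_singleton]
    have hnd : nd k (I.tt (I.Q \ {v})) = nd k (I.tt I.Q) := by rw [htt]; exact nd_sub htv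
    have hne : (I.Q \ {v}).Nonempty := by
      rw [← card_pos, card_sdiff_of_subset (by simpa using hv), card_singleton]; omega
    have hc := H.c _ hss.1 hne hss.ne (by
      rcases hZ with rfl | rfl
      · exact hne.ne_empty
      · intro h; have := h ▸ mem_singleton_self v; simp at this)
    have hq := H.q
    have hd0 := dd_nonneg h (A := {v}) (by simpa using hv)
    have hsv := dd_single h hv
    rw [Finset.sum_eq_zero hm] at hsv
    have := h.o0 v hv
    have := h.i0 v hv
    have := h.φ0 v hv
    have hz : I.o v = 0 ∧ I.i v = 0 ∧ I.φ v = 0 ∧ I.dd {v} = 0 := by omega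
    refine rem_iso h hv hm 0 le_rfl (by omega) (by rw [hz.2.1, hz.2.2.2]; simpa using htv) (fun h => absurd h hvS) ?_
    have hφ : ∀ u ∈ I.Q, ∑ x ∈ I.Q \ (I.Q \ {v}), I.μ u x = 0 := by
      intro u hu; rw [hco, sum_singleton, h.symm]; exact hm u hu
    refine hT _ ∅ S (ok_sub h hss.1) (by have := size_sub h hss; omega) ⟨Or.inl rfl, ?_, ?_, ?_, ?_, ?_⟩
    · intro u hu
      have hu' := hss.1 hu
      simp only [sub]; rw [hφ u hu', H.φz u hu']; rfl
    · intro A hA hAne hAQ _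
      rw [dd_sub hss.1 hA]
      refine H.c A (hA.trans hss.1) hAne ?_ ?_
      · rintro rfl; exact hss.2 hA
      · rcases hZ with rfl | rfl
        · exact hAne.ne_empty
        · rintro rfl; have := hA (mem_singleton_self v); simp [sub] at this
    · rw [sub_Q, dd_sub hss.1 Subset.rfl]
      change I.dd (I.Q \ {v}) ≤ _ + nd k (I.tt (I.Q \ {v})); omega
    · change 2 * k ∣ sm I.i (I.Q \ {v}) - sm I.o (I.Q \ {v}) - I.tt (I.Q \ {v})
      rw [sm_sdiff _ (by simpa using hv), sm_sdiff _ (by simpa using hv), sm_singleton, sm_singleton, htt, hz.1, hz.2.1]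
      obtain ⟨q, hq⟩ := dvd_add H.net htv
      exact ⟨q, by linarith⟩
    · intro u hu huS
      have hu' := hss.1 hu
      rw [dd_sub hss.1 (singleton_subset_iff.2 hu)]
      exact ⟨by simp, (H.s u hu' huS).2⟩

/-- a vertex which must have positive out-degree -/
theorem T0_sstep {k n : ℤ} (hk : 2 ≤ k) {I : Inst V} {S : Finset V} (hT : PT V k n) (h : I.Ok) (hs : I.size < n + 1)
    (H : T0H k I ∅ S) (hQ : 2 ≤ I.Q.card)
    (hslack : ∀ A ⊆ I.Q, A ≠ I.Q → 2 ≤ A.card → 2 * k + nd k (I.tt A) ≤ I.dd A)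
    {v : V} (hv : v ∈ I.Q) (hvS : v ∈ S) : I.Good k S := by
  have hsv := (H.s v hv hvS).2
  rcases exists_lft h hv with ⟨I', L⟩ | ⟨ho, hi, hφ, w, hw, hn, hm, hpos⟩ | ⟨hm, hd⟩
  · refine L.good (S' := S.erase v) (fun u hu hne => mem_erase.2 ⟨hne, hu⟩)
      (fun _ _ r hr => Feas.nonneg L.ok hr (by rw [L.Q]; exact hv)) ?_
    refine hT I' ∅ _ L.ok (by have := L.size hv; omega) ⟨Or.inl rfl, ?_, ?_, ?_, ?_, ?_⟩
    · rw [L.Q]; exact L.φz H.φz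
    · rw [L.Q]; intro A hA hne hAQ _
      rw [tt, L.t]
      change _ + nd k (I.tt A) ≤ _
      by_cases hc : ∃ u, A = {u}
      · obtain ⟨u, rfl⟩ := hc
        by_cases huv : u = v
        · subst huv
          rw [L.dv, tt_singleton]; omega
        · rw [L.dw u (by simpa using hA) huv]
          exact H.c _ hA hne hAQ hne.ne_empty
      · push Not at hc
        have := hslack A hA hAQ (card_two hne hc)
        have := L.dge A hA
        omega
    · have := L.dle I.Q Subset.rfl
      have := H.q
      rw [L.Q, tt, L.t]; unfold tt at this; omega
    · have := L.net H.φz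
      rw [L.Q, tt, L.t, this]; exact H.net
    · rw [L.Q]; intro u hu huS
      rw [mem_erase] at huS
      rw [L.dw u hu huS.1, L.t]
      exact ⟨by simp, (H.s u hu huS.2).2⟩
  · have hpar := h.par v hv
    have hp2 := nd_par hk (I.t v)
    have hnn := nd_nonneg hk (I.t v)
    obtain ⟨c, hc1, hc2, hc3⟩ : ∃ c, 1 ≤ c ∧ 1 ≤ I.dd {v} - c ∧ 2 * k ∣ 2 * c - I.dd {v} - I.t v := by
      obtain ⟨-, -, q, hq | hq⟩ := nd_spec hk (I.t v)
      · exact ⟨(I.dd {v} + nd k (I.t v)) / 2, by omega, by omega, -q, by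
          have : 2 * ((I.dd {v} + nd k (I.t v)) / 2) = I.dd {v} + nd k (I.t v) := by omega
          linarith⟩
      · exact ⟨(I.dd {v} - nd k (I.t v)) / 2, by omega, by omega, -q, by
          have : 2 * ((I.dd {v} - nd k (I.t v)) / 2) = I.dd {v} - nd k (I.t v) := by omega
          linarith⟩
    refine pend h hv hw hn ho hi hφ hm c (by omega) (by omega) hc3 (S1 := S \ {v, w}) ?_ (fun h => hc1) (fun _ => hc2) ?_
    · intro u hu h1 h2; simp [hu, h1, h2]
    · exact hT _ _ _ (ok_con h (pair_sub hv hw) (by simp)) (by have := size_con h (pair_sub hv hw) (a := w) (by simp) (pair_card hn); omega)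
        (H.con (pair_sub hv hw) (by simp) (pair_card hn))
  · exfalso
    have hdd := dd_iso h hv hm
    obtain ⟨hss, hco⟩ := ok_rem h hv
    have htt : I.tt (I.Q \ {v}) + I.t v = I.tt I.Q := by
      rw [tt_sdiff _ (by simpa using hv), tt_singleton]; ring
    have hne : (I.Q \ {v}).Nonempty := by
      rw [← card_pos, card_sdiff_of_subset (by simpa using hv), card_singleton]; omega
    have hc := H.c _ hss.1 hne hss.ne hne.ne_empty
    have hq := H.q
    have := nd_triangle hk (I.tt (I.Q \ {v})) (I.t v)
    rw [htt] at this
    omega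

/-- the final step: all vertices "positive" -/
theorem T0_final {k n : ℤ} (hk : 2 ≤ k) {I : Inst V} (hW : PW V k n) (h : I.Ok) (hs : I.size < n + 1)
    (H : T0H k I ∅ ∅) (hQ : 2 ≤ I.Q.card)
    (hslack : ∀ A ⊆ I.Q, A ≠ I.Q → 2 ≤ A.card → 2 * k + nd k (I.tt A) ≤ I.dd A)
    (hP : ∀ v ∈ I.Q, nd k (I.t v - 1) < nd k (I.t v)) (hi : ∀ v ∈ I.Q, I.i v = 0) : I.Good k ∅ := by
  obtain ⟨x, hx⟩ : I.Q.Nonempty := by rw [← card_pos]; omega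
  obtain ⟨hss, hco⟩ := ok_rem h hx
  have hi0 : sm I.i I.Q = 0 := sm_zero_of hi
  have hφ0 : sm I.φ I.Q = 0 := sm_zero_of H.φz
  have hfull := dd_full I
  have hnet := H.net
  have hq := H.q
  have ho0 := sm_nonneg (g := I.o) (A := I.Q) h.o0
  have hndD : nd k (I.tt I.Q) = nd k (sm I.o I.Q) := by
    rw [← nd_neg hk (sm I.o I.Q)]
    refine (nd_congr ?_).symm
    rw [hi0] at hnet; convert hnet using 1; ring
  have hD : sm I.o I.Q ≤ 2 * k - 1 := by
    by_contra hc
    have := nd_le_abs hk (sm I.o I.Q) 1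
    rw [abs_of_nonneg (by omega)] at this
    omega
  have hG : (I.sub (I.Q \ {x})).Good k ∅ := by
    refine hW _ ∅ ∅ (ok_sub h hss.1) (by have := size_sub h hss; omega) ⟨Or.inl rfl, ?_, ?_, ?_, ?_, ?_, by simp⟩
    · intro u hu; exact hi u (hss.1 hu)
    · exact (sm_mono hss.1 h.o0).trans hD
    · intro A hA hne _
      rw [dd_sub hss.1 hA]
      change 2 * k - 1 + nd k (I.tt A - 1) ≤ _
      have hAQ : A ≠ I.Q := by rintro rfl; exact hss.2 hA
      have hAs := hA.trans hss.1
      by_cases hc : ∃ u, A = {u}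
      · obtain ⟨u, rfl⟩ := hc
        have h1 := H.c _ hAs hne hAQ hne.ne_empty
        have h2 := hP u (by simpa using hAs)
        rw [tt_singleton] at h1 ⊢
        omega
      · push Not at hc
        have := hslack A hAs hAQ (card_two hne hc)
        have := nd_pred hk (I.tt A)
        omega
    all_goals
      have key : ∀ C ⊆ I.Q \ {x}, C.Nonempty → 2 * sm I.o C ≤ I.dd C + nd k (I.tt C) := by
        intro C hC hne
        have hCs := hC.trans hss.1
        have hxC : x ∉ C := fun hx' => by have := hC hx'; simp at this
        have h1 := H.c (I.Q \ C) sdiff_subset ⟨x, mem_sdiff.2 ⟨hx, hxC⟩⟩ (by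
          intro he; obtain ⟨y, hy⟩ := hne
          have := he ▸ hCs hy
          exact (mem_sdiff.1 this).2 hy) (Finset.Nonempty.ne_empty ⟨x, mem_sdiff.2 ⟨hx, hxC⟩⟩)
        have h2 : I.dd (I.Q \ C) = ee I.μ C (I.Q \ C) + (sm I.o I.Q - sm I.o C) := by
          unfold dd
          rw [Finset.sdiff_sdiff_eq_self hCs, ee_comm h.symm, sm_sdiff _ hCs,
            sm_zero_of (g := I.i) (fun v hv => hi v (sdiff_subset hv)),
            sm_zero_of (g := I.φ) (fun v hv => H.φz v (sdiff_subset hv))]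
          ring
        have h3 : I.dd C = ee I.μ C (I.Q \ C) + sm I.o C := by
          unfold dd
          rw [sm_zero_of (g := I.i) (fun v hv => hi v (hCs hv)),
            sm_zero_of (g := I.φ) (fun v hv => H.φz v (hCs hv))]
          ring
        have h4 := nd_triangle hk (I.tt C) (I.tt (I.Q \ C))
        rw [tt_sdiff _ hCs] at h4 h1
        rw [show I.tt C + (I.tt I.Q - I.tt C) = I.tt I.Q by ring] at h4
        omega
    · intro A hA hne _
      rw [dd_sub hss.1 hA]; exact key A hA hne
    · intro _
      rw [sub_Q, dd_sub hss.1 Subset.rfl]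
      refine key _ Subset.rfl ?_
      rw [← card_pos, card_sdiff_of_subset (by simpa using hx), card_singleton]; omega
  obtain ⟨r1, hr1, h1, -⟩ := hG
  obtain ⟨o', i', P, e1, -, -, -, -, -, e2⟩ := free h hss.1 hr1
  rw [hco] at e1 e2
  have hF := e2 I.t (fun _ => i' x) ⟨fun _ _ => 0, fun _ => 0, by
      simp [h.diag], by simpa using h.φ0 x hx, by simp⟩
  refine ⟨_, hF, ?_, by simp⟩
  have hv' : ∀ v ∈ I.Q, v ≠ x → 2 * k ∣ 2 * (if v ∈ I.Q \ {x} then r1 v else i' x) - I.dd {v} - I.t v := by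
    intro v hv hne
    have hm : v ∈ I.Q \ {x} := by simp [hv, hne]
    rw [if_pos hm]
    have := h1 v hm
    rw [dd_sub hss.1 (by simpa using hm)] at this
    exact this
  intro v hv
  by_cases hvx : v = x
  · subst hvx
    obtain ⟨f, p, hF⟩ := hF
    refine last_res h hF hv ?_ hv'
    have hp : sm p I.Q = 0 := sm_zero_of fun u hu => by
      have := hF.2.1 u hu
      have := H.φz u hu
      omega
    rw [hp, hφ0]; simpa using hnet
  · exact hv' v hv hvx

end Inst
end FR

open Finset
set_option linter.unusedSectionVars false
set_option linter.unnecessarySeqFocus false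
namespace FR
namespace Inst
variable {V : Type*} [DecidableEq V]

theorem Op.size {I I' : Inst V} {dr : V → ℤ} (O : Op I I' dr) {v : V} (hv : v ∈ I.Q) (h : I'.dd {v} < I.dd {v})
    (hd : ∀ A ⊆ I.Q, I'.dd A ≤ I.dd A) : I'.size < I.size := size_lt_of O.Q hv h hd

theorem good_mono {I : Inst V} {k : ℤ} {S S' : Finset V} (h : ∀ v ∈ I.Q, v ∈ S → v ∈ S') (G : I.Good k S') : I.Good k S := by
  obtain ⟨r, h1, h2, h3⟩ := G
  exact ⟨r, h1, h2, fun v hv hs => h3 v hv (h v hv hs)⟩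

theorem T0_del {k n : ℤ} (hk : 2 ≤ k) {I : Inst V} (hT : PT V k n) (hW : PW V k n) (h : I.Ok) (hs : I.size < n + 1)
    (H : T0H k I ∅ ∅) (hQ : 2 ≤ I.Q.card)
    (hslack : ∀ A ⊆ I.Q, A ≠ I.Q → 2 ≤ A.card → 2 * k + nd k (I.tt A) ≤ I.dd A)
    (hz : ∀ v ∈ I.Q, nd k (I.t v) ≠ 0) : I.Good k ∅ := by
  -- deletion of an arc
  by_cases c1 : ∃ u ∈ I.Q, ∃ w ∈ I.Q, 1 ≤ I.μ u w ∧ nd k (I.t u - 1) < nd k (I.t u) ∧ nd k (I.t w + 1) < nd k (I.t w)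
  · obtain ⟨u, hu, w, hw, hm, hPu, hNw⟩ := c1
    have huw := ne_of_mu h hm
    have O := op_delA h hu hw hm
    refine O.good (fun v => dl_nonneg _ _) (S' := ∅) (by simp) ?_
    refine hT _ ∅ ∅ O.ok ?_ ⟨Or.inl rfl, H.φz, ?_, ?_, ?_, by simp⟩
    · have := O.size hu (by rw [dd_delA hu hw]; simp [huw.symm]) (fun A _ => by rw [dd_delA hu hw]; split_ifs <;> omega)
      omega
    · intro A hA hne hAQ _
      rw [tt_delA, dd_delA hu hw]
      by_cases hc : ∃ x, A = {x}
      · obtain ⟨x, rfl⟩ := hc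
        have h1 := H.c _ hA hne hAQ hne.ne_empty
        rw [tt_singleton] at h1 ⊢
        by_cases hux : u = x
        · subst hux
          simp [huw.symm]; omega
        · by_cases hwx : w = x
          · subst hwx
            simp [huw]; omega
          · simpa [hux, hwx] using h1
      · push Not at hc
        have := hslack A hA hAQ (card_two hne hc)
        have := nd_pred hk (I.tt A)
        have := nd_succ hk (I.tt A)
        by_cases hux : u ∈ A <;> by_cases hwx : w ∈ A <;> simp [hux, hwx] <;> omega
    · change (I.delA u w).dd I.Q ≤ _ + nd k ((I.delA u w).tt I.Q)
      rw [tt_delA, dd_delA hu hw]; simpa [hu, hw] using H.q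
    · change _ ∣ sm I.i I.Q - sm I.o I.Q - (I.delA u w).tt I.Q
      rw [tt_delA]; simpa [hu, hw] using H.net
  by_cases c2 : ∃ u ∈ I.Q, 1 ≤ I.i u ∧ nd k (I.t u - 1) < nd k (I.t u)
  · obtain ⟨u, hu, hm, hPu⟩ := c2
    have O := op_delI h hm
    refine O.good (fun v => dl_nonneg _ _) (S' := ∅) (by simp) ?_
    refine hT _ ∅ ∅ O.ok ?_ ⟨Or.inl rfl, H.φz, ?_, ?_, ?_, by simp⟩
    · have := O.size hu (by rw [dd_delI]; simp) (fun A _ => by rw [dd_delI]; split_ifs <;> omega)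
      omega
    · intro A hA hne hAQ _
      rw [tt_delI, dd_delI]
      by_cases hc : ∃ x, A = {x}
      · obtain ⟨x, rfl⟩ := hc
        have h1 := H.c _ hA hne hAQ hne.ne_empty
        rw [tt_singleton] at h1 ⊢
        by_cases hux : u = x
        · subst hux
          simp; omega
        · simpa [hux] using h1
      · push Not at hc
        have := hslack A hA hAQ (card_two hne hc)
        have := nd_pred hk (I.tt A)
        by_cases hux : u ∈ A <;> simp [hux] <;> omega
    · change (I.delI u).dd I.Q ≤ _ + nd k ((I.delI u).tt I.Q)
      rw [tt_delI, dd_delI]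
      have := H.q
      have := nd_pred hk (I.tt I.Q)
      simp [hu]; omega
    · change _ ∣ sm (fun x => I.i x - dl u x) I.Q - sm I.o I.Q - (I.delI u).tt I.Q
      rw [tt_delI, sm_sub, sm_dl, if_pos hu]
      obtain ⟨q, hq⟩ := H.net
      exact ⟨q, by linarith⟩
  by_cases c3 : ∃ u ∈ I.Q, 1 ≤ I.o u ∧ nd k (I.t u + 1) < nd k (I.t u)
  · obtain ⟨u, hu, hm, hPu⟩ := c3
    have O := op_delO h hm
    refine O.good (fun v => le_rfl) (S' := ∅) (by simp) ?_
    refine hT _ ∅ ∅ O.ok ?_ ⟨Or.inl rfl, H.φz, ?_, ?_, ?_, by simp⟩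
    · have := O.size hu (by rw [dd_delO]; simp) (fun A _ => by rw [dd_delO]; split_ifs <;> omega)
      omega
    · intro A hA hne hAQ _
      rw [tt_delO, dd_delO]
      by_cases hc : ∃ x, A = {x}
      · obtain ⟨x, rfl⟩ := hc
        have h1 := H.c _ hA hne hAQ hne.ne_empty
        rw [tt_singleton] at h1 ⊢
        by_cases hux : u = x
        · subst hux
          simp; omega
        · simpa [hux] using h1
      · push Not at hc
        have := hslack A hA hAQ (card_two hne hc)
        have := nd_succ hk (I.tt A)
        by_cases hux : u ∈ A <;> simp [hux] <;> omega
    · change (I.delO u).dd I.Q ≤ _ + nd k ((I.delO u).tt I.Q)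
      rw [tt_delO, dd_delO]
      have := H.q
      have := nd_succ hk (I.tt I.Q)
      simp [hu]; omega
    · change _ ∣ sm I.i I.Q - sm (fun x => I.o x - dl u x) I.Q - (I.delO u).tt I.Q
      rw [tt_delO, sm_sub, sm_dl, if_pos hu]
      obtain ⟨q, hq⟩ := H.net
      exact ⟨q, by linarith⟩
  push Not at c1 c2 c3
  -- every vertex not in `P` is in `N`
  have hN : ∀ v ∈ I.Q, ¬ nd k (I.t v - 1) < nd k (I.t v) → nd k (I.t v + 1) < nd k (I.t v) := by
    intro v hv hnp
    have := (nonpos_succ hk hnp (hz v hv)).1; omega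
  by_cases hall : ∀ v ∈ I.Q, nd k (I.t v - 1) < nd k (I.t v)
  · refine T0_final hk hW h hs H hQ hslack hall fun v hv => ?_
    by_contra hne
    have := h.i0 v hv
    exact absurd (hall v hv) (not_lt.2 (c2 v hv (by omega)))
  by_cases hall2 : ∀ v ∈ I.Q, ¬ nd k (I.t v - 1) < nd k (I.t v)
  · refine good_rev h ?_
    have hsz : I.rev.size = I.size := by
      unfold size; exact Finset.sum_congr rfl fun v _ => by rw [dd_rev]
    refine T0_final hk hW (ok_rev h) (by rw [hsz]; exact hs) ⟨Or.inl rfl, H.φz, ?_, ?_, ?_, by simp⟩ hQ ?_ ?_ ?_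
    · intro A hA hne hAQ hZ
      rw [tt_rev, dd_rev, nd_neg hk]; exact H.c A hA hne hAQ hZ
    · rw [tt_rev, dd_rev, nd_neg hk]; exact H.q
    · rw [tt_rev]
      obtain ⟨q, hq⟩ := H.net
      exact ⟨-q, by simp only [rev]; linarith⟩
    · intro A hA hAQ h2
      rw [tt_rev, dd_rev, nd_neg hk]; exact hslack A hA hAQ h2
    · intro v hv
      have := hN v hv (hall2 v hv)
      simp only [rev]
      rw [show -I.t v - 1 = -(I.t v + 1) by ring, nd_neg hk, nd_neg hk]; exact this
    · intro v hv
      by_contra hne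
      have := h.o0 v hv
      have h3 : 1 ≤ I.o v := by have : I.o v ≠ 0 := hne; omega
      have := c3 v hv h3
      have := hN v hv (hall2 v hv)
      omega
  exfalso
  push Not at hall hall2
  obtain ⟨b, hb, hb'⟩ := hall
  obtain ⟨a, ha, ha'⟩ := hall2
  set P := I.Q.filter fun v => nd k (I.t v - 1) < nd k (I.t v) with hPdef
  have hPs : P ⊆ I.Q := filter_subset _ _
  have haP : a ∈ P := mem_filter.2 ⟨ha, ha'⟩
  have hbP : b ∈ I.Q \ P := mem_sdiff.2 ⟨hb, fun h => absurd (mem_filter.1 h).2 (not_lt.2 hb')⟩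
  have e1 := H.c P hPs ⟨a, haP⟩ (fun he => (mem_sdiff.1 hbP).2 (he ▸ hb)) (Finset.Nonempty.ne_empty ⟨a, haP⟩)
  have e2 := H.c (I.Q \ P) sdiff_subset ⟨b, hbP⟩ (fun he => by
      have ha2 := ha
      rw [← he] at ha2
      exact (mem_sdiff.1 ha2).2 haP)
    (Finset.Nonempty.ne_empty ⟨b, hbP⟩)
  have e3 := dd_union h hPs sdiff_subset (disjoint_sdiff (s := P) (t := I.Q))
  have e4 : ee I.μ P (I.Q \ P) = 0 := by
    refine Finset.sum_eq_zero fun u hu => Finset.sum_eq_zero fun w hw => ?_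
    by_contra hne
    have hu1 := mem_filter.1 hu
    have hw1 := mem_sdiff.1 hw
    have := h.nn u w
    have := c1 u hu1.1 w hw1.1 (by omega) hu1.2
    have := hN w hw1.1 (fun hh => hw1.2 (mem_filter.2 ⟨hw1.1, hh⟩))
    omega
  rw [union_sdiff_of_subset hPs] at e3
  have e5 := nd_triangle hk (I.tt P) (I.tt (I.Q \ P))
  rw [tt_sdiff _ hPs, show I.tt P + (I.tt I.Q - I.tt P) = I.tt I.Q by ring] at e5
  rw [tt_sdiff _ hPs] at e2
  have := H.q
  omega

theorem slack_of {k : ℤ} (hk : 2 ≤ k) {I : Inst V} (h : I.Ok) {A : Finset V} (hA : A ⊆ I.Q)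
    (hn : ¬ I.dd A ≤ 2 * k - 2 + nd k (I.tt A)) : 2 * k + nd k (I.tt A) ≤ I.dd A := by
  have := dd_par h hA
  have := nd_par hk (I.tt A)
  omega

theorem T0_step {k n : ℤ} (hk : 2 ≤ k) (hT : PT V k n) (hW : PW V k n) : PT V k (n + 1) := by
  have hkk := hk
  intro I Z S h hs H
  -- normalise `Z`
  have key : ∀ Z, (Z = ∅ ∨ ∃ v ∈ I.Q, Z = {v}) → T0H k I Z S → I.Good k S := by
    clear H Z
    intro Z hZ H
    by_cases hc0 : I.Q = ∅
    · exact good_empty hc0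
    by_cases hc1 : ∃ v, I.Q = {v}
    · obtain ⟨v, hv⟩ := hc1
      have hvQ : v ∈ I.Q := by rw [hv]; simp
      have hnet := H.net
      have hfull := dd_full I
      have hφ := H.φz v hvQ
      have hq := H.q
      simp only [hv, sm_singleton, tt_singleton] at hnet hfull hq
      refine good_one h hv 0 le_rfl (h.φ0 v hvQ) ?_ ?_
      · rw [hfull, hφ]
        obtain ⟨q, hq⟩ := hnet
        exact ⟨q, by linarith⟩
      · intro hvS
        have := (H.s v hvQ hvS).2
        omega
    push Not at hc1
    have hQ := card_two (nonempty_iff_ne_empty.2 hc0) hc1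
    by_cases hti : ∃ A ⊆ I.Q, A ≠ I.Q ∧ 2 ≤ A.card ∧ I.dd A ≤ 2 * k - 2 + nd k (I.tt A)
    · obtain ⟨A, hA, hAQ, h2, ht⟩ := hti
      exact T0_tight hT h hs H hA hAQ h2 ht
    have hslack : ∀ A ⊆ I.Q, A ≠ I.Q → 2 ≤ A.card → 2 * k + nd k (I.tt A) ≤ I.dd A := by
      intro A hA hAQ h2
      exact slack_of hk h hA fun hn => hti ⟨A, hA, hAQ, h2, hn⟩
    rcases hZ with rfl | ⟨v, hv, rfl⟩
    · by_cases hS : ∃ v ∈ I.Q, v ∈ S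
      · obtain ⟨v, hv, hvS⟩ := hS
        exact T0_sstep hk hT h hs H hQ hslack hv hvS
      push Not at hS
      refine good_mono (S' := ∅) (fun v hv hvS => absurd hvS (hS v hv)) ?_
      have H' : T0H k I ∅ ∅ := ⟨H.z, H.φz, H.c, H.q, H.net, by simp⟩
      by_cases hz : ∃ v ∈ I.Q, nd k (I.t v) = 0
      · obtain ⟨v, hv, hz⟩ := hz
        exact T0_zstep hk hT h hs H' hQ hslack hv ((nd_eq_zero hk).1 hz) (by simp) (Or.inl rfl)
      · push Not at hz
        exact T0_del hk hT hW h hs H' hQ hslack hz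
    · refine T0_zstep hk hT h hs H hQ hslack hv ?_ (fun hvS => (H.s v hv hvS).1 (by simp)) (Or.inr rfl)
      rcases H.z with hz | ⟨u, hu, hz⟩
      · simp at hz
      · rw [singleton_inj] at hu; subst hu; exact hz
  rcases H.z with hz | ⟨v, hv, hz⟩
  · exact key Z (Or.inl hz) H
  · by_cases hvQ : v ∈ I.Q
    · exact key Z (Or.inr ⟨v, hvQ, hv⟩) H
    · refine key ∅ (Or.inl rfl) ⟨Or.inl rfl, H.φz, ?_, H.q, H.net, fun u hu hS => ⟨by simp, (H.s u hu hS).2⟩⟩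
      intro A hA hne hAQ _
      refine H.c A hA hne hAQ ?_
      rintro rfl; subst hv
      exact hvQ (hA (by simp))

end Inst
end FR

open Finset
set_option linter.unusedSectionVars false
set_option linter.unnecessarySeqFocus false
namespace FR
namespace Inst
variable {V : Type*} [DecidableEq V]

/-- fixing the directions of all free edges -/
theorem fix_phi {I : Inst V} {k : ℤ} {S : Finset V} (p : V → ℤ) (hp : ∀ v ∈ I.Q, 0 ≤ p v ∧ p v ≤ I.φ v)
    (sd : Side I I.Q (fun v => I.o v + I.φ v - p v) (fun v => I.i v + p v))
    (G : (I.side I.Q (fun v => I.o v + I.φ v - p v) (fun v => I.i v + p v)).Good k S) : I.Good k S := by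
  obtain ⟨r, ⟨f, q, h1, h2, h3⟩, h4, h5⟩ := G
  refine ⟨r, ⟨f, p, h1, hp, ?_⟩, ?_, h5⟩
  · intro v hv
    have e1 := h2 v hv
    have e2 := h3 v hv
    simp only [side] at e1 e2
    rw [e2]; linarith
  · intro v hv
    have := h4 v hv
    rw [sd.dd {v} (singleton_subset_iff.2 hv)] at this
    exact this

theorem last_vertex {I : Inst V} (h : I.Ok) {k : ℤ} {S : Finset V} {y : V} (hy : y ∈ I.Q) (hφ : ∀ u ∈ I.Q, u ≠ y → I.φ u = 0)
    (G : (I.sub (I.Q \ {y})).Good k S) (p : ℤ) (hp0 : 0 ≤ p) (hp1 : p ≤ I.φ y)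
    (hp : 2 * k ∣ 2 * p - I.φ y + sm I.i I.Q - sm I.o I.Q - I.tt I.Q) (hS : y ∈ S → 1 ≤ p) : I.Good k S := by
  obtain ⟨r1, hr1, h1, h1S⟩ := G
  obtain ⟨hss, hco⟩ := ok_rem h hy
  obtain ⟨o', i', P, e1, e3, e4, e5, -, -, e2⟩ := free h hss.1 hr1
  rw [hco] at e1 e2 e3 e4
  rw [sm_singleton, sm_singleton] at e3 e4
  obtain ⟨e6, e7, e8⟩ := e1 y (by simp)
  have hi'0 : 0 ≤ i' y := by have := h.i0 y hy; omega
  have hF := e2 I.t (fun _ => p + i' y) ⟨fun _ _ => 0, fun _ => p, by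
      simp [h.diag], by simp; exact ⟨hp0, hp1⟩, by simp⟩
  have hv' : ∀ v ∈ I.Q, v ≠ y → 2 * k ∣ 2 * (if v ∈ I.Q \ {y} then r1 v else p + i' y) - I.dd {v} - I.t v := by
    intro v hv hne
    have hm : v ∈ I.Q \ {y} := by simp [hv, hne]
    rw [if_pos hm]
    have := h1 v hm
    rw [dd_sub hss.1 (by simpa using hm)] at this
    exact this
  have hys : ({y} : Finset V) ⊆ I.Q := by simpa using hy
  refine ⟨_, hF, ?_, ?_⟩
  · intro v hv
    by_cases hvx : v = y
    · subst hvx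
      rw [if_neg (by simp)]
      have s1 := sum_dd h hss.1
      have s2 : I.dd (I.Q \ {v}) = ee I.μ (I.Q \ {v}) {v} + sm I.o (I.Q \ {v}) + sm I.i (I.Q \ {v}) := by
        unfold dd
        rw [hco, sm_zero_of (g := I.φ)]
        · ring
        · intro u hu; exact hφ u (hss.1 hu) (by simpa using (mem_sdiff.1 hu).2)
      have s3 : sm (I.sub (I.Q \ {v})).φ (I.Q \ {v}) = ee I.μ (I.Q \ {v}) {v} := by
        unfold sm ee
        refine Finset.sum_congr rfl fun u hu => ?_
        simp only [sub, hco]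
        rw [hφ u (hss.1 hu) (by simpa using (mem_sdiff.1 hu).2), zero_add]
      have s4 : I.dd {v} = ee I.μ (I.Q \ {v}) {v} + I.o v + I.i v + I.φ v := by
        unfold dd; rw [ee_comm h.symm, sm_singleton, sm_singleton, sm_singleton]
      have s5 : ∑ w ∈ I.Q \ {v}, I.μ v w = ee I.μ (I.Q \ {v}) {v} := by
        rw [ee_comm h.symm, ee_singleton_left]
      have s6 : 2 * k ∣ ∑ u ∈ I.Q \ {v}, (2 * r1 u - I.dd {u} - I.t u) :=
        Finset.dvd_sum fun u hu => by
          have := hv' u (hss.1 hu) (by simpa using (mem_sdiff.1 hu).2)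
          rwa [if_pos hu] at this
      rw [Finset.sum_sub_distrib, Finset.sum_sub_distrib, ← Finset.mul_sum, s1] at s6
      have s7 : ∑ u ∈ I.Q \ {v}, r1 u = sm r1 (I.Q \ {v}) := rfl
      have s8 : ∑ u ∈ I.Q \ {v}, I.t u = I.tt I.Q - I.t v := by
        have := tt_sdiff I hys; rw [tt_singleton] at this; exact this
      rw [sm_sdiff _ hys, sm_sdiff _ hys, sm_singleton, sm_singleton] at s2
      rw [sm_sdiff I.i hys, sm_singleton] at e5
      obtain ⟨a, ha⟩ := s6
      obtain ⟨b, hb⟩ := hp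
      refine ⟨b - a, ?_⟩
      have : 2 * k * (b - a) = 2 * k * b - 2 * k * a := by ring
      have h9 : i' v = I.i v + ee I.μ (I.Q \ {v}) {v} - P := by omega
      rw [this, ← ha, ← hb, s7, s8, s4, s2, h9]
      linarith
    · exact hv' v hv hvx
  · intro v hv hvS
    by_cases hvx : v = y
    · subst hvx
      rw [if_neg (by simp)]
      have := hS hvS
      omega
    · have hm : v ∈ I.Q \ {y} := by simp [hv, hvx]
      rw [if_pos hm]
      exact h1S v hm hvS

theorem MH.con {k : ℤ} {I : Inst V} {Z S A : Finset V} {a : V} (H : MH k I Z S) (hA : A ⊆ I.Q) (ha : a ∈ A)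
    (h2 : 2 ≤ A.card) : MH k (I.con A a) (Z \ A) (S \ A) where
  z := zok_con ha H.z
  oQ := by rw [(con_o ha Subset.rfl).1, ex_Q hA ha]; exact H.oQ
  iQ := by rw [(con_o ha Subset.rfl).2.1, ex_Q hA ha]; exact H.iQ
  c := by
    intro B hB hne hnZ
    rw [tt_con ha hB, dd_con hA ha hB]
    exact H.c _ (ex_sub hA hB ha) (ex_ne hne) (ex_ne_Z h2 hB hne H.z hnZ)
  e := by
    intro v hv hvZ
    rw [mem_sdiff] at hvZ
    have hva : v ≠ a := by rintro rfl; exact hvZ.2 ha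
    rw [(con_single hA ha hv hvZ.2).1]
    have := H.e v ((mem_con.1 hv).resolve_left hva).1 hvZ.1
    simpa [Inst.con, hva] using this
  s := by
    intro v hv hvS
    rw [mem_sdiff] at hvS
    rw [(con_single hA ha hv hvS.2).1, (con_single hA ha hv hvS.2).2]
    have := H.s v ((mem_con.1 hv).resolve_left (by rintro rfl; exact hvS.2 ha)).1 hvS.1
    exact ⟨fun h => this.1 (mem_sdiff.1 h).1, this.2⟩

theorem M_aux {k n : ℤ} (hk : 2 ≤ k) (hT : PT V k (n + 1)) (hM : PM V k n) (I : Inst V) (Z S : Finset V) (h : I.Ok)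
    (hs : I.size < n + 1) (H : MH k I Z S)
    (hX : ∀ I' : Inst V, I'.Ok → I'.size < n + 1 → sm I'.φ I'.Q < sm I.φ I.Q → MH k I' Z S → I'.Good k S) : I.Good k S := by
  by_cases hc0 : I.Q = ∅
  · exact good_empty hc0
  have hQne := nonempty_iff_ne_empty.2 hc0
  have hfull := dd_full I
  have hoQ := H.oQ
  have hiQ := H.iQ
  have ho0 := sm_nonneg h.o0
  have hi0 := sm_nonneg h.i0
  have hφ0 := sm_nonneg h.φ0
  have hparQ := dd_par h (Subset.refl I.Q)
  have hndp := nd_par hk (I.tt I.Q)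
  have hndn := nd_nonneg hk (I.tt I.Q)
  obtain ⟨T, hT1, hT2⟩ : ∃ T, (T = nd k (I.tt I.Q) ∨ T = - nd k (I.tt I.Q)) ∧ 2 * k ∣ T - I.tt I.Q := by
    obtain ⟨-, -, q, hq | hq⟩ := nd_spec hk (I.tt I.Q)
    · exact ⟨_, Or.inl rfl, -q, by linarith⟩
    · exact ⟨_, Or.inr rfl, -q, by linarith⟩
  -- number of free edges directed towards the free vertex
  obtain ⟨p, hpe⟩ : ∃ p, 2 * p = sm I.φ I.Q + T + sm I.o I.Q - sm I.i I.Q := by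
    have : 2 ∣ sm I.φ I.Q + T + sm I.o I.Q - sm I.i I.Q := by omega
    obtain ⟨p, hp⟩ := this
    exact ⟨p, hp.symm⟩
  have hp2 : 2 * k ∣ 2 * p - sm I.φ I.Q + sm I.i I.Q - sm I.o I.Q - I.tt I.Q := by
    convert hT2 using 1; linarith
  by_cases hc1 : ∃ v, I.Q = {v}
  · obtain ⟨v, hv⟩ := hc1
    have hvQ : v ∈ I.Q := by rw [hv]; simp
    have hb : 0 ≤ p ∧ p ≤ sm I.φ I.Q ∧ (v ∈ S → 1 ≤ p) := by
      by_cases hZ : I.Q = Z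
      · have e := H.e v hvQ (by rw [← hZ]; exact hvQ)
        have hz : nd k (I.tt I.Q) = 0 := by
          rw [nd_eq_zero hk]
          rcases H.z with hz | ⟨u, hu, hz⟩
          · exact absurd (hZ.trans hz) hc0
          · have := hv.symm.trans (hZ.trans hu)
            rw [singleton_inj] at this; subst this
            rwa [hv, tt_singleton]
        have e1 : sm I.o I.Q = I.o v := by rw [hv, sm_singleton]
        have e2 : sm I.i I.Q = I.i v := by rw [hv, sm_singleton]
        have e3 : I.dd {v} = I.dd I.Q := by rw [hv]
        rw [e3] at e
        refine ⟨by omega, by omega, ?_⟩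
        intro hvS
        exact absurd (hZ ▸ hvQ) (H.s v hvQ hvS).1
      · have := H.c _ Subset.rfl hQne hZ
        refine ⟨by omega, by omega, ?_⟩
        intro hvS
        have h9 := (H.s v hvQ hvS).2
        have e1 : I.t v = I.tt I.Q := by rw [hv, tt_singleton]
        have e3 : I.dd {v} = I.dd I.Q := by rw [hv]
        rw [e3, e1] at h9
        omega
    have hi1 := h.i0 v hvQ
    simp only [hv, sm_singleton, tt_singleton] at hb hp2 hfull
    refine good_one h hv p hb.1 hb.2.1 ?_ (fun hvS => by have := hb.2.2 hvS; omega)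
    rw [hfull]
    obtain ⟨q, hq⟩ := hp2
    exact ⟨q, by linarith⟩
  push Not at hc1
  have hQ2 := card_two hQne hc1
  have hQZ : I.Q ≠ Z := by
    rintro h1
    rcases H.z with hz | ⟨u, hu, hz⟩
    · exact hc0 (h1.trans hz)
    · exact hc1 u (h1.trans hu)
  have hcQ := H.c _ Subset.rfl hQne hQZ
  have hpb : 0 ≤ p ∧ p ≤ sm I.φ I.Q := by omega
  by_cases hsm : I.dd I.Q ≤ 2 * k - 2 + nd k (I.tt I.Q)
  · obtain ⟨g, hg1, hg2⟩ := split I.Q I.φ h.φ0 p hpb.1 hpb.2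
    have sd : Side I I.Q (fun v => I.o v + I.φ v - g v) (fun v => I.i v + g v) := by
      refine side_of h Subset.rfl fun v hv => ?_
      have := hg1 v hv
      have := h.o0 v hv
      have := h.i0 v hv
      refine ⟨by omega, by omega, ?_⟩
      simp; ring
    refine fix_phi g hg1 sd ?_
    refine hT _ Z S sd.ok (by have := sd.sz'; omega) ⟨H.z, fun _ _ => rfl, ?_, ?_, ?_, ?_⟩
    · intro A hA hne _ hZ
      rw [sd.dd A hA]; exact H.c A hA hne hZ
    · rw [side_Q, sd.dd _ Subset.rfl]; exact hsm
    · rw [side_Q]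
      change 2 * k ∣ sm (fun v => I.i v + g v) I.Q - sm (fun v => I.o v + I.φ v - g v) I.Q - I.tt I.Q
      rw [sm_add, sm_sub, sm_add]
      have : sm g I.Q = p := hg2
      rw [this]
      obtain ⟨q, hq⟩ := hp2
      exact ⟨q, by linarith⟩
    · intro v hv hvS
      rw [sd.dd {v} (singleton_subset_iff.2 hv)]
      exact H.s v hv hvS
  by_cases hti : ∃ A ⊆ I.Q, A ≠ I.Q ∧ 2 ≤ A.card ∧ I.dd A ≤ 2 * k - 2 + nd k (I.tt A)
  · obtain ⟨A, hA, hAQ, h2, ht⟩ := hti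
    obtain ⟨a, ha⟩ : A.Nonempty := by rw [← card_pos]; omega
    have hG : (I.con A a).Good k (S \ A) :=
      hM _ _ _ (ok_con h hA ha) (by have := size_con h hA ha h2; omega) (H.con hA ha h2)
    refine glue_good h hA ha (fun u hu hu' => mem_sdiff.2 ⟨hu, hu'⟩) hG ?_
    intro o' i' sd _ hnet _
    refine hT _ Z S sd.ok (by have := sd.sz hAQ; omega) ⟨H.z, fun _ _ => rfl, ?_, ?_, hnet, ?_⟩
    · intro C hC hne _ hZ
      rw [sd.dd C hC]
      exact H.c C (hC.trans hA) hne hZ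
    · rw [show (I.side A o' i').Q = A from rfl, sd.dd A Subset.rfl]; exact ht
    · intro v hv hvS
      rw [sd.dd {v} (singleton_subset_iff.2 hv)]
      exact H.s v (hA hv) hvS
  have hslack : ∀ A ⊆ I.Q, 2 ≤ A.card → 2 * k + nd k (I.tt A) ≤ I.dd A := by
    intro A hA h2
    refine slack_of hk h hA fun hn => ?_
    by_cases hAQ : A = I.Q
    · subst hAQ; exact hsm hn
    · exact hti ⟨A, hA, hAQ, h2, hn⟩
  have hslQ := hslack I.Q Subset.rfl hQ2
  obtain ⟨y, hy, hφy⟩ : ∃ y ∈ I.Q, 0 < I.φ y := sm_pos (by omega)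
  by_cases hy2 : ∃ y' ∈ I.Q, y' ≠ y ∧ 0 < I.φ y'
  · obtain ⟨y', hy', hne, hφy'⟩ := hy2
    have O := op_lftX h hy hy' hne.symm hφy hφy'
    refine O.good (fun _ => le_rfl) (S' := S) (fun u hu => Or.inl hu) ?_
    have hsingle : ∀ v, (I.lftX y y').dd {v} = I.dd {v} := by
      intro v; rw [dd_lftX hy hy', if_neg]; · ring
      rintro ⟨h1, h2⟩; rw [mem_singleton] at h1 h2; exact hne (h2.trans h1.symm)
    refine hX _ O.ok ?_ ?_ ⟨H.z, H.oQ, H.iQ, ?_, ?_, ?_⟩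
    · have : (I.lftX y y').size = I.size := Finset.sum_congr rfl fun v _ => by rw [hsingle]
      omega
    · have e1 := dd_full (I.lftX y y')
      have e2 : (I.lftX y y').dd (I.lftX y y').Q = I.dd I.Q - 2 := by
        change (I.lftX y y').dd I.Q = _
        rw [dd_lftX hy hy', if_pos ⟨hy, hy'⟩]
      change _ = sm I.o I.Q + sm I.i I.Q + sm (I.lftX y y').φ (I.lftX y y').Q at e1
      omega
    · intro A hA hAne hAZ
      rw [tt_lftX]
      by_cases hc : ∃ u, A = {u}
      · obtain ⟨u, rfl⟩ := hc
        rw [hsingle]; exact H.c _ hA hAne hAZ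
      · push Not at hc
        have := hslack A hA (card_two hAne hc)
        rw [dd_lftX hy hy']
        split_ifs <;> omega
    · intro v hv hvZ
      rw [hsingle]; exact H.e v hv hvZ
    · intro v hv hvS
      rw [hsingle]; exact H.s v hv hvS
  · push Not at hy2
    have hφz : ∀ u ∈ I.Q, u ≠ y → I.φ u = 0 := fun u hu hne => le_antisymm (hy2 u hu hne) (h.φ0 u hu)
    have hφs : sm I.φ I.Q = I.φ y := by
      unfold sm
      exact Finset.sum_eq_single_of_mem y hy hφz
    obtain ⟨hss, hco⟩ := ok_rem h hy
    refine last_vertex h hy hφz ?_ p hpb.1 (by omega) (by rw [← hφs]; exact hp2) (fun _ => by omega)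
    refine hM _ Z S (ok_sub h hss.1) (by have := size_sub h hss; omega) ⟨H.z, ?_, ?_, ?_, ?_, ?_⟩
    · exact (sm_mono hss.1 h.o0).trans H.oQ
    · exact (sm_mono hss.1 h.i0).trans H.iQ
    · intro A hA hne hZ
      rw [dd_sub hss.1 hA]; exact H.c A (hA.trans hss.1) hne hZ
    · intro v hv hvZ
      rw [dd_sub hss.1 (singleton_subset_iff.2 hv)]; exact H.e v (hss.1 hv) hvZ
    · intro v hv hvS
      rw [dd_sub hss.1 (singleton_subset_iff.2 hv)]; exact H.s v (hss.1 hv) hvS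

theorem M_step {k n : ℤ} (hk : 2 ≤ k) (hT : PT V k (n + 1)) (hM : PM V k n) : PM V k (n + 1) := by
  have key : ∀ m : ℕ, ∀ (I : Inst V) (Z S : Finset V), I.Ok → I.size < n + 1 → sm I.φ I.Q < m → MH k I Z S → I.Good k S := by
    intro m
    induction m with
    | zero =>
      intro I Z S h _ hm
      have := sm_nonneg h.φ0
      push_cast at hm; omega
    | succ m ih =>
      intro I Z S h hs hm H
      refine M_aux hk hT hM I Z S h hs H fun I' h' hs' hm' H' => ih I' Z S h' hs' (by push_cast at hm; omega) H'
  intro I Z S h hs H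
  exact key ((sm I.φ I.Q).toNat + 1) I Z S h hs (by have := sm_nonneg h.φ0; push_cast; omega) H

end Inst
end FR

open Finset
set_option linter.unusedSectionVars false
set_option linter.unnecessarySeqFocus false
namespace FR
namespace Inst
variable {V : Type*} [DecidableEq V]

theorem WH.con {k : ℤ} {I : Inst V} {Z S S1 A : Finset V} {a : V} (H : WH k I Z S) (hA : A ⊆ I.Q) (ha : a ∈ A)
    (h2 : 2 ≤ A.card) (hS : ∀ v ∈ S1, (v ∈ S ∧ v ∉ A) ∨ (v = a ∧ ¬ nd k (I.tt A - 1) < nd k (I.tt A))) :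
    WH k (I.con A a) (Z \ A) S1 where
  z := zok_con ha H.z
  iz := by
    intro u hu
    have h1 := (con_o ha (singleton_subset_iff.2 hu)).2.1
    rw [sm_singleton] at h1
    rw [h1]
    exact sm_zero_of fun x hx => H.iz x (ex_sub hA (singleton_subset_iff.2 hu) ha hx)
  oQ := by rw [(con_o ha Subset.rfl).1, ex_Q hA ha]; exact H.oQ
  c := by
    intro B hB hne hnZ
    rw [tt_con ha hB, dd_con hA ha hB]
    exact H.c _ (ex_sub hA hB ha) (ex_ne hne) (ex_ne_Z h2 hB hne H.z hnZ)
  b := by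
    intro B hB hne hnQ
    rw [tt_con ha hB, dd_con hA ha hB, (con_o ha hB).1]
    exact H.b _ (ex_sub hA hB ha) (ex_ne hne) (ex_ne_Q hA ha hB hnQ)
  bQ := by
    rw [tt_con ha Subset.rfl, dd_con hA ha Subset.rfl, (con_o ha Subset.rfl).1, ex_Q hA ha]
    intro hc
    exact H.bQ (hc.imp id fun hn => hn.mono sdiff_subset)
  s := by
    intro v hv hvS
    rcases hS v hvS with ⟨h1, h3⟩ | ⟨rfl, h1⟩
    · rw [(con_single hA ha hv h3).2]
      have := H.s v ((mem_con.1 hv).resolve_left (by rintro rfl; exact h3 ha)).1 h1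
      exact ⟨fun h => this.1 (mem_sdiff.1 h).1, this.2⟩
    · rw [(con_self hA ha).2]
      exact ⟨fun h => (mem_sdiff.1 h).2 ha, h1⟩

theorem WH.s' {k : ℤ} (hk : 2 ≤ k) {I : Inst V} {Z S : Finset V} (H : WH k I Z S) {v : V} (hv : v ∈ I.Q) (hvS : v ∈ S) :
    v ∉ Z ∧ 2 * k + nd k (I.t v) ≤ I.dd {v} := by
  obtain ⟨h1, h2⟩ := H.s v hv hvS
  refine ⟨h1, ?_⟩
  have := H.c {v} (singleton_subset_iff.2 hv) (singleton_nonempty v) (by rintro rfl; simp at h1)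
  rw [tt_singleton] at this
  have := nd_pred hk (I.t v)
  omega

theorem WH.c' {k : ℤ} (hk : 2 ≤ k) {I : Inst V} {Z S : Finset V} (H : WH k I Z S) {A : Finset V} (hA : A ⊆ I.Q)
    (hne : A.Nonempty) (hZ : A ≠ Z) : 2 * k - 2 + nd k (I.tt A) ≤ I.dd A := by
  have := H.c A hA hne hZ
  have := nd_pred hk (I.tt A)
  omega

theorem W_tight_pos {k n : ℤ} (hk : 2 ≤ k) (hT : PT V k (n + 1)) (hW : PW V k n) {I : Inst V} {Z S : Finset V} (h : I.Ok)
    (hs : I.size < n + 1) (H : WH k I Z S) {A : Finset V} (hA : A ⊆ I.Q) (h2 : 2 ≤ A.card)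
    (ht : I.dd A ≤ 2 * k - 1 + nd k (I.tt A - 1)) (hp : nd k (I.tt A - 1) < nd k (I.tt A)) : I.Good k S := by
  obtain ⟨a, ha⟩ : A.Nonempty := by rw [← card_pos]; omega
  have hG : (I.con A a).Good k (S \ A) :=
    hW _ _ _ (ok_con h hA ha) (by have := size_con h hA ha h2; omega)
      (H.con hA ha h2 fun v hv => Or.inl (mem_sdiff.1 hv))
  refine glue_good h hA ha (fun u hu hu' => mem_sdiff.2 ⟨hu, hu'⟩) hG ?_
  intro o' i' sd _ hnet _
  refine hT _ Z S sd.ok (by have := sd.sz'; omega) ⟨H.z, fun _ _ => rfl, ?_, ?_, hnet, ?_⟩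
  · intro C hC hne _ hZ
    rw [sd.dd C hC]
    exact H.c' hk (hC.trans hA) hne hZ
  · rw [side_Q, sd.dd A Subset.rfl]
    change _ ≤ _ + nd k (I.tt A); omega
  · intro v hv hvS
    rw [sd.dd {v} (singleton_subset_iff.2 hv)]
    exact H.s' hk (hA hv) hvS

theorem W_tight_nonpos {k n : ℤ} (hk : 2 ≤ k) (hT : PT V k (n + 1)) (hW : PW V k n) {I : Inst V} {Z S : Finset V} (h : I.Ok)
    (hs : I.size < n + 1) (H : WH k I Z S) {A : Finset V} (hA : A ⊆ I.Q) (h2 : 2 ≤ A.card)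
    (ht : I.dd A ≤ 2 * k - 1 + nd k (I.tt A - 1)) (hp : ¬ nd k (I.tt A - 1) < nd k (I.tt A))
    (hslack : ∀ C ⊆ I.Q, 2 ≤ C.card → 2 * k + nd k (I.tt C) ≤ I.dd C) : I.Good k S := by
  obtain ⟨a, ha⟩ : A.Nonempty := by rw [← card_pos]; omega
  have hG : (I.con A a).Good k (insert a (S \ A)) :=
    hW _ _ _ (ok_con h hA ha) (by have := size_con h hA ha h2; omega)
      (H.con hA ha h2 fun v hv => by
        rcases mem_insert.1 hv with h | h
        · exact Or.inr ⟨h, hp⟩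
        · exact Or.inl (mem_sdiff.1 h))
  refine glue_good h hA ha (fun u hu hu' => mem_insert_of_mem (mem_sdiff.2 ⟨hu, hu'⟩)) hG ?_
  intro o' i' sd hpt hnet h1
  have h1 := h1 (mem_insert_self _ _)
  have hJs := sd.sz'
  have hdd := sd.dd
  have htt : ∀ C, (I.side A o' i').tt C = I.tt C := fun C => rfl
  by_cases hy : ∃ y ∈ A, 1 ≤ i' y ∧ y ∉ Z
  · obtain ⟨y, hyA, hy1, hyZ⟩ := hy
    have O := op_delI sd.ok (v := y) hy1
    have hyQ : y ∈ (I.side A o' i').Q := hyA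
    refine O.good (fun v => dl_nonneg _ _) (S' := S.erase y) ?_ ?_
    · intro u hu
      by_cases huy : u = y
      · right; simp [dl, huy]
      · left; exact mem_erase.2 ⟨huy, hu⟩
    refine hT _ Z _ O.ok ?_ ⟨?_, fun _ _ => rfl, ?_, ?_, ?_, ?_⟩
    · have := O.size hyQ (by rw [dd_delI]; simp) (fun A _ => by rw [dd_delI]; split_ifs <;> omega)
      omega
    · rcases H.z with hz | ⟨v, hv, hz⟩
      · exact Or.inl hz
      · refine Or.inr ⟨v, hv, ?_⟩
        have : v ≠ y := by rintro rfl; rw [hv] at hyZ; simp at hyZ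
        simpa [delI, side, dl, this] using hz
    · intro C hC hne _ hZ
      rw [tt_delI, dd_delI, hdd C hC, htt]
      have := H.c C (hC.trans hA) hne hZ
      have := nd_pred hk (I.tt C)
      split_ifs
      · omega
      · simp; omega
    · change ((I.side A o' i').delI y).dd A ≤ _ + nd k (((I.side A o' i').delI y).tt A)
      rw [tt_delI, dd_delI, hdd A Subset.rfl, htt]
      simp [hyA]; omega
    · change _ ∣ sm (fun x => i' x - dl y x) A - sm o' A - ((I.side A o' i').delI y).tt A
      rw [tt_delI, sm_sub, sm_dl, htt]
      simp only [hyA, if_true]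
      obtain ⟨q, hq⟩ := hnet
      exact ⟨q, by linarith⟩
    · intro v hv hvS
      rw [mem_erase] at hvS
      rw [dd_delI, hdd {v} (singleton_subset_iff.2 hv)]
      have := H.s' hk (hA hv) hvS.2
      have hne : y ∉ ({v} : Finset V) := by simpa using hvS.1.symm
      simpa [hne, delI, side, dl, hvS.1] using this
  · push Not at hy
    obtain ⟨v, hv, hv1⟩ : ∃ y ∈ A, 0 < i' y := sm_pos (by omega)
    have hvZ := hy v hv hv1
    obtain ⟨hZ, htv⟩ : Z = {v} ∧ 2 * k ∣ I.t v := by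
      rcases H.z with rfl | ⟨u, rfl, hu⟩
      · simp at hvZ
      · rw [mem_singleton] at hvZ; subst hvZ; exact ⟨rfl, hu⟩
    have hvA : {v} ⊆ A := singleton_subset_iff.2 hv
    have hne : (A \ {v}).Nonempty := by
      rw [← card_pos, card_sdiff_of_subset hvA, card_singleton]; omega
    obtain ⟨w, hwA, hw1⟩ : ∃ w ∈ A, 1 ≤ I.μ v w := by
      by_contra hc
      push Not at hc
      have e1 := dd_union h (hvA.trans hA) (sdiff_subset.trans hA) (disjoint_sdiff (s := {v}) (t := A))
      rw [union_sdiff_of_subset hvA, ee_singleton_left, Finset.sum_eq_zero fun x hx => by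
        have := hc x (sdiff_subset hx); have := h.nn v x; omega] at e1
      have e2 := H.c (A \ {v}) (sdiff_subset.trans hA) hne (by
        rw [hZ]; intro he; have := he ▸ mem_singleton_self v; simp at this)
      rw [tt_sdiff _ hvA, tt_singleton, show I.tt A - I.t v - 1 = I.tt A - 1 - I.t v by ring, nd_sub htv] at e2
      have e3 := dd_single sd.ok (v := v) hv
      rw [hdd {v} hvA] at e3
      have e4 : 0 ≤ ∑ w ∈ (I.side A o' i').Q, (I.side A o' i').μ v w := Finset.sum_nonneg fun x _ => h.nn v x
      have e5 := (hpt v hv).1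
      have e6 : (I.side A o' i').o v = o' v := rfl
      have e7 : (I.side A o' i').i v = i' v := rfl
      have e8 : (I.side A o' i').φ v = 0 := rfl
      omega
    have hvw := ne_of_mu h hw1
    have hvJ : v ∈ (I.side A o' i').Q := hv
    have hwJ : w ∈ (I.side A o' i').Q := hwA
    have O := op_delW sd.ok hvJ hwJ hw1 hv1
    refine O.good (fun v => add_nonneg (dl_nonneg _ _) (dl_nonneg _ _)) (S' := S.erase w) ?_ ?_
    · intro u hu
      by_cases huy : u = w
      · right; have := dl_nonneg v u
        have : dl w u = 1 := by simp [dl, huy]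
        omega
      · left; exact mem_erase.2 ⟨huy, hu⟩
    refine hT _ Z _ O.ok ?_ ⟨?_, fun _ _ => rfl, ?_, ?_, ?_, ?_⟩
    · have := O.size hvJ (by rw [dd_delW hvJ hwJ]; simp [hvw.symm]) (fun A _ => by rw [dd_delW hvJ hwJ]; split_ifs <;> omega)
      omega
    · refine Or.inr ⟨v, hZ, ?_⟩
      simpa [delW, side, dl, hvw] using htv
    · intro C hC hCne _ hCZ
      rw [tt_delW, dd_delW hvJ hwJ, hdd C hC, htt]
      have := H.c C (hC.trans hA) hCne hCZ
      have := nd_pred hk (I.tt C)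
      by_cases hwC : w ∈ C
      · simp [hwC]; omega
      · by_cases hvC : v ∈ C
        · have := hslack C (hC.trans hA) (card_two hCne fun u hu => by
            rw [hu, mem_singleton] at hvC; exact hCZ (by rw [hu, hZ, hvC]))
          simp [hwC, hvC]; omega
        · simp [hwC, hvC]; omega
    · change ((I.side A o' i').delW v w).dd A ≤ _ + nd k (((I.side A o' i').delW v w).tt A)
      rw [tt_delW, dd_delW hvJ hwJ, hdd A Subset.rfl, htt]
      simp [hwA]; omega
    · change _ ∣ sm (fun x => i' x - dl v x) A - sm o' A - ((I.side A o' i').delW v w).tt A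
      rw [tt_delW, sm_sub, sm_dl, htt]
      simp only [hv, hwA, if_true]
      obtain ⟨q, hq⟩ := hnet
      exact ⟨q, by linarith⟩
    · intro u hu huS
      rw [mem_erase] at huS
      rw [dd_delW hvJ hwJ, hdd {u} (singleton_subset_iff.2 hu)]
      have h5 := H.s' hk (hA hu) huS.2
      have hne1 : w ≠ u := huS.1.symm
      have hne2 : v ≠ u := by rintro rfl; exact h5.1 hvZ
      simpa [hne1, hne2, delW, side, dl, huS.1] using h5

end Inst
end FR

open Finset
set_option linter.unusedSectionVars false
set_option linter.unnecessarySeqFocus false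
namespace FR
namespace Inst
variable {V : Type*} [DecidableEq V]

theorem sd_Q {I : Inst V} {A : Finset V} (hA : A ⊆ I.Q) : I.Q \ (I.Q \ A) = A := Finset.sdiff_sdiff_eq_self hA

/-- M with total in-root `k` allowed -/
theorem M_plus {k n : ℤ} (hk : 2 ≤ k) (hM : PM V k (n + 1)) {J : Inst V} {Z S : Finset V} (h : J.Ok) (hs : J.size < n + 1)
    (hz : ZOk k J Z) (hoQ : sm J.o J.Q ≤ k - 1) (hiQ : sm J.i J.Q ≤ k)
    (hc : ∀ A ⊆ J.Q, A.Nonempty → A ≠ Z → 2 * k - 1 + nd k (J.tt A - 1) ≤ J.dd A)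
    (he : ∀ v ∈ J.Q, v ∈ Z → 2 * (J.o v + J.i v) ≤ J.dd {v})
    (hS : ∀ v ∈ J.Q, v ∈ S → v ∉ Z ∧ 2 * k + nd k (J.t v) ≤ J.dd {v})
    (hslack : ∀ C ⊆ J.Q, 2 ≤ C.card → 2 * k + nd k (J.tt C) ≤ J.dd C) : J.Good k S := by
  have hc' : ∀ A ⊆ J.Q, A.Nonempty → A ≠ Z → 2 * k - 2 + nd k (J.tt A) ≤ J.dd A := by
    intro A hA hne hZ
    have := hc A hA hne hZ
    have := nd_pred hk (J.tt A)
    omega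
  by_cases hi : sm J.i J.Q ≤ k - 1
  · exact hM J Z S h hs ⟨hz, hoQ, hi, hc', he, hS⟩
  by_cases hy : ∃ y ∈ J.Q, 1 ≤ J.i y ∧ y ∉ Z
  · obtain ⟨y, hyQ, hy1, hyZ⟩ := hy
    have O := op_delI h (v := y) hy1
    refine O.good (fun v => dl_nonneg _ _) (S' := S.erase y) ?_ ?_
    · intro u hu
      by_cases huy : u = y
      · right; simp [dl, huy]
      · left; exact mem_erase.2 ⟨huy, hu⟩
    refine hM _ Z _ O.ok ?_ ⟨?_, hoQ, ?_, ?_, ?_, ?_⟩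
    · have := O.size hyQ (by rw [dd_delI]; simp) (fun A _ => by rw [dd_delI]; split_ifs <;> omega)
      omega
    · rcases hz with hz | ⟨v, hv, hz⟩
      · exact Or.inl hz
      · refine Or.inr ⟨v, hv, ?_⟩
        have : v ≠ y := by rintro rfl; rw [hv] at hyZ; simp at hyZ
        simpa [delI, dl, this] using hz
    · change sm (fun x => J.i x - dl y x) J.Q ≤ _
      rw [sm_sub, sm_dl, if_pos hyQ]; omega
    · intro C hC hne hZ
      rw [tt_delI, dd_delI]
      have := hc C hC hne hZ
      have := hc' C hC hne hZ
      split_ifs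
      · omega
      · simp; omega
    · intro v hv hvZ
      have hne : v ≠ y := by rintro rfl; exact hyZ hvZ
      have hne' : y ∉ ({v} : Finset V) := by simpa using hne.symm
      rw [dd_delI]
      simpa [hne', delI, dl, hne] using he v hv hvZ
    · intro v hv hvS
      rw [mem_erase] at hvS
      rw [dd_delI]
      have hne : y ∉ ({v} : Finset V) := by simpa using hvS.1.symm
      simpa [hne, delI, dl, hvS.1] using hS v hv hvS.2
  push Not at hy
  obtain ⟨v, hv, hv1⟩ : ∃ y ∈ J.Q, 0 < J.i y := sm_pos (by omega)
  have hvZ := hy v hv hv1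
  obtain ⟨hZ, htv⟩ : Z = {v} ∧ 2 * k ∣ J.t v := by
    rcases hz with rfl | ⟨u, rfl, hu⟩
    · simp at hvZ
    · rw [mem_singleton] at hvZ; subst hvZ; exact ⟨rfl, hu⟩
  have hev := he v hv hvZ
  have hds := dd_single h hv
  have hov := h.o0 v hv
  by_cases hw : ∃ w ∈ J.Q, 1 ≤ J.μ v w
  · obtain ⟨w, hw, hw1⟩ := hw
    have hvw := ne_of_mu h hw1
    have O := op_delW h hv hw hw1 hv1
    refine O.good (fun v => add_nonneg (dl_nonneg _ _) (dl_nonneg _ _)) (S' := S.erase w) ?_ ?_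
    · intro u hu
      by_cases huy : u = w
      · right; have := dl_nonneg v u
        have : dl w u = 1 := by simp [dl, huy]
        omega
      · left; exact mem_erase.2 ⟨huy, hu⟩
    refine hM _ Z _ O.ok ?_ ⟨?_, hoQ, ?_, ?_, ?_, ?_⟩
    · have := O.size hv (by rw [dd_delW hv hw]; simp [hvw.symm]) (fun A _ => by rw [dd_delW hv hw]; split_ifs <;> omega)
      omega
    · refine Or.inr ⟨v, hZ, ?_⟩
      simpa [delW, dl, hvw] using htv
    · change sm (fun x => J.i x - dl v x) J.Q ≤ _
      rw [sm_sub, sm_dl, if_pos hv]; omega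
    · intro C hC hCne hCZ
      rw [tt_delW, dd_delW hv hw]
      have := hc C hC hCne hCZ
      have := hc' C hC hCne hCZ
      by_cases hwC : w ∈ C
      · simp [hwC]; omega
      · by_cases hvC : v ∈ C
        · have := hslack C hC (card_two hCne fun u hu => by
            rw [hu, mem_singleton] at hvC; exact hCZ (by rw [hu, hZ, hvC]))
          simp [hwC, hvC]; omega
        · simp [hwC, hvC]; omega
    · intro u hu huZ
      rw [hZ, mem_singleton] at huZ; subst huZ
      rw [dd_delW hv hw]
      have e1 : (J.delW u w).o u = J.o u := rfl
      have e2 : (J.delW u w).i u = J.i u - 1 := by simp [delW, dl]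
      rw [e1, e2]
      simp [hvw.symm]; omega
    · intro u hu huS
      rw [mem_erase] at huS
      rw [dd_delW hv hw]
      have h5 := hS u hu huS.2
      have hne1 : w ≠ u := huS.1.symm
      have hne2 : v ≠ u := by rintro rfl; exact h5.1 hvZ
      simpa [hne1, hne2, delW, dl, huS.1] using h5
  · push Not at hw
    rw [Finset.sum_eq_zero fun x hx => by have := hw x hx; have := h.nn v x; omega] at hds
    have L := lft_sp h hv 0 1 1 (by simp) hov hv1 (by omega)
    have hvS : v ∉ S := fun hh => (hS v hv hh).1 hvZ
    refine L.good (S' := S) (fun u hu _ => hu) (fun h => absurd h hvS) ?_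
    refine hM _ Z S L.ok (by have := L.size hv; omega) ⟨?_, ?_, ?_, ?_, ?_, ?_⟩
    · exact Or.inr ⟨v, hZ, htv⟩
    · have := L.oQ; exact this.trans hoQ
    · change sm (fun x => J.i x - 1 * dl v x) J.Q ≤ _
      simp only [one_mul]
      rw [sm_sub, sm_dl, if_pos hv]; omega
    · intro C hC hCne hCZ
      change _ + nd k (J.tt C) ≤ _
      by_cases hc1 : ∃ u, C = {u}
      · obtain ⟨u, rfl⟩ := hc1
        have huv : u ≠ v := fun h => hCZ (by rw [h, hZ])
        rw [L.dw u (singleton_subset_iff.1 hC) huv]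
        exact hc' _ hC hCne hCZ
      · push Not at hc1
        have := hslack C hC (card_two hCne hc1)
        have := L.dge C hC
        omega
    · intro u hu huZ
      rw [hZ, mem_singleton] at huZ; subst huZ
      rw [L.dv]
      simp [dl]; omega
    · intro u hu huS
      have h5 := hS u hu huS
      have hne2 : u ≠ v := by rintro rfl; exact h5.1 hvZ
      rw [L.dw u hu hne2]; exact h5

theorem W_free {k n : ℤ} (hk : 2 ≤ k) (hM : PM V k (n + 1)) (hW : PW V k n) {I : Inst V} {Z S : Finset V} (h : I.Ok)
    (hs : I.size < n + 1) (H : WH k I Z S) (hslack : ∀ C ⊆ I.Q, 2 ≤ C.card → 2 * k + nd k (I.tt C) ≤ I.dd C)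
    {A : Finset V} (hA : A ⊆ I.Q) (hne : A.Nonempty) (hAQ : A ≠ I.Q) (ht : I.dd A + nd k (I.tt A) ≤ 2 * sm I.o A) :
    I.Good k S := by
  have hss : A ⊂ I.Q := HasSubset.Subset.ssubset_of_ne hA hAQ
  have hneQ : ∀ C ⊆ A, C ≠ I.Q := by rintro C hC rfl; exact hAQ (Subset.antisymm hA hC)
  have hGA : (I.sub A).Good k S := by
    refine hW _ Z S (ok_sub h hA) (by have := size_sub h hss; omega) ⟨H.z, ?_, ?_, ?_, ?_, ?_, ?_⟩
    · intro u hu; exact H.iz u (hA hu)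
    · exact (sm_mono hA h.o0).trans H.oQ
    · intro C hC hCne hCZ
      rw [dd_sub hA hC]; exact H.c C (hC.trans hA) hCne hCZ
    · intro C hC hCne _
      rw [dd_sub hA hC]; exact H.b C (hC.trans hA) hCne (hneQ C hC)
    · intro _
      rw [sub_Q, dd_sub hA Subset.rfl]; exact H.b A hA hne hAQ
    · intro v hv hvS
      exact H.s v (hA hv) hvS
  have hteq : 2 * sm I.o A = I.dd A + nd k (I.tt A) := le_antisymm (H.b A hA hne hAQ) ht
  obtain ⟨r1, hr1, h1, h1S⟩ := hGA
  obtain ⟨o', i', P, e1, e2, e3, e4, e5, e6, e7⟩ := free h hA hr1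
  have hiA : sm I.i A = 0 := sm_zero_of fun v hv => H.iz v (hA hv)
  have hiQ : sm I.i I.Q = 0 := sm_zero_of fun v hv => H.iz v hv
  have hi' : sm I.i (I.Q \ A) = 0 := by rw [sm_sdiff _ hA, hiA, hiQ]; rfl
  have hν : sm (I.sub A).φ A = I.dd A - sm I.o A := by
    have := dd_full (I.sub A)
    rw [sub_Q, dd_sub hA Subset.rfl] at this
    have a1 : sm (I.sub A).o A = sm I.o A := rfl
    have a2 : sm (I.sub A).i A = sm I.i A := rfl
    omega
  -- the residue of P
  have hres : 2 * k ∣ 2 * P - I.dd A - I.tt A := by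
    have a1 : 2 * k ∣ ∑ v ∈ A, (2 * r1 v - I.dd {v} - I.t v) := Finset.dvd_sum fun v hv => by
      have := h1 v hv
      rwa [dd_sub hA (singleton_subset_iff.2 hv)] at this
    rw [Finset.sum_sub_distrib, Finset.sum_sub_distrib, ← Finset.mul_sum, sum_dd h hA] at a1
    have a2 : ∑ v ∈ A, r1 v = sm r1 A := rfl
    have a3 : ∑ v ∈ A, I.t v = I.tt A := rfl
    rw [a2, a3] at a1
    obtain ⟨q, hq⟩ := a1
    exact ⟨q, by linarith⟩
  set J : Inst V := ⟨I.Q \ A, I.μ, o', i', I.φ, I.t⟩ with hJ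
  have hsub : I.Q \ A ⊆ I.Q := sdiff_subset
  have hb : ∀ v ∈ J.Q, J.o v + J.i v + J.φ v = I.o v + I.i v + I.φ v + ∑ w ∈ I.Q \ J.Q, I.μ v w := by
    intro v hv
    have := (e1 v hv).2.2
    change o' v + i' v + I.φ v = _ + ∑ w ∈ I.Q \ (I.Q \ A), I.μ v w
    rw [sd_Q hA]; linarith
  have hdd : ∀ C ⊆ I.Q \ A, J.dd C = I.dd C := fun C hC => dd_restrict (I := I) (J := J) rfl hsub hb hC
  have hsz : J.size < I.size := size_restrict h rfl (by
    refine HasSubset.Subset.ssubset_of_ne hsub fun he => ?_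
    obtain ⟨x, hx⟩ := hne
    have h2 := hA hx
    rw [← he] at h2
    exact (mem_sdiff.1 h2).2 hx) hb
  have hJok : J.Ok := ok_restrict h rfl hsub (fun _ _ => rfl) hb (fun v hv => (h.o0 v (hsub hv)).trans (e1 v hv).1)
    (fun v hv => (h.i0 v (hsub hv)).trans (e1 v hv).2.1) (fun v hv => h.φ0 v (hsub hv))
  suffices hG : J.Good k S by
    obtain ⟨r2, hr2, h2, h2S⟩ := hG
    refine ⟨_, e7 I.t r2 hr2, ?_, ?_⟩
    · intro v hv
      by_cases hvA : v ∈ A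
      · simp only [hvA, if_true]
        have := h1 v hvA
        rwa [dd_sub hA (singleton_subset_iff.2 hvA)] at this
      · simp only [hvA, if_false]
        have hvd : v ∈ I.Q \ A := mem_sdiff.2 ⟨hv, hvA⟩
        have := h2 v hvd
        rwa [hdd _ (singleton_subset_iff.2 hvd)] at this
    · intro v hv hvS
      by_cases hvA : v ∈ A
      · simp only [hvA, if_true]; exact h1S v hvA hvS
      · simp only [hvA, if_false]; exact h2S v (mem_sdiff.2 ⟨hv, hvA⟩) hvS
  have hndn := nd_nonneg hk (I.tt A)
  have hndk := nd_le hk (I.tt A)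
  have hoA : sm I.o A ≤ 2 * k - 1 := (sm_mono hA h.o0).trans H.oQ
  have hod := sm_sdiff I.o hA
  have hoQ := H.oQ
  have hJc : ∀ C ⊆ J.Q, C.Nonempty → C ≠ Z → 2 * k - 1 + nd k (J.tt C - 1) ≤ J.dd C := by
    intro C hC hCne hCZ
    rw [hdd C hC]; exact H.c C (hC.trans hsub) hCne hCZ
  have hJsl : ∀ C ⊆ J.Q, 2 ≤ C.card → 2 * k + nd k (J.tt C) ≤ J.dd C := by
    intro C hC h2
    rw [hdd C hC]; exact hslack C (hC.trans hsub) h2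
  have hJs : ∀ v ∈ J.Q, v ∈ S → v ∉ Z ∧ 2 * k + nd k (J.t v) ≤ J.dd {v} := by
    intro v hv hvS
    rw [hdd {v} (singleton_subset_iff.2 hv)]; exact H.s' hk (hsub hv) hvS
  -- the degree inequality at unions
  have hun : ∀ C ⊆ I.Q \ A, C.Nonempty → (A ∪ C ≠ I.Q ∨ (¬ nd k (I.tt I.Q - 1) < nd k (I.tt I.Q) ∨ Z.Nonempty)) →
      2 * (sm I.o C + ee I.μ C A) ≤ I.dd C + nd k (I.tt C) ∧ (2 * k ∣ I.tt C → 2 * (sm I.o C + ee I.μ C A) ≤ I.dd C) := by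
    intro C hC hCne hor
    have hCQ := hC.trans hsub
    have hdis : Disjoint A C := disjoint_sdiff.mono_right hC
    have a1 : 2 * sm I.o (A ∪ C) ≤ I.dd (A ∪ C) + nd k (I.tt (A ∪ C)) := by
      by_cases he : A ∪ C = I.Q
      · rw [he]; exact H.bQ (hor.resolve_left fun hh => hh he)
      · exact H.b _ (union_subset hA hCQ) (hne.mono subset_union_left) he
    rw [sm_union _ hdis, dd_union h hA hCQ hdis, tt_union _ hdis] at a1
    have a2 := nd_triangle hk (I.tt A) (I.tt C)
    rw [ee_comm h.symm] at a1
    refine ⟨by omega, fun hd => ?_⟩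
    rw [nd_add hd] at a1; omega
  have hJe : ∀ v ∈ J.Q, v ∈ Z → 2 * (J.o v + J.i v) ≤ J.dd {v} := by
    intro v hv hvZ
    have hvs := singleton_subset_iff.2 hv
    have a1 := (hun {v} hvs (singleton_nonempty v) (Or.inr (Or.inr ⟨v, hvZ⟩))).2 (by
      rw [tt_singleton]
      rcases H.z with rfl | ⟨u, rfl, hu⟩
      · simp at hvZ
      · rw [mem_singleton] at hvZ; subst hvZ; exact hu)
    rw [hdd {v} hvs]
    rw [sm_singleton, ee_singleton_left] at a1
    have a2 := (e1 v hv).2.2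
    have a3 := H.iz v (hsub hv)
    change 2 * (o' v + i' v) ≤ _
    rw [a2, a3]; linarith
  by_cases hp : nd k (I.tt A - 1) < nd k (I.tt A)
  · have hd := pos_dvd hk hp
    have hnd1 : 1 ≤ nd k (I.tt A) := by have := nd_nonneg hk (I.tt A - 1); omega
    have hPk : P = sm I.o A - k := by
      have a1 : 2 * k ∣ 2 * (P - sm I.o A) := by
        obtain ⟨q, hq⟩ := dvd_add hres hd
        exact ⟨q, by linarith⟩
      obtain ⟨q, hq⟩ := a1
      have hq' : P - sm I.o A = k * q := by linarith
      have : q = -1 := by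
        have b1 : -(2 : ℤ) < q := by
          by_contra hc
          have : k * q ≤ k * (-2) := mul_le_mul_of_nonneg_left (by omega) (by omega)
          omega
        have b2 : q < 0 := by
          by_contra hc
          have : 0 ≤ k * q := mul_nonneg (by omega) (by omega)
          omega
        omega
      rw [this] at hq'; linarith
    refine M_plus hk hM hJok (by omega) H.z ?_ ?_ hJc hJe hJs hJsl
    · change sm o' (I.Q \ A) ≤ _; omega
    · change sm i' (I.Q \ A) ≤ _; omega
  · have hd := nonpos_dvd hk hp
    obtain ⟨r, hr⟩ : ∃ r, r = sm I.o A - nd k (I.tt A) - P := ⟨_, rfl⟩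
    have a1 : 2 * k ∣ 2 * r := by
      obtain ⟨q, hq⟩ := dvd_add hres hd
      exact ⟨-q, by rw [hr]; linarith⟩
    obtain ⟨q, hq⟩ := a1
    have hq' : r = k * q := by linarith
    have hq01 : q = 0 ∨ q = 1 := by
      have b1 : q < 2 := by
        by_contra hc
        have : k * 2 ≤ k * q := mul_le_mul_of_nonneg_left (by omega) (by omega)
        omega
      have b2 : -1 < q := by
        by_contra hc
        have : k * q ≤ k * (-1) := mul_le_mul_of_nonneg_left (by omega) (by omega)
        omega
      omega
    rcases hq01 with rfl | rfl
    · -- all free edges leave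
      have hi0 : ∀ v ∈ I.Q \ A, i' v = 0 := by
        intro v hv
        have b0 : ∀ u ∈ I.Q \ A, 0 ≤ i' u := fun u hu => hJok.i0 u hu
        have b1 := Finset.single_le_sum (f := i') b0 hv
        have b2 : ∑ u ∈ I.Q \ A, i' u = sm i' (I.Q \ A) := rfl
        have := b0 v hv
        omega
      have hoC : ∀ C ⊆ I.Q \ A, sm o' C = sm I.o C + ee I.μ C A := by
        intro C hC
        unfold sm ee
        rw [← Finset.sum_add_distrib]
        refine Finset.sum_congr rfl fun v hv => ?_
        have b1 := (e1 v (hC hv)).2.2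
        have b2 := hi0 v (hC hv)
        have b3 := H.iz v (hsub (hC hv))
        omega
      refine hW J Z S hJok (by omega) ⟨H.z, hi0, ?_, hJc, ?_, ?_, ?_⟩
      · change sm o' (I.Q \ A) ≤ _; omega
      · intro C hC hCne hCQ
        rw [hdd C hC]
        change 2 * sm o' C ≤ _ + nd k (I.tt C)
        rw [hoC C hC]
        refine (hun C hC hCne (Or.inl fun he => hCQ ?_)).1
        change C = I.Q \ A
        rw [← he, union_sdiff_cancel_left (disjoint_sdiff.mono_right hC)]
      · intro hor
        change 2 * sm o' (I.Q \ A) ≤ J.dd (I.Q \ A) + nd k (I.tt (I.Q \ A))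
        change (¬ nd k (I.tt (I.Q \ A) - 1) < nd k (I.tt (I.Q \ A)) ∨ _) at hor
        have hne' : (I.Q \ A).Nonempty := sdiff_nonempty.2 hss.2
        rw [hdd _ Subset.rfl, hoC _ Subset.rfl]
        by_cases hc : ¬ nd k (I.tt I.Q - 1) < nd k (I.tt I.Q) ∨ Z.Nonempty
        · exact (hun _ Subset.rfl hne' (Or.inr hc)).1
        · push Not at hc
          obtain ⟨hc1, hc2⟩ := hc
          have hn2 := hor.resolve_right (by rw [hc2]; simp)
          have d1 := nonpos_dvd hk hn2
          have d2 := pos_dvd hk hc1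
          have hcQ := H.c I.Q Subset.rfl (hne.mono hA) (by rw [hc2]; exact (hne.mono hA).ne_empty)
          have hdu := dd_union h hA hsub (disjoint_sdiff (s := A) (t := I.Q))
          rw [union_sdiff_of_subset hA] at hdu
          have htu := tt_sdiff I hA
          have hcm := ee_comm h.symm A (I.Q \ A)
          have n1 := nd_nonneg hk (I.tt (I.Q \ A))
          have n2 := nd_le hk (I.tt (I.Q \ A))
          have n3 := nd_nonneg hk (I.tt I.Q - 1)
          have n4 := nd_le hk (I.tt I.Q)
          have n5 := nd_pred hk (I.tt I.Q)
          have hsum : 2 * k ≤ nd k (I.tt A) + nd k (I.tt (I.Q \ A)) + nd k (I.tt I.Q) := by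
            have : 2 * k ∣ nd k (I.tt A) + nd k (I.tt (I.Q \ A)) + nd k (I.tt I.Q) := by
              obtain ⟨q, hq⟩ := dvd_sub (dvd_add hd d1) d2
              exact ⟨q, by linarith⟩
            exact Int.le_of_dvd (by omega) this
          omega
      · intro v hv hvS
        exact H.s v (hsub hv) hvS
    · refine M_plus hk hM hJok (by omega) H.z ?_ ?_ hJc hJe hJs hJsl
      · change sm o' (I.Q \ A) ≤ _; omega
      · change sm i' (I.Q \ A) ≤ _; omega

end Inst
end FR

open Finset
set_option linter.unusedSectionVars false
set_option linter.unnecessarySeqFocus false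
namespace FR
namespace Inst
variable {V : Type*} [DecidableEq V]

theorem W_zstep {k n : ℤ} (hk : 2 ≤ k) (hW : PW V k n) {I : Inst V} {Z S : Finset V} (h : I.Ok)
    (hs : I.size < n + 1) (H : WH k I Z S) (hQ : 2 ≤ I.Q.card)
    (hslack : ∀ C ⊆ I.Q, 2 ≤ C.card → 2 * k + 1 + nd k (I.tt C - 1) ≤ I.dd C)
    (hb : ∀ A ⊆ I.Q, A.Nonempty → A ≠ I.Q → 2 * sm I.o A + 2 ≤ I.dd A + nd k (I.tt A))
    (hbQ : 2 * sm I.o I.Q ≤ I.dd I.Q + nd k (I.tt I.Q))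
    {v : V} (hv : v ∈ I.Q) (htv : 2 * k ∣ I.t v) (hvS : v ∈ S → 2 ≤ I.dd {v}) (hZ : Z = ∅ ∨ Z = {v}) : I.Good k S := by
  have hkk := hk
  have hvQ : {v} ⊆ I.Q := singleton_subset_iff.2 hv
  rcases exists_lft h hv with ⟨I', L⟩ | ⟨ho, hi, hφ, w, hw, hn, hm, hpos⟩ | ⟨hm, hd⟩
  · refine L.good (S' := S.erase v) (fun u hu hne => mem_erase.2 ⟨hne, hu⟩)
      (fun _ _ r hr => Feas.nonneg L.ok hr (by rw [L.Q]; exact hv)) ?_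
    have htt : ∀ A, I'.tt A = I.tt A := fun A => by unfold tt; rw [L.t]
    refine hW I' {v} _ L.ok (by have := L.size hv; omega) ⟨Or.inr ⟨v, rfl, by rw [L.t]; exact htv⟩, ?_, ?_, ?_, ?_, ?_, ?_⟩
    · rw [L.Q]; exact L.iz H.iz
    · rw [L.Q]; exact L.oQ.trans H.oQ
    · rw [L.Q]; intro A hA hne hAv
      rw [htt]
      by_cases hc : ∃ u, A = {u}
      · obtain ⟨u, rfl⟩ := hc
        have huv : u ≠ v := fun h => hAv (by rw [h])
        rw [L.dw u (singleton_subset_iff.1 hA) huv]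
        refine H.c _ hA hne ?_
        rcases hZ with rfl | rfl
        · exact hne.ne_empty
        · exact hAv
      · push Not at hc
        have := hslack A hA (card_two hne hc)
        have := L.dge A hA
        omega
    · rw [L.Q]; intro A hA hne hAQ
      rw [htt]
      have := L.ob A hA
      have := hb A hA hne hAQ
      omega
    · rw [L.Q, htt]; intro _
      have := L.oQ2 (H.iz v hv)
      omega
    · rw [L.Q]; intro u hu huS
      rw [mem_erase] at huS
      rw [L.t]
      exact ⟨by simpa using huS.1, (H.s u hu huS.2).2⟩
  · have hpar := h.par v hv
    have h2 : 2 ∣ I.dd {v} := by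
      have : (2:ℤ) ∣ I.t v := dvd_trans (dvd_mul_right 2 k) htv
      omega
    obtain ⟨c, hc⟩ := h2
    refine pend h hv hw hn ho hi hφ hm c (by omega) (by omega) ?_ (S1 := S \ {v, w}) ?_ (fun h => by omega) (fun _ => by omega) ?_
    · rw [hc]; simpa using htv
    · intro u hu h1 h2; simp [hu, h1, h2]
    · exact hW _ _ _ (ok_con h (pair_sub hv hw) (by simp)) (by have := size_con h (pair_sub hv hw) (a := w) (by simp) (pair_card hn); omega)
        (H.con (pair_sub hv hw) (by simp) (pair_card hn) fun u hu => Or.inl (mem_sdiff.1 hu))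
  · obtain ⟨hss, hco⟩ := ok_rem h hv
    have hne : (I.Q \ {v}).Nonempty := by
      rw [← card_pos, card_sdiff_of_subset hvQ, card_singleton]; omega
    have hbv := hb {v} hvQ (singleton_nonempty v) (by intro he; rw [← he, card_singleton] at hQ; omega)
    rw [tt_singleton, (nd_eq_zero hk).2 htv, sm_singleton] at hbv
    have hds := dd_single h hv
    rw [Finset.sum_eq_zero hm] at hds
    have := h.o0 v hv
    have hiv := H.iz v hv
    have := h.φ0 v hv
    have hpar := h.par v hv
    have h2 : 2 ∣ I.dd {v} := by
      have : (2:ℤ) ∣ I.t v := dvd_trans (dvd_mul_right 2 k) htv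
      omega
    obtain ⟨c, hc⟩ := h2
    refine rem_iso h hv hm c (by omega) (by omega) ?_ (fun h => by omega) ?_
    · rw [hiv, hc]; simpa using htv
    have hneQ : ∀ A ⊆ I.Q \ {v}, A ≠ I.Q := by rintro A hA rfl; exact hss.2 hA
    refine hW _ ∅ S (ok_sub h hss.1) (by have := size_sub h hss; omega) ⟨Or.inl rfl, ?_, ?_, ?_, ?_, ?_, ?_⟩
    · intro u hu; exact H.iz u (hss.1 hu)
    · exact (sm_mono hss.1 h.o0).trans H.oQ
    · intro A hA hAne _
      rw [dd_sub hss.1 hA]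
      refine H.c A (hA.trans hss.1) hAne ?_
      rcases hZ with rfl | rfl
      · exact hAne.ne_empty
      · rintro rfl; have := hA (mem_singleton_self v); simp [sub] at this
    · intro A hA hAne _
      rw [dd_sub hss.1 hA]
      exact H.b A (hA.trans hss.1) hAne (hneQ A hA)
    · intro _
      rw [sub_Q, dd_sub hss.1 Subset.rfl]
      exact H.b _ hss.1 hne (hneQ _ Subset.rfl)
    · intro u hu huS
      exact ⟨by simp, (H.s u (hss.1 hu) huS).2⟩

theorem W_pos {k n : ℤ} (hk : 2 ≤ k) (hW : PW V k n) {I : Inst V} {S : Finset V} (h : I.Ok)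
    (hs : I.size < n + 1) (H : WH k I ∅ S) (hQ : 2 ≤ I.Q.card)
    (hslack : ∀ C ⊆ I.Q, 2 ≤ C.card → 2 * k + 1 + nd k (I.tt C - 1) ≤ I.dd C)
    (hb : ∀ A ⊆ I.Q, A.Nonempty → A ≠ I.Q → 2 * sm I.o A + 2 ≤ I.dd A + nd k (I.tt A))
    (hp : nd k (I.tt I.Q - 1) < nd k (I.tt I.Q))
    (hX : ∀ I' : Inst V, I'.Ok → I'.size < n + 1 → sm I'.φ I'.Q < sm I.φ I.Q → WH k I' ∅ S → I'.Good k S) : I.Good k S := by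
  have hslQ := hslack I.Q Subset.rfl hQ
  have hfull := dd_full I
  have hiQ : sm I.i I.Q = 0 := sm_zero_of H.iz
  have hoQ := H.oQ
  have hpr := nd_pred hk (I.tt I.Q)
  have hn0 := nd_nonneg hk (I.tt I.Q - 1)
  have hnk := nd_le hk (I.tt I.Q)
  have hparQ := dd_par h (Subset.refl I.Q)
  have hndp := nd_par hk (I.tt I.Q)
  have ho0 := sm_nonneg h.o0
  obtain ⟨y, hy, hφy⟩ : ∃ y ∈ I.Q, 0 < I.φ y := sm_pos (by omega)
  by_cases hy2 : ∃ y' ∈ I.Q, y' ≠ y ∧ 0 < I.φ y'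
  · obtain ⟨y', hy', hne, hφy'⟩ := hy2
    have O := op_lftX h hy hy' hne.symm hφy hφy'
    refine O.good (fun _ => le_rfl) (S' := S) (fun u hu => Or.inl hu) ?_
    have hsingle : ∀ v, (I.lftX y y').dd {v} = I.dd {v} := by
      intro v; rw [dd_lftX hy hy', if_neg]; · ring
      rintro ⟨h1, h2⟩; rw [mem_singleton] at h1 h2; exact hne (h2.trans h1.symm)
    refine hX _ O.ok ?_ ?_ ⟨H.z, H.iz, H.oQ, ?_, ?_, ?_, ?_⟩
    · have : (I.lftX y y').size = I.size := Finset.sum_congr rfl fun v _ => by rw [hsingle]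
      omega
    · have e1 := dd_full (I.lftX y y')
      have e2 : (I.lftX y y').dd (I.lftX y y').Q = I.dd I.Q - 2 := by
        change (I.lftX y y').dd I.Q = _
        rw [dd_lftX hy hy', if_pos ⟨hy, hy'⟩]
      change _ = sm I.o I.Q + sm I.i I.Q + sm (I.lftX y y').φ (I.lftX y y').Q at e1
      omega
    · intro A hA hAne hAZ
      rw [tt_lftX]
      by_cases hc : ∃ u, A = {u}
      · obtain ⟨u, rfl⟩ := hc
        rw [hsingle]; exact H.c _ hA hAne hAZ
      · push Not at hc
        have := hslack A hA (card_two hAne hc)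
        rw [dd_lftX hy hy']
        split_ifs <;> omega
    · intro A hA hAne hAQ
      rw [tt_lftX, dd_lftX hy hy']
      have := hb A hA hAne hAQ
      change 2 * sm I.o A ≤ _
      split_ifs <;> omega
    · rintro (hc | hc)
      · exact absurd hp hc
      · simp at hc
    · exact H.s
  · push Not at hy2
    have hφz : ∀ u ∈ I.Q, u ≠ y → I.φ u = 0 := fun u hu hne => le_antisymm (hy2 u hu hne) (h.φ0 u hu)
    have hφs : sm I.φ I.Q = I.φ y := by
      unfold sm
      exact Finset.sum_eq_single y (fun u hu hne => hφz u hu hne) (fun hn => absurd hy hn)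
    obtain ⟨hss, hco⟩ := ok_rem h hy
    have hneQ : ∀ A ⊆ I.Q \ {y}, A ≠ I.Q := by rintro A hA rfl; exact hss.2 hA
    have hne : (I.Q \ {y}).Nonempty := by
      rw [← card_pos, card_sdiff_of_subset (singleton_subset_iff.2 hy), card_singleton]; omega
    have hG : (I.sub (I.Q \ {y})).Good k S := by
      refine hW _ ∅ S (ok_sub h hss.1) (by have := size_sub h hss; omega) ⟨Or.inl rfl, ?_, ?_, ?_, ?_, ?_, ?_⟩
      · intro u hu; exact H.iz u (hss.1 hu)
      · exact (sm_mono hss.1 h.o0).trans H.oQ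
      · intro A hA hAne _
        rw [dd_sub hss.1 hA]
        exact H.c A (hA.trans hss.1) hAne hAne.ne_empty
      · intro A hA hAne _
        rw [dd_sub hss.1 hA]
        exact H.b A (hA.trans hss.1) hAne (hneQ A hA)
      · intro _
        rw [sub_Q, dd_sub hss.1 Subset.rfl]
        exact H.b _ hss.1 hne (hneQ _ Subset.rfl)
      · intro u hu huS
        exact H.s u (hss.1 hu) huS
    obtain ⟨p, hpe⟩ : ∃ p, 2 * p = I.dd I.Q - 2 * k + nd k (I.tt I.Q) := by
      have : 2 ∣ I.dd I.Q - 2 * k + nd k (I.tt I.Q) := by omega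
      obtain ⟨p, hp⟩ := this
      exact ⟨p, hp.symm⟩
    refine last_vertex h hy hφz hG p (by omega) (by omega) ?_ (fun _ => by omega)
    obtain ⟨q, hq⟩ := pos_dvd hk hp
    refine ⟨-q - 1, ?_⟩
    have : 2 * k * (-q - 1) = - (2 * k * q) - 2 * k := by ring
    omega

theorem W_single {k : ℤ} (hk : 2 ≤ k) {I : Inst V} {Z S : Finset V} (h : I.Ok) (H : WH k I Z S) {v : V} (hv : I.Q = {v}) :
    I.Good k S := by
  have hvQ : v ∈ I.Q := by rw [hv]; simp
  have hfull := dd_full I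
  have hoQ := H.oQ
  have hbQ := H.bQ
  have hcQ := H.c I.Q Subset.rfl ⟨v, hvQ⟩
  have hsv := H.s v hvQ
  have hiv := H.iz v hvQ
  have hov := h.o0 v hvQ
  have hpar := h.par v hvQ
  have hndp := nd_par hk (I.t v)
  have hpr := nd_pred hk (I.t v)
  have hn0 := nd_nonneg hk (I.t v - 1)
  have hnn := nd_nonneg hk (I.t v)
  simp only [hv, sm_singleton, tt_singleton] at hfull hoQ hbQ hcQ
  by_cases hZ : Z = {v}
  · have htv : 2 * k ∣ I.t v := by
      rcases H.z with rfl | ⟨u, hu, hd⟩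
      · exact absurd hZ.symm (singleton_ne_empty v)
      · rw [hZ, singleton_inj] at hu; subst hu; exact hd
    have hb := hbQ (Or.inr (by rw [hZ]; simp))
    rw [(nd_eq_zero hk).2 htv] at hb hndp
    obtain ⟨p, hp⟩ : 2 ∣ I.dd {v} := by omega
    refine good_one h hv p (by omega) (by omega) ?_ (fun hvS => absurd (by rw [hZ]; simp) (hsv hvS).1)
    rw [hiv, hp]; simpa using htv
  have hc := hcQ (fun h => hZ h.symm)
  by_cases hps : nd k (I.t v - 1) < nd k (I.t v)
  · obtain ⟨p, hp⟩ : 2 ∣ I.dd {v} - 2 * k + nd k (I.t v) := by omega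
    refine good_one h hv p (by omega) (by omega) ?_ (fun hvS => absurd hps (hsv hvS).2)
    obtain ⟨q, hq⟩ := pos_dvd hk hps
    refine ⟨-q - 1, ?_⟩
    have : 2 * k * (-q - 1) = - (2 * k * q) - 2 * k := by ring
    omega
  · have hb := hbQ (Or.inl hps)
    obtain ⟨p, hp⟩ : 2 ∣ I.dd {v} - nd k (I.t v) := by omega
    refine good_one h hv p (by omega) (by omega) ?_ (fun hvS => by omega)
    obtain ⟨q, hq⟩ := nonpos_dvd hk hps
    refine ⟨-q, ?_⟩
    have : 2 * k * (-q) = - (2 * k * q) := by ring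
    omega

end Inst
end FR

open Finset
set_option linter.unusedSectionVars false
set_option linter.unnecessarySeqFocus false
namespace FR
namespace Inst
variable {V : Type*} [DecidableEq V]

/-- two consecutive descents -/
theorem pos_pred {k : ℤ} (hk : 2 ≤ k) {n : ℤ} (h : nd k (n - 1) < nd k n) (h1 : nd k n ≠ 1) :
    nd k (n - 1 - 1) = nd k n - 2 := by
  obtain ⟨q, hq⟩ := pos_dvd hk h
  have h0 := nd_nonneg hk n
  have h0' := nd_nonneg hk (n - 1)
  have hle := nd_le hk n
  have : nd k (n - 1 - 1) = nd k (nd k n - 2) := nd_congr ⟨q, by linarith⟩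
  rw [this, nd_small hk (by omega) (by omega)]

theorem W_del {k n : ℤ} (hk : 2 ≤ k) (hM : PM V k (n + 1)) (hW : PW V k n) {I : Inst V} {S : Finset V} (h : I.Ok)
    (hs : I.size < n + 1) (H : WH k I ∅ S)
    (hslack : ∀ C ⊆ I.Q, 2 ≤ C.card → 2 * k + 1 + nd k (I.tt C - 1) ≤ I.dd C)
    (hb : ∀ A ⊆ I.Q, A.Nonempty → A ≠ I.Q → 2 * sm I.o A + 2 ≤ I.dd A + nd k (I.tt A))
    (hbQ : 2 * sm I.o I.Q ≤ I.dd I.Q + nd k (I.tt I.Q))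
    (hnQ : ¬ nd k (I.tt I.Q - 1) < nd k (I.tt I.Q))
    (hz : ∀ v ∈ I.Q, nd k (I.t v) ≠ 0) : I.Good k S := by
  have hkk := hk
  have hzok : ∀ u, nd k (I.t u - 1) < nd k (I.t u) → ∀ I' : Inst V, I'.t u = I.t u - 1 →
      ZOk k I' (if nd k (I.t u) = 1 then {u} else ∅) := by
    intro u hp I' hI'
    split_ifs with h1
    · right
      refine ⟨u, rfl, ?_⟩
      have := pos_dvd hk hp
      rw [h1] at this; rw [hI']; exact this
    · left; rfl
  have hnotZ : ∀ u, nd k (I.t u - 1) < nd k (I.t u) → ∀ v ∈ I.Q, v ∈ S → v ≠ u ∧ v ∉ (if nd k (I.t u) = 1 then ({u} : Finset V) else ∅) := by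
    intro u hp v hv hvS
    have h1 := (H.s v hv hvS).2
    have h2 : v ≠ u := by rintro rfl; exact h1 hp
    refine ⟨h2, ?_⟩
    split_ifs
    · simpa using h2
    · simp
  -- deletion of an arc
  by_cases c1 : ∃ u ∈ I.Q, ∃ w ∈ I.Q, 1 ≤ I.μ u w ∧ nd k (I.t u - 1) < nd k (I.t u) ∧ ¬ nd k (I.t w - 1) < nd k (I.t w)
  · obtain ⟨u, hu, w, hw, hm, hPu, hNw⟩ := c1
    have huw := ne_of_mu h hm
    have O := op_delA h hu hw hm
    have htu : (I.delA u w).t u = I.t u - 1 := by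
      have := tt_delA I u w {u}
      simp only [tt_singleton] at this; simpa [huw.symm] using this
    have htw : (I.delA u w).t w = I.t w + 1 := by
      have := tt_delA I u w {w}
      simp only [tt_singleton] at this; simpa [huw] using this
    have htx : ∀ x, x ≠ u → x ≠ w → (I.delA u w).t x = I.t x := by
      intro x h1 h2
      have := tt_delA I u w {x}
      simp only [tt_singleton] at this; simpa [h1.symm, h2.symm] using this
    refine O.good (fun v => dl_nonneg _ _) (S' := S) (fun v hvS => Or.inl hvS) ?_
    refine hW _ (if nd k (I.t u) = 1 then {u} else ∅) S O.ok ?_ ⟨hzok u hPu _ htu, H.iz, H.oQ, ?_, ?_, ?_, ?_⟩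
    · have := O.size hu (by rw [dd_delA hu hw]; simp [huw.symm]) (fun A _ => by rw [dd_delA hu hw]; split_ifs <;> omega)
      omega
    · intro A hA hne hAZ
      rw [tt_delA, dd_delA hu hw]
      by_cases hc : ∃ x, A = {x}
      · obtain ⟨x, rfl⟩ := hc
        have h1 := H.c _ hA hne hne.ne_empty
        rw [tt_singleton] at h1 ⊢
        by_cases hux : u = x
        · subst hux
          have h2 : nd k (I.t u) ≠ 1 := by
            intro h2; rw [if_pos h2] at hAZ; exact hAZ rfl
          have := pos_pred hk hPu h2
          have := nd_pred hk (I.t u)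
          simp [huw.symm]; omega
        · by_cases hwx : w = x
          · subst hwx
            have := nd_pred hk (I.t w)
            simp [huw]; omega
          · simpa [hux, hwx] using h1
      · push Not at hc
        have := hslack A hA (card_two hne hc)
        have := nd_pred hk (I.tt A - 1)
        have := nd_succ hk (I.tt A - 1)
        have e1 : I.tt A - 1 + 1 = I.tt A := by ring
        by_cases hux : u ∈ A <;> by_cases hwx : w ∈ A <;> simp [hux, hwx] <;> simp only [e1] at * <;> omega
    · intro A hA hne hAQ
      have := hb A hA hne hAQ
      rw [tt_delA, dd_delA hu hw]
      change 2 * sm I.o A ≤ _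
      have := nd_pred hk (I.tt A)
      have := nd_succ hk (I.tt A)
      by_cases hux : u ∈ A <;> by_cases hwx : w ∈ A <;> simp [hux, hwx] <;> omega
    · intro _
      change 2 * sm I.o I.Q ≤ (I.delA u w).dd I.Q + nd k ((I.delA u w).tt I.Q)
      rw [tt_delA, dd_delA hu hw]; simpa [hu, hw] using hbQ
    · intro v hv hvS
      obtain ⟨h1, h2⟩ := hnotZ u hPu v hv hvS
      refine ⟨h2, ?_⟩
      by_cases hvw : v = w
      · subst hvw
        rw [htw]; exact (nonpos_succ hk hNw (hz v hv)).2
      · rw [htx v h1 hvw]; exact (H.s v hv hvS).2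
  by_cases c2 : ∃ u ∈ I.Q, 1 ≤ I.φ u ∧ nd k (I.t u - 1) < nd k (I.t u)
  · obtain ⟨u, hu, hm, hPu⟩ := c2
    have O := op_delX h hm
    have htu : (I.delX u).t u = I.t u - 1 := by
      have := tt_delX I u {u}
      simp only [tt_singleton] at this; simpa using this
    have htx : ∀ x, x ≠ u → (I.delX u).t x = I.t x := by
      intro x h1
      have := tt_delX I u {x}
      simp only [tt_singleton] at this; simpa [h1.symm] using this
    refine O.good (fun v => dl_nonneg _ _) (S' := S) (fun v hvS => Or.inl hvS) ?_
    refine hW _ (if nd k (I.t u) = 1 then {u} else ∅) S O.ok ?_ ⟨hzok u hPu _ htu, H.iz, H.oQ, ?_, ?_, ?_, ?_⟩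
    · have := O.size hu (by rw [dd_delX]; simp) (fun A _ => by rw [dd_delX]; split_ifs <;> omega)
      omega
    · intro A hA hne hAZ
      rw [tt_delX, dd_delX]
      by_cases hc : ∃ x, A = {x}
      · obtain ⟨x, rfl⟩ := hc
        have h1 := H.c _ hA hne hne.ne_empty
        rw [tt_singleton] at h1 ⊢
        by_cases hux : u = x
        · subst hux
          have h2 : nd k (I.t u) ≠ 1 := by
            intro h2; rw [if_pos h2] at hAZ; exact hAZ rfl
          have := pos_pred hk hPu h2
          have := nd_pred hk (I.t u)
          simp; omega
        · simpa [hux] using h1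
      · push Not at hc
        have := hslack A hA (card_two hne hc)
        have := nd_pred hk (I.tt A - 1)
        by_cases hux : u ∈ A <;> simp [hux] <;> omega
    · intro A hA hne hAQ
      have := hb A hA hne hAQ
      rw [tt_delX, dd_delX]
      change 2 * sm I.o A ≤ _
      have := nd_pred hk (I.tt A)
      by_cases hux : u ∈ A <;> simp [hux] <;> omega
    · intro _
      change 2 * sm I.o I.Q ≤ (I.delX u).dd I.Q + nd k ((I.delX u).tt I.Q)
      rw [tt_delX, dd_delX]
      have := nd_pred hk (I.tt I.Q)
      simp [hu]; omega
    · intro v hv hvS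
      obtain ⟨h1, h2⟩ := hnotZ u hPu v hv hvS
      refine ⟨h2, ?_⟩
      rw [htx v h1]; exact (H.s v hv hvS).2
  by_cases c3 : ∃ u ∈ I.Q, 1 ≤ I.o u ∧ ¬ nd k (I.t u - 1) < nd k (I.t u)
  · obtain ⟨u, hu, hm, hPu⟩ := c3
    have O := op_delO h hm
    have htu : (I.delO u).t u = I.t u + 1 := by
      have := tt_delO I u {u}
      simp only [tt_singleton] at this; simpa using this
    have htx : ∀ x, x ≠ u → (I.delO u).t x = I.t x := by
      intro x h1
      have := tt_delO I u {x}
      simp only [tt_singleton] at this; simpa [h1.symm] using this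
    have hso : ∀ A, sm (I.delO u).o A ≤ sm I.o A := by
      intro A
      change sm (fun x => I.o x - dl u x) A ≤ _
      rw [sm_sub, sm_dl]; split_ifs <;> omega
    refine O.good (fun v => le_rfl) (S' := S) (fun v hvS => Or.inl hvS) ?_
    refine hW _ ∅ S O.ok ?_ ⟨Or.inl rfl, H.iz, (hso _).trans H.oQ, ?_, ?_, ?_, ?_⟩
    · have := O.size hu (by rw [dd_delO]; simp) (fun A _ => by rw [dd_delO]; split_ifs <;> omega)
      omega
    · intro A hA hne hAZ
      rw [tt_delO, dd_delO]
      by_cases hc : ∃ x, A = {x}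
      · obtain ⟨x, rfl⟩ := hc
        have h1 := H.c _ hA hne hne.ne_empty
        rw [tt_singleton] at h1 ⊢
        by_cases hux : u = x
        · subst hux
          have := nd_pred hk (I.t u)
          simp; omega
        · simpa [hux] using h1
      · push Not at hc
        have := hslack A hA (card_two hne hc)
        have := nd_succ hk (I.tt A - 1)
        have e1 : I.tt A - 1 + 1 = I.tt A := by ring
        by_cases hux : u ∈ A <;> simp [hux] <;> simp only [e1] at * <;> omega
    · intro A hA hne hAQ
      have := hb A hA hne hAQ
      rw [tt_delO, dd_delO]
      have := hso A
      have := nd_succ hk (I.tt A)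
      by_cases hux : u ∈ A <;> simp [hux] <;> omega
    · intro _
      change 2 * sm (fun x => I.o x - dl u x) I.Q ≤ (I.delO u).dd I.Q + nd k ((I.delO u).tt I.Q)
      rw [tt_delO, dd_delO, sm_sub, sm_dl]
      have := nd_succ hk (I.tt I.Q)
      simp [hu]; omega
    · intro v hv hvS
      refine ⟨by simp, ?_⟩
      by_cases hvw : v = u
      · subst hvw
        rw [htu]; exact (nonpos_succ hk hPu (hz v hv)).2
      · rw [htx v hvw]; exact (H.s v hv hvS).2
  push Not at c1 c2 c3
  set P := I.Q.filter fun v => nd k (I.t v - 1) < nd k (I.t v) with hPdef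
  have hPs : P ⊆ I.Q := filter_subset _ _
  by_cases hP : P.Nonempty
  · exfalso
    have e1 := H.c P hPs hP hP.ne_empty
    have e4 : ee I.μ P (I.Q \ P) = 0 := by
      refine Finset.sum_eq_zero fun u hu => Finset.sum_eq_zero fun w hw => ?_
      by_contra hne
      have hu1 := mem_filter.1 hu
      have hw1 := mem_sdiff.1 hw
      have := h.nn u w
      exact hw1.2 (mem_filter.2 ⟨hw1.1, c1 u hu1.1 w hw1.1 (by omega) hu1.2⟩)
    have e5 : sm I.i P = 0 := sm_zero_of fun v hv => H.iz v (hPs hv)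
    have e6 : sm I.φ P = 0 := by
      refine sm_zero_of fun v hv => ?_
      by_contra hne
      have hv1 := mem_filter.1 hv
      have := h.φ0 v hv1.1
      have := c2 v hv1.1 (by omega)
      omega
    have e7 : I.dd P = sm I.o P := by unfold dd; omega
    have e8 : 2 * sm I.o P ≤ I.dd P + nd k (I.tt P) := by
      by_cases hPQ : P = I.Q
      · rw [hPQ]; exact hbQ
      · have := hb P hPs hP hPQ; omega
    have := nd_le hk (I.tt P)
    have := nd_nonneg hk (I.tt P - 1)
    omega
  · have hall : ∀ v ∈ I.Q, ¬ nd k (I.t v - 1) < nd k (I.t v) := fun v hv hp => hP ⟨v, mem_filter.2 ⟨hv, hp⟩⟩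
    have ho : ∀ v ∈ I.Q, I.o v = 0 := by
      intro v hv
      by_contra hne
      have := h.o0 v hv
      exact hall v hv (c3 v hv (by omega))
    refine hM I ∅ S h hs ⟨Or.inl rfl, ?_, ?_, ?_, by simp, ?_⟩
    · rw [sm_zero_of ho]; omega
    · rw [sm_zero_of H.iz]; omega
    · intro A hA hne hZ; exact H.c' hk hA hne hZ
    · intro v hv hvS; exact H.s' hk hv hvS

theorem W_aux {k n : ℤ} (hk : 2 ≤ k) (hT : PT V k (n + 1)) (hM : PM V k (n + 1)) (hW : PW V k n) {I : Inst V} {S : Finset V} (h : I.Ok)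
    (hs : I.size < n + 1) 
    (hX : ∀ I' : Inst V, I'.Ok → I'.size < n + 1 → sm I'.φ I'.Q < sm I.φ I.Q → WH k I' ∅ S → I'.Good k S)
    (Z : Finset V) (hZ : Z = ∅ ∨ ∃ v ∈ I.Q, Z = {v}) (H : WH k I Z S) : I.Good k S := by
  have hkk := hk
  by_cases hc0 : I.Q = ∅
  · exact good_empty hc0
  by_cases hc1 : ∃ v, I.Q = {v}
  · obtain ⟨v, hv⟩ := hc1
    exact W_single hk h H hv
  push Not at hc1
  have hQne := nonempty_iff_ne_empty.2 hc0
  have hQ := card_two hQne hc1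
  have hZc : ∀ C : Finset V, 2 ≤ C.card → C ≠ Z := by
    rintro C h2 rfl
    rcases hZ with rfl | ⟨v, -, rfl⟩ <;> simp at h2
  by_cases t1 : ∃ A ⊆ I.Q, 2 ≤ A.card ∧ I.dd A ≤ 2 * k - 1 + nd k (I.tt A - 1) ∧ nd k (I.tt A - 1) < nd k (I.tt A)
  · obtain ⟨A, hA, h2, ht, hp⟩ := t1
    exact W_tight_pos hk hT hW h hs H hA h2 ht hp
  push Not at t1
  have hslack0 : ∀ C ⊆ I.Q, 2 ≤ C.card → 2 * k + nd k (I.tt C) ≤ I.dd C := by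
    intro C hC h2
    have e1 := H.c C hC (by rw [← card_pos]; omega) (hZc C h2)
    have e2 := nd_pred hk (I.tt C)
    have e3 := dd_par h hC
    have e4 := nd_par hk (I.tt C)
    by_cases e5 : I.dd C ≤ 2 * k - 1 + nd k (I.tt C - 1)
    · have := t1 C hC h2 e5; omega
    · omega
  by_cases t2 : ∃ A ⊆ I.Q, 2 ≤ A.card ∧ I.dd A ≤ 2 * k - 1 + nd k (I.tt A - 1)
  · obtain ⟨A, hA, h2, ht⟩ := t2
    exact W_tight_nonpos hk hT hW h hs H hA h2 ht (not_lt.2 (t1 A hA h2 ht)) hslack0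
  push Not at t2
  have hslack : ∀ C ⊆ I.Q, 2 ≤ C.card → 2 * k + 1 + nd k (I.tt C - 1) ≤ I.dd C := by
    intro C hC h2
    have e1 := t2 C hC h2
    have e3 := dd_par h hC
    have e4 := nd_par hk (I.tt C - 1)
    omega
  by_cases t3 : ∃ A ⊆ I.Q, A.Nonempty ∧ A ≠ I.Q ∧ I.dd A + nd k (I.tt A) ≤ 2 * sm I.o A
  · obtain ⟨A, hA, hne, hAQ, ht⟩ := t3
    exact W_free hk hM hW h hs H hslack0 hA hne hAQ ht
  push Not at t3
  have hb : ∀ A ⊆ I.Q, A.Nonempty → A ≠ I.Q → 2 * sm I.o A + 2 ≤ I.dd A + nd k (I.tt A) := by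
    intro A hA hne hAQ
    have e1 := t3 A hA hne hAQ
    have e3 := dd_par h hA
    have e4 := nd_par hk (I.tt A)
    omega
  rcases hZ with rfl | ⟨v, hv, rfl⟩
  · by_cases hp : nd k (I.tt I.Q - 1) < nd k (I.tt I.Q)
    · exact W_pos hk hW h hs H hQ hslack hb hp hX
    have hbQ := H.bQ (Or.inl hp)
    by_cases hz : ∃ v ∈ I.Q, nd k (I.t v) = 0
    · obtain ⟨v, hv, hz⟩ := hz
      refine W_zstep hk hW h hs H hQ hslack hb hbQ hv ((nd_eq_zero hk).1 hz) (fun hvS => ?_) (Or.inl rfl)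
      have := (H.s' hk hv hvS).2
      omega
    · push Not at hz
      exact W_del hk hM hW h hs H hslack hb hbQ hp hz
  · have hbQ := H.bQ (Or.inr (singleton_nonempty v))
    refine W_zstep hk hW h hs H hQ hslack hb hbQ hv ?_ (fun hvS => absurd (mem_singleton_self v) (H.s v hv hvS).1) (Or.inr rfl)
    rcases H.z with hz | ⟨u, hu, hz⟩
    · simp at hz
    · rw [singleton_inj] at hu; subst hu; exact hz

theorem W_step {k n : ℤ} (hk : 2 ≤ k) (hT : PT V k (n + 1)) (hM : PM V k (n + 1)) (hW : PW V k n) : PW V k (n + 1) := by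
  have key : ∀ m : ℕ, ∀ (I : Inst V) (S : Finset V), I.Ok → I.size < n + 1 → sm I.φ I.Q < m → 
      ∀ Z, (Z = ∅ ∨ ∃ v ∈ I.Q, Z = {v}) → WH k I Z S → I.Good k S := by
    intro m
    induction m with
    | zero =>
      intro I S h _ hm
      have := sm_nonneg h.φ0
      push_cast at hm; omega
    | succ m ih =>
      intro I S h hs hm Z hZ H
      refine W_aux hk hT hM hW h hs (fun I' h' hs' hm' H' => ih I' S h' hs' (by push_cast at hm; omega) ∅ (Or.inl rfl) H') Z hZ H
  intro I Z S h hs H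
  have key2 := key ((sm I.φ I.Q).toNat + 1) I S h hs (by have := sm_nonneg h.φ0; push_cast; omega)
  rcases H.z with hz | ⟨v, hv, hz⟩
  · exact key2 Z (Or.inl hz) H
  · by_cases hvQ : v ∈ I.Q
    · exact key2 Z (Or.inr ⟨v, hvQ, hv⟩) H
    · refine key2 ∅ (Or.inl rfl) ⟨Or.inl rfl, H.iz, H.oQ, ?_, H.b, ?_, fun u hu hS => ⟨by simp, (H.s u hu hS).2⟩⟩
      · intro A hA hne _
        refine H.c A hA hne ?_
        rintro rfl; subst hv
        exact hvQ (hA (by simp))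
      · rintro (h1 | h1)
        · exact H.bQ (Or.inl h1)
        · simp at h1

theorem P_all {k : ℤ} (hk : 2 ≤ k) (n : ℕ) : PT V k n ∧ PM V k n ∧ PW V k n := by
  induction n with
  | zero =>
    refine ⟨?_, ?_, ?_⟩ <;>
    · intro I Z S h hs
      have := size_nonneg h
      push_cast at hs; omega
  | succ n ih =>
    obtain ⟨hT, hM, hW⟩ := ih
    push_cast
    have hT' := T0_step hk hT hW
    have hM' := M_step hk hT' hM
    exact ⟨hT', hM', W_step hk hT' hM' hW⟩

/-- The base theorem. -/
theorem T0_thm {k : ℤ} (hk : 2 ≤ k) {I : Inst V} (h : I.Ok) (H : T0H k I ∅ ∅) : I.Good k ∅ := by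
  have := size_nonneg h
  exact (P_all hk (I.size.toNat + 1)).1 I ∅ ∅ h (by push_cast; omega) H

end Inst
end FR

open Finset
set_option linter.unusedSectionVars false
set_option linter.unnecessarySeqFocus false
namespace FR
namespace Inst
variable {V : Type*} [DecidableEq V]

/-- `ν` connects `Q` -/
def Conn (Q : Finset V) (ν : V → V → ℤ) : Prop :=
  ∀ A ⊆ Q, A.Nonempty → A ≠ Q → ∃ u ∈ A, ∃ w ∈ Q \ A, 1 ≤ ν u w

theorem Conn.of_not_mem {Q : Finset V} {ν : V → V → ℤ} (hs : ∀ x y, ν x y = ν y x) {v : V}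
    (H : ∀ A ⊆ Q, A.Nonempty → v ∉ A → ∃ u ∈ A, ∃ w ∈ Q \ A, 1 ≤ ν u w) : Conn Q ν := by
  intro A hA hne hAQ
  by_cases hv : v ∈ A
  · obtain ⟨u, hu, w, hw, h1⟩ := H (Q \ A) sdiff_subset
      (by
        rw [sdiff_nonempty]
        intro h; exact hAQ (Subset.antisymm hA h)) (by simp [hv])
    rw [Finset.sdiff_sdiff_eq_self hA] at hw
    exact ⟨w, hw, u, hu, by rw [hs]; exact h1⟩
  · exact H A hA hne hv

theorem conn_leaf {Q : Finset V} {ν : V → V → ℤ} (hs : ∀ x y, ν x y = ν y x) (hC : Conn Q ν) {v x : V} (hv : v ∈ Q)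
    (hx : ∀ y ∈ Q, y ≠ x → ν v y = 0) :
    Conn (Q \ {v}) (fun a b => if a = v ∨ b = v then 0 else ν a b) := by
  refine Conn.of_not_mem (v := x) (fun a b => ?_) fun A hA hne hxA => ?_
  · simp only [hs a b, or_comm]
  · have hvA : v ∉ A := fun h => by simpa using hA h
    obtain ⟨u, hu, w, hw, h1⟩ := hC A (hA.trans sdiff_subset) hne (by rintro rfl; exact hvA hv)
    rw [mem_sdiff] at hw
    have huv : u ≠ v := by rintro rfl; exact hvA hu
    have hwv : w ≠ v := by
      rintro rfl
      have := hx u ((hA.trans sdiff_subset) hu) (by rintro rfl; exact hxA hu)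
      rw [hs] at h1; omega
    exact ⟨u, hu, w, by simp [hw.1, hw.2, hwv], by simpa [huv, hwv] using h1⟩

theorem bridge {Q : Finset V} {ν : V → V → ℤ} (hs : ∀ x y, ν x y = ν y x) (hC : Conn Q ν) {v x : V}
    (hn : ¬ Conn Q (fun a b => ν a b - ed v x a b)) :
    ∃ A ⊆ Q, v ∉ A ∧ x ∈ A ∧ (∀ u ∈ A, ∀ w ∈ Q \ A, 1 ≤ ν u w → u = x ∧ w = v) ∧ ν x v ≤ 1 ∧ v ∈ Q := by
  have key : ∃ A ⊆ Q, A.Nonempty ∧ v ∉ A ∧ ∀ u ∈ A, ∀ w ∈ Q \ A, ν u w - ed v x u w < 1 := by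
    by_contra hcon
    apply hn
    refine Conn.of_not_mem (v := v) (fun a b => by rw [hs, ed_symm]) fun A hA hne hv => ?_
    by_contra h2
    apply hcon
    push Not at h2
    exact ⟨A, hA, hne, hv, h2⟩
  obtain ⟨A, hA, hne, hvA, hP⟩ := key
  have h1 : ∀ u ∈ A, ∀ w ∈ Q \ A, 1 ≤ ν u w → u = x ∧ w = v := by
    intro u hu w hw h1
    have h2 := hP u hu w hw
    have huv : u ≠ v := by rintro rfl; exact hvA hu
    unfold ed at h2
    rw [if_neg (fun h => huv h.1)] at h2
    by_contra hc
    rw [if_neg hc] at h2; omega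
  by_cases hQ : A = Q
  · -- then `v ∉ Q`
    exfalso
    apply hn
    intro B hB hne' hBQ
    obtain ⟨u, hu, w, hw, h3⟩ := hC B hB hne' hBQ
    refine ⟨u, hu, w, hw, ?_⟩
    have : u ≠ v := by rintro rfl; exact hvA (hQ ▸ hB hu)
    have : w ≠ v := by rintro rfl; exact hvA (hQ ▸ (mem_sdiff.1 hw).1)
    unfold ed
    simp [*]
  obtain ⟨u, hu, w, hw, h3⟩ := hC A hA hne hQ
  obtain ⟨rfl, rfl⟩ := h1 u hu w hw h3
  refine ⟨A, hA, hvA, hu, h1, ?_, (mem_sdiff.1 hw).1⟩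
  have h2 := hP u hu w hw
  have huv : u ≠ w := by rintro rfl; exact hvA hu
  unfold ed at h2
  simp [huv] at h2
  omega

theorem conn_lift {Q : Finset V} {ν : V → V → ℤ} (hs : ∀ x y, ν x y = ν y x) (h0 : ∀ x y, 0 ≤ ν x y) (hC : Conn Q ν) {v x y : V}
    {A : Finset V} (hA : A ⊆ Q) (hv : v ∉ A) (hx : x ∈ A)
    (hP : ∀ u ∈ A, ∀ w ∈ Q \ A, 1 ≤ ν u w → u = x ∧ w = v) (hyQ : y ∈ Q) (hyA : y ∉ A) (hyv : y ≠ v) (hvQ : v ∈ Q) :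
    Conn Q (fun a b => ν a b - ed v x a b + ed x y a b) := by
  refine Conn.of_not_mem (v := v) (fun a b => by rw [hs, ed_symm, ed_symm x]) fun B hB hne hvB => ?_
  by_contra hcon
  push Not at hcon
  have h1 : ∀ u ∈ B, ∀ w ∈ Q \ B, 1 ≤ ν u w → u = x ∧ w = v := by
    intro u hu w hw h1
    have h2 := hcon u hu w hw
    have huv : u ≠ v := by rintro rfl; exact hvB hu
    have := ed_nonneg x y u w
    unfold ed at h2 this
    rw [if_neg (fun h => huv h.1)] at h2
    by_contra hc
    rw [if_neg hc] at h2; omega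
  obtain ⟨u, hu, w, hw, h3⟩ := hC B hB hne (by rintro rfl; exact hvB hvQ)
  obtain ⟨rfl, rfl⟩ := h1 u hu w hw h3
  have hBA : B ⊆ A := by
    by_contra hn
    obtain ⟨a, ha, b, hb, h4⟩ := hC (B \ A) (sdiff_subset.trans hB) (sdiff_nonempty.2 hn)
      (by intro h; have := h ▸ hvQ; exact hvB (mem_sdiff.1 this).1)
    rw [mem_sdiff] at ha
    by_cases hbB : b ∈ B
    · have hbA : b ∈ A := by
        by_contra hbA
        exact (mem_sdiff.1 hb).2 (mem_sdiff.2 ⟨hbB, hbA⟩)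
      have := hP b hbA a (mem_sdiff.2 ⟨hB ha.1, ha.2⟩) (by rw [hs]; exact h4)
      exact hvB (this.2 ▸ ha.1)
    · have := h1 a ha.1 b (mem_sdiff.2 ⟨(mem_sdiff.1 hb).1, hbB⟩) h4
      exact ha.2 (this.1 ▸ hx)
  have hyB : y ∉ B := fun h => hyA (hBA h)
  have h5 := hcon u hu y (mem_sdiff.2 ⟨hyQ, hyB⟩)
  have huw : u ≠ w := by rintro rfl; exact hvB hu
  have := h0 u y
  have huy : u ≠ y := by rintro rfl; exact hyB hu
  unfold ed at h5
  simp [huw, hyv, huy] at h5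
  omega

/-- find a liftable edge -/
theorem find_lift {Q : Finset V} {ν : V → V → ℤ} (hs : ∀ x y, ν x y = ν y x) (h0 : ∀ x y, 0 ≤ ν x y) (hC : Conn Q ν) {v y : V}
    (h2 : 2 ≤ sm (ν v) Q) (hyQ : y ∈ Q) (hyv : y ≠ v) :
    ∃ x ∈ Q, 1 ≤ ν v x ∧ (Conn Q (fun a b => ν a b - ed v x a b) ∨
      (x ≠ y ∧ Conn Q (fun a b => ν a b - ed v x a b + ed x y a b))) := by
  by_contra hcon
  push Not at hcon
  obtain ⟨x1, hx1, p1⟩ := sm_pos (show 0 < sm (ν v) Q by omega)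
  obtain ⟨n1, l1⟩ := hcon x1 hx1 p1
  obtain ⟨A1, hA1, v1, m1, P1, u1, hvQ⟩ := bridge hs hC n1
  have e1 : sm (ν v) Q = ν v x1 + sm (ν v) (Q.erase x1) := by
    rw [← sm_insert _ (notMem_erase x1 Q), insert_erase hx1]
  rw [hs] at u1
  obtain ⟨x2, hx2, p2⟩ := sm_pos (show 0 < sm (ν v) (Q.erase x1) by omega)
  rw [mem_erase] at hx2
  obtain ⟨n2, l2⟩ := hcon x2 hx2.2 p2
  obtain ⟨A2, hA2, v2, m2, P2, u2, -⟩ := bridge hs hC n2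
  have y1 : y ∈ A1 := by
    by_contra hy
    exact l1 (by rintro rfl; exact hy m1) (conn_lift hs h0 hC hA1 v1 m1 P1 hyQ hy hyv hvQ)
  have y2 : y ∈ A2 := by
    by_contra hy
    exact l2 (by rintro rfl; exact hy m2) (conn_lift hs h0 hC hA2 v2 m2 P2 hyQ hy hyv hvQ)
  obtain ⟨a, ha, b, hb, h3⟩ := hC (A1 ∩ A2) (inter_subset_left.trans hA1) ⟨y, mem_inter.2 ⟨y1, y2⟩⟩
    (by intro h; have := h ▸ hvQ; exact v1 (mem_inter.1 this).1)
  rw [mem_inter] at ha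
  rw [mem_sdiff, mem_inter] at hb
  by_cases hb1 : b ∈ A1
  · have hb2 : b ∉ A2 := fun h => hb.2 ⟨hb1, h⟩
    obtain ⟨rfl, rfl⟩ := P2 a ha.2 b (mem_sdiff.2 ⟨hb.1, hb2⟩) h3
    exact v1 hb1
  · obtain ⟨rfl, rfl⟩ := P1 a ha.1 b (mem_sdiff.2 ⟨hb.1, hb1⟩) h3
    by_cases hb2 : b ∈ A2
    · exact v2 hb2
    · have := (P2 a ha.2 b (mem_sdiff.2 ⟨hb.1, hb2⟩) h3).1
      exact hx2.1 this.symm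

end Inst
end FR

open Finset
set_option linter.unusedSectionVars false
set_option linter.unnecessarySeqFocus false
namespace FR
namespace Inst
variable {V : Type*} [DecidableEq V]

/-- an instance without root and without free edges -/
def ins (Q : Finset V) (μ : V → V → ℤ) (t : V → ℤ) : Inst V := ⟨Q, μ, fun _ => 0, fun _ => 0, fun _ => 0, t⟩

theorem dd_ins {Q : Finset V} {μ : V → V → ℤ} {t : V → ℤ} (A : Finset V) : (ins Q μ t).dd A = ee μ A (Q \ A) := by
  simp [dd, ins, sm_zero]

theorem dd_ins1 {Q : Finset V} {μ : V → V → ℤ} {t : V → ℤ} (h : (ins Q μ t).Ok) {v : V} (hv : v ∈ Q) :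
    (ins Q μ t).dd {v} = sm (μ v) Q := by
  rw [dd_single h hv]; simp [ins, sm]

theorem sm_split (g : V → ℤ) {Q : Finset V} {v : V} (hv : v ∈ Q) : sm g Q = sm g (Q \ {v}) + g v := by
  rw [sm_sdiff _ (singleton_subset_iff.2 hv), sm_singleton]; ring

theorem ok_ins {Q : Finset V} {μ : V → V → ℤ} {t : V → ℤ} (hs : ∀ x y, μ x y = μ y x) (h0 : ∀ x y, 0 ≤ μ x y) (hd : ∀ x, μ x x = 0)
    (hp : ∀ v ∈ Q, 2 ∣ sm (μ v) Q - t v) : (ins Q μ t).Ok := by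
  refine ⟨hs, h0, hd, fun _ _ => le_rfl, fun _ _ => le_rfl, fun _ _ => le_rfl, fun v hv => ?_⟩
  change v ∈ Q at hv
  have : (ins Q μ t).dd {v} = sm (μ v) Q := by
    rw [dd_ins, ee_singleton_left, sm_split _ hv, hd]; simp [sm]
  rw [this]; exact hp v hv

theorem ok_rem_v {Q : Finset V} {μ : V → V → ℤ} {t : V → ℤ} (h : (ins Q μ t).Ok) {v : V} (hv : v ∈ Q) (g : V → ℤ) :
    (ins (Q \ {v}) μ (fun w => t w + 2 * g w - μ v w)).Ok := by
  refine ok_ins h.symm h.nn h.diag fun w hw => ?_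
  have hw' := (mem_sdiff.1 hw).1
  have h1 := h.par w hw'
  rw [dd_ins1 h hw', sm_split _ hv] at h1
  have h2 : μ w v = μ v w := h.symm w v
  change 2 ∣ _ - t w at h1
  omega

theorem rem_v {Q : Finset V} {μ : V → V → ℤ} {t : V → ℤ} (h : (ins Q μ t).Ok) {k : ℤ} {v : V} (hv : v ∈ Q) (g : V → ℤ)
    (hg : ∀ w ∈ Q, 0 ≤ g w ∧ g w ≤ μ v w) (hk : 2 * k ∣ 2 * sm g Q - sm (μ v) Q - t v)
    (G : (ins (Q \ {v}) μ (fun w => t w + 2 * g w - μ v w)).Good k ∅) : (ins Q μ t).Good k ∅ := by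
  have h' := ok_rem_v h hv g
  obtain ⟨r, ⟨f, q, F1, F2, F3⟩, h1, -⟩ := G
  have hgv : g v = 0 := by
    have := hg v hv
    have hd : μ v v = 0 := h.diag v
    omega
  have hsym : ∀ x y, μ x y = μ y x := h.symm
  have hd : ∀ x, μ x x = 0 := h.diag
  have mem : ∀ u, u ∈ Q → u ≠ v → u ∈ Q \ {v} := by
    intro u hu hne; simp [hu, hne]
  refine ⟨fun x => if x = v then sm g Q else r x + μ v x - g x,
    ⟨fun x y => if x = v then (if y = v then 0 else g y) else if y = v then μ v x - g x else f x y, fun _ => 0, ?_, ?_, ?_⟩, ?_, by simp⟩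
  · intro x hx y hy
    have gx := hg x hx
    have gy := hg y hy
    change 0 ≤ _ ∧ _ = μ x y
    by_cases h3 : x = v
    · by_cases h4 : y = v
      · simp [h3, h4, hd]
      · subst h3; simp [h4]; exact gy.1
    · by_cases h4 : y = v
      · subst h4; simp [h3, hsym x y]; omega
      · have := F1 x (mem x hx h3) y (mem y hy h4)
        change 0 ≤ f x y ∧ f x y + f y x = μ x y at this
        simpa [h3, h4] using this
  · intro x hx; exact ⟨le_rfl, le_rfl⟩
  · intro x hx
    change _ = ∑ u ∈ Q, _ + 0 + 0
    rw [add_zero, add_zero]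
    by_cases h3 : x = v
    · subst h3
      simp only [if_true]
      refine Finset.sum_congr rfl fun y hy => ?_
      by_cases h4 : y = x
      · subst h4; simp [hgv]
      · simp [h4]
    · have := F3 x (mem x hx h3)
      have hq := F2 x (mem x hx h3)
      change 0 ≤ q x ∧ q x ≤ 0 at hq
      change r x = ∑ u ∈ Q \ {v}, f x u + q x + 0 at this
      simp only [h3, if_false]
      rw [← Finset.sum_sdiff (s₁ := {v}) (s₂ := Q) (singleton_subset_iff.2 hv)]
      simp only [sum_singleton, if_true]
      rw [Finset.sum_congr rfl (g := fun u => f x u) fun y hy => by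
        rw [if_neg]; simpa using (mem_sdiff.1 hy).2]
      omega
  · intro x hx
    change x ∈ Q at hx
    rw [dd_ins1 h hx]
    change 2 * k ∣ _ - _ - t x
    by_cases h3 : x = v
    · subst h3; simpa using hk
    · have := h1 x (mem x hx h3)
      rw [dd_ins1 h' (mem x hx h3)] at this
      obtain ⟨c, hc⟩ := this
      refine ⟨c, ?_⟩
      have e1 := sm_split (μ x) hv
      rw [hsym x v] at e1
      change _ - (t x + 2 * g x - μ v x) = _ at hc
      simp only [h3, if_false]
      linarith

/-- a family of symmetric edge-disjoint subgraphs -/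
structure Fam {m : ℕ} (μ : V → V → ℤ) (ν : Fin m → V → V → ℤ) : Prop where
  nn : ∀ i x y, 0 ≤ ν i x y
  symm : ∀ i x y, ν i x y = ν i y x
  le : ∀ x y, ∑ i, ν i x y ≤ μ x y

theorem Fam.sm {m : ℕ} {μ : V → V → ℤ} {ν : Fin m → V → V → ℤ} (F : Fam μ ν) (v : V) (Q : Finset V) :
    ∑ i, sm (ν i v) Q ≤ sm (μ v) Q := by
  unfold FR.sm
  rw [Finset.sum_comm]
  exact Finset.sum_le_sum fun y _ => F.le v y

def TP (V : Type*) [DecidableEq V] (k : ℤ) (m n : ℕ) : Prop :=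
  ∀ (Q : Finset V) (μ : V → V → ℤ) (t : V → ℤ) (ν : Fin m → V → V → ℤ), (ins Q μ t).Ok → Q.card < n → 2 * k ∣ sm t Q →
    Fam μ ν → (∀ i, Conn Q (ν i)) → (ins Q μ t).Good k ∅

theorem TP_end {k : ℤ} {m n : ℕ} (hk : 2 ≤ k) (IH : TP V k m n) {Q : Finset V} {μ : V → V → ℤ} {t : V → ℤ} {ν : Fin m → V → V → ℤ}
    (h : (ins Q μ t).Ok) (hn : Q.card < n + 1) (ht : 2 * k ∣ sm t Q) (F : Fam μ ν) {v : V} (hv : v ∈ Q)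
    (hC : ∀ i, Conn (Q \ {v}) (ν i)) (hd : k - 1 ≤ sm (μ v) Q) : (ins Q μ t).Good k ∅ := by
  have hpar := h.par v hv
  rw [dd_ins1 h hv] at hpar
  change 2 ∣ _ - t v at hpar
  obtain ⟨c, hc⟩ : 2 ∣ sm (μ v) Q + t v := by omega
  have e1 := Int.emod_add_mul_ediv c k
  have e2 := Int.emod_nonneg c (show k ≠ 0 by omega)
  have e3 := Int.emod_lt_of_pos c (show 0 < k by omega)
  obtain ⟨g, hg, hgs⟩ := split Q (μ v) (fun w _ => h.nn v w) (c % k) e2 (by unfold sm at hd; omega)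
  have hdv : 2 * k ∣ 2 * sm g Q - sm (μ v) Q - t v := by
    refine ⟨-(c / k), ?_⟩
    have : sm g Q = c % k := hgs
    rw [this]
    linarith
  refine rem_v h hv g hg hdv ?_
  refine IH _ _ _ ν (ok_rem_v h hv g) ?_ ?_ F hC
  · rw [card_sdiff_of_subset (singleton_subset_iff.2 hv), card_singleton]
    have := card_pos.2 ⟨v, hv⟩
    omega
  · have hgv : g v = 0 := by
      have := hg v hv
      have hd : μ v v = 0 := h.diag v
      omega
    have hmv : μ v v = 0 := h.diag v
    have : sm (fun w => t w + 2 * g w - μ v w) (Q \ {v}) = sm t Q - t v + 2 * sm g Q - sm (μ v) Q := by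
      rw [sm_split t hv, sm_split g hv, sm_split (μ v) hv, hgv, hmv]
      unfold sm
      rw [Finset.sum_sub_distrib, Finset.sum_add_distrib, ← Finset.mul_sum]
      ring
    rw [this]
    obtain ⟨a, ha⟩ := hdv
    obtain ⟨b, hb⟩ := ht
    exact ⟨a + b, by linarith⟩

theorem sm_ed {Q : Finset V} {v x : V} (hx : x ∈ Q) (hn : x ≠ v) : sm (ed v x v) Q = 1 := by
  unfold sm ed
  simp [hn.symm, hx]

theorem sm_ed0 {Q : Finset V} {v x y : V} (h1 : x ≠ v) (h2 : y ≠ v) : sm (ed x y v) Q = 0 := by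
  unfold sm ed
  simp [h1.symm, h2.symm]

theorem Fam.upd {m : ℕ} {μ μ' : V → V → ℤ} {ν : Fin m → V → V → ℤ} (F : Fam μ ν) (i : Fin m) (ν' : V → V → ℤ)
    (h0 : ∀ x y, 0 ≤ ν' x y) (hs : ∀ x y, ν' x y = ν' y x) (hle : ∀ x y, ∑ j, ν j x y + ν' x y - ν i x y ≤ μ' x y) :
    Fam μ' (Function.update ν i ν') := by
  refine ⟨?_, ?_, ?_⟩
  · intro j x y
    by_cases h : j = i
    · subst h; simpa using h0 x y
    · simpa [h] using F.nn j x y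
  · intro j x y
    by_cases h : j = i
    · subst h; simpa using hs x y
    · simpa [h] using F.symm j x y
  · intro x y
    refine le_trans (le_of_eq ?_) (hle x y)
    have e1 := Finset.add_sum_erase univ (fun j => ν j x y) (mem_univ i)
    have e2 := Finset.add_sum_erase univ (fun j => Function.update ν i ν' j x y) (mem_univ i)
    have e3 : ∑ j ∈ univ.erase i, Function.update ν i ν' j x y = ∑ j ∈ univ.erase i, ν j x y :=
      Finset.sum_congr rfl fun j hj => by rw [Function.update_of_ne (ne_of_mem_erase hj)]
    simp only [Function.update_self] at e2
    linarith

theorem TP_rem {k : ℤ} {m n : ℕ} (hk : 2 ≤ k) (IH : TP V k m n) {Q : Finset V} {t : V → ℤ}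
    (hn : Q.card < n + 1) (h2 : 2 ≤ Q.card) (ht : 2 * k ∣ sm t Q) {v : V} (hv : v ∈ Q) (N : ℕ) :
    ∀ (μ : V → V → ℤ) (ν : Fin m → V → V → ℤ) (Act : Finset (Fin m)),
    (ins Q μ t).Ok → Fam μ ν → (∀ i ∈ Act, Conn Q (ν i)) → (∀ i ∉ Act, (∀ x, ν i v x = 0) ∧ Conn (Q \ {v}) (ν i)) →
    k - 1 + 2 * ∑ i ∈ Act, (sm (ν i v) Q - 1) ≤ sm (μ v) Q → ∑ i ∈ Act, (sm (ν i v) Q + 1) < N →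
    (ins Q μ t).Good k ∅ := by
  induction N with
  | zero =>
    intro μ ν Act h F hA hD hI hN
    have : 0 ≤ ∑ i ∈ Act, (sm (ν i v) Q + 1) := Finset.sum_nonneg fun i _ => by
      have := sm_nonneg (A := Q) fun y _ => F.nn i v y
      omega
    push_cast at hN; omega
  | succ N ih =>
    intro μ ν Act h F hA hD hI hN
    by_cases hAct : Act = ∅
    · subst hAct
      refine TP_end hk IH h hn ht F hv (fun i => (hD i (by simp)).2) ?_
      simpa using hI
    have hpos : ∀ i ∈ Act, 1 ≤ sm (ν i v) Q := by
      intro i hi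
      obtain ⟨u, hu, w, hw, h3⟩ := hA i hi {v} (singleton_subset_iff.2 hv) (singleton_nonempty v)
        (by rintro rfl; simp at h2)
      rw [mem_singleton] at hu; subst hu
      exact h3.trans (sm_le (mem_sdiff.1 hw).1 fun y _ => F.nn i u y)
    have upd_sum : ∀ (i : Fin m) (ν' : V → V → ℤ) (c : ℤ), i ∈ Act → 
        ∑ j ∈ Act, (sm (Function.update ν i ν' j v) Q + c) = ∑ j ∈ Act, (sm (ν j v) Q + c) + sm (ν' v) Q - sm (ν i v) Q := by
      intro i ν' c hi
      have e1 := Finset.add_sum_erase Act (fun j => sm (ν j v) Q + c) hi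
      have e2 := Finset.add_sum_erase Act (fun j => sm (Function.update ν i ν' j v) Q + c) hi
      have e3 : ∑ j ∈ Act.erase i, (sm (Function.update ν i ν' j v) Q + c) = ∑ j ∈ Act.erase i, (sm (ν j v) Q + c) :=
        Finset.sum_congr rfl fun j hj => by rw [Function.update_of_ne (ne_of_mem_erase hj)]
      simp only [Function.update_self] at e2
      linarith
    by_cases h1 : ∃ i ∈ Act, sm (ν i v) Q = 1
    · -- make `i` done
      obtain ⟨i, hi, h1⟩ := h1
      obtain ⟨x, hx, hx1⟩ := sm_pos (show 0 < sm (ν i v) Q by omega)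
      have e1 : sm (ν i v) Q = ν i v x + sm (ν i v) (Q.erase x) := by
        rw [← sm_insert _ (notMem_erase x Q), insert_erase hx]
      have hx2 : ∀ y ∈ Q, y ≠ x → ν i v y = 0 := by
        intro y hy hne
        have := sm_le (mem_erase.2 ⟨hne, hy⟩) fun y _ => F.nn i v y
        have := F.nn i v y
        omega
      have hle : ∀ a b, (if a = v ∨ b = v then 0 else ν i a b) ≤ ν i a b := by
        intro a b; split_ifs
        · exact F.nn i a b
        · exact le_rfl
      have hsame : ∀ j ∈ Act.erase i, Function.update ν i (fun a b => if a = v ∨ b = v then 0 else ν i a b) j = ν j :=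
        fun j hj => Function.update_of_ne (ne_of_mem_erase hj) _ _
      have e2 := Finset.add_sum_erase Act (fun j => sm (ν j v) Q + 1) hi
      have e3 := Finset.add_sum_erase Act (fun j => sm (ν j v) Q - 1) hi
      refine ih μ (Function.update ν i (fun a b => if a = v ∨ b = v then 0 else ν i a b)) (Act.erase i) h ?_ ?_ ?_ ?_ ?_
      · refine F.upd i _ (fun a b => ?_) (fun a b => ?_) (fun a b => ?_)
        · split_ifs
          · exact le_rfl
          · exact F.nn i a b
        · simp only [F.symm i a b, or_comm]
        · have := F.le a b
          have := hle a b
          omega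
      · intro j hj
        rw [hsame j hj]; exact hA j (mem_of_mem_erase hj)
      · intro j hj
        by_cases hji : j = i
        · subst hji
          rw [Function.update_self]
          exact ⟨by simp, conn_leaf (F.symm j) (hA j hi) hv hx2⟩
        · rw [Function.update_of_ne hji]
          exact hD j fun hj' => hj (mem_erase.2 ⟨hji, hj'⟩)
      · rw [Finset.sum_congr rfl fun j hj => by rw [hsame j hj]]
        try simp only at e3
        omega
      · rw [Finset.sum_congr rfl fun j hj => by rw [hsame j hj]]
        try simp only at e2
        push_cast at hN
        omega
    push Not at h1
    obtain ⟨i, hi⟩ := nonempty_iff_ne_empty.2 hAct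
    have hge : ∀ j ∈ Act, 2 ≤ sm (ν j v) Q := fun j hj => by
      have := hpos j hj
      have := h1 j hj
      omega
    -- an unused edge
    obtain ⟨y, hy, hyl⟩ : ∃ y ∈ Q, ∑ j, ν j v y < μ v y := by
      by_contra hcon
      push Not at hcon
      have e1 : sm (μ v) Q ≤ ∑ j, sm (ν j v) Q := by
        unfold sm
        rw [Finset.sum_comm]
        exact Finset.sum_le_sum hcon
      have e2 : ∑ j, sm (ν j v) Q = ∑ j ∈ Act, sm (ν j v) Q := by
        symm
        refine Finset.sum_subset (subset_univ _) fun j _ hj => ?_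
        exact sm_zero_of fun y _ => (hD j hj).1 y
      have e3 : ∑ j ∈ Act, sm (ν j v) Q ≤ ∑ j ∈ Act, 2 * (sm (ν j v) Q - 1) :=
        Finset.sum_le_sum fun j hj => by have := hge j hj; omega
      rw [← Finset.mul_sum] at e3
      omega
    have hsumn : 0 ≤ ∑ j, ν j v y := Finset.sum_nonneg fun j _ => F.nn j v y
    have hyv : y ≠ v := by
      rintro rfl
      have : μ y y = 0 := h.diag y
      omega
    obtain ⟨x, hx, hx1, hor⟩ := find_lift (F.symm i) (F.nn i) (hA i hi) (hge i hi) hy hyv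
    have hmx : 1 ≤ μ v x := by
      have e1 := F.le v x
      have e2 := Finset.single_le_sum (f := fun j => ν j v x) (fun j _ => F.nn j v x) (mem_univ i)
      try simp only at e2
      omega
    have hxv : x ≠ v := (ne_of_mu h hmx).symm
    have hed : ∀ a b, ed v x a b ≤ ν i a b := ed_le hxv.symm (F.symm i) (F.nn i) hx1
    have hD' : ∀ ν', ∀ j ∉ Act, (∀ x, Function.update ν i ν' j v x = 0) ∧ Conn (Q \ {v}) (Function.update ν i ν' j) := by
      intro ν' j hj
      rw [Function.update_of_ne (by rintro rfl; exact hj hi)]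
      exact hD j hj
    have hA' : ∀ ν', Conn Q ν' → ∀ j ∈ Act, Conn Q (Function.update ν i ν' j) := by
      intro ν' hc j hj
      by_cases hji : j = i
      · subst hji; simpa using hc
      · rw [Function.update_of_ne hji]; exact hA j hj
    rcases hor with hc | ⟨hxy, hc⟩
    · -- drop a redundant edge
      have hsm : sm (fun b => ν i v b - ed v x v b) Q = sm (ν i v) Q - 1 := by
        rw [sm_sub, sm_ed hx hxv]
      refine ih μ (Function.update ν i (fun a b => ν i a b - ed v x a b)) Act h ?_ (hA' _ hc) (hD' _) ?_ ?_
      · refine F.upd i _ (fun a b => ?_) (fun a b => ?_) (fun a b => ?_)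
        · have := hed a b; omega
        · simp only [F.symm i a b, ed_symm v x a b]
        · have := F.le a b
          have := ed_nonneg v x a b
          omega
      · have := upd_sum i (fun a b => ν i a b - ed v x a b) (-1) hi
        simp only [← sub_eq_add_neg] at this
        rw [this, hsm]; omega
      · rw [upd_sum i _ _ hi, hsm]
        push_cast at hN
        omega
    · -- lift
      have hmy : 1 ≤ μ v y := by omega
      have L := lft_ww h hv hx hy hxy hmx hmy
      refine L.good (S' := ∅) (by simp) (by simp) ?_
      have hsm : sm (fun b => ν i v b - ed v x v b + ed x y v b) Q = sm (ν i v) Q - 1 := by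
        rw [sm_add, sm_sub, sm_ed hx hxv, sm_ed0 hxv hyv]; ring
      have hsmμ : sm (fun b => μ v b - ed v x v b - ed v y v b + ed x y v b) Q = sm (μ v) Q - 2 := by
        rw [sm_add, sm_sub, sm_sub, sm_ed hx hxv, sm_ed hy hyv, sm_ed0 hxv hyv]; ring
      refine ih (fun a b => μ a b - ed v x a b - ed v y a b + ed x y a b)
        (Function.update ν i (fun a b => ν i a b - ed v x a b + ed x y a b)) Act L.ok ?_ (hA' _ hc) (hD' _) ?_ ?_
      · refine F.upd i _ (fun a b => ?_) (fun a b => ?_) (fun a b => ?_)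
        · have := hed a b
          have := ed_nonneg x y a b
          omega
        · simp only [F.symm i a b, ed_symm v x a b, ed_symm x y a b]
        · have key : ed v y a b ≤ μ a b - ∑ j, ν j a b := by
            refine ed_le (μ := fun a b => μ a b - ∑ j, ν j a b) hyv.symm ?_ ?_ ?_ a b
            · intro a b
              have e1 : μ a b = μ b a := h.symm a b
              have e2 : ∑ j, ν j a b = ∑ j, ν j b a := Finset.sum_congr rfl fun j _ => F.symm j a b
              simp only [e1, e2]
            · intro a b; have := F.le a b; omega
            · omega
          omega
      · have := upd_sum i (fun a b => ν i a b - ed v x a b + ed x y a b) (-1) hi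
        simp only [← sub_eq_add_neg] at this
        rw [this, hsm, hsmμ]; omega
      · rw [upd_sum i _ _ hi, hsm]
        push_cast at hN
        omega

end Inst
end FR

open Finset
set_option linter.unusedSectionVars false
set_option linter.unnecessarySeqFocus false
namespace FR
namespace Inst
variable {V : Type*} [DecidableEq V]

/-- contraction of a multiplicity function -/
def cn (A : Finset V) (a : V) (ν : V → V → ℤ) : V → V → ℤ :=
  fun u v => if u = a then (if v = a then 0 else ∑ x ∈ A, ν x v) else if v = a then ∑ x ∈ A, ν u x else ν u v

theorem con_ins (Q : Finset V) (μ : V → V → ℤ) (t : V → ℤ) (A : Finset V) (a : V) :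
    (ins Q μ t).con A a = ins (insert a (Q \ A)) (cn A a μ) (fun v => if v = a then sm t A else t v) := by
  unfold con ins cn
  simp [sm_zero]

theorem Fam.cn {m : ℕ} {μ : V → V → ℤ} {ν : Fin m → V → V → ℤ} (F : Fam μ ν) (A : Finset V) (a : V) :
    Fam (cn A a μ) (fun i => cn A a (ν i)) := by
  refine ⟨?_, ?_, ?_⟩
  · intro i x y
    unfold Inst.cn
    split_ifs
    · exact le_rfl
    · exact Finset.sum_nonneg fun z _ => F.nn _ _ _
    · exact Finset.sum_nonneg fun z _ => F.nn _ _ _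
    · exact F.nn _ _ _
  · intro i x y
    unfold Inst.cn
    split_ifs
    · rfl
    · exact Finset.sum_congr rfl fun z _ => F.symm _ _ _
    · exact Finset.sum_congr rfl fun z _ => F.symm _ _ _
    · exact F.symm _ _ _
  · intro x y
    unfold Inst.cn
    split_ifs
    · simp
    · rw [Finset.sum_comm]; exact Finset.sum_le_sum fun z _ => F.le _ _
    · rw [Finset.sum_comm]; exact Finset.sum_le_sum fun z _ => F.le _ _
    · exact F.le _ _

theorem conn_cn {Q : Finset V} {ν : V → V → ℤ} (h0 : ∀ x y, 0 ≤ ν x y) (hC : Conn Q ν) {A : Finset V} {a : V}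
    (hA : A ⊆ Q) (ha : a ∈ A) : Conn (insert a (Q \ A)) (cn A a ν) := by
  intro B hB hne hBQ
  have hB' : B ⊆ ((ins Q ν 0).con A a).Q := hB
  obtain ⟨u, hu, w, hw, h1⟩ := hC (ex A a B) (ex_sub (I := ins Q ν 0) hA hB' ha) (ex_ne hne)
    (ex_ne_Q (I := ins Q ν 0) hA ha hB' hBQ)
  have key : ∀ u w, (u ∈ A → w ∉ A) → ν u w ≤ cn A a ν (if u ∈ A then a else u) (if w ∈ A then a else w) := by
    intro u w huw
    unfold cn
    by_cases h2 : u ∈ A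
    · have h3 := huw h2
      have h4 : w ≠ a := fun h => h3 (h ▸ ha)
      simp only [h2, h3, h4, if_true, if_false]
      exact Finset.single_le_sum (f := fun x => ν x w) (fun x _ => h0 x w) h2
    · have h4 : u ≠ a := fun h => h2 (h ▸ ha)
      by_cases h3 : w ∈ A
      · simp only [h2, h3, h4, if_true, if_false]
        exact Finset.single_le_sum (f := fun x => ν u x) (fun x _ => h0 u x) h3
      · have h5 : w ≠ a := fun h => h3 (h ▸ ha)
        simp only [h2, h3, h4, h5, if_false]; exact le_rfl
  have hBm : ∀ x ∈ B, x = a ∨ x ∈ Q ∧ x ∉ A := fun x hx => by simpa using hB hx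
  rw [mem_sdiff] at hw
  unfold ex at hu hw
  refine ⟨if u ∈ A then a else u, ?_, if w ∈ A then a else w, ?_, h1.trans (key u w ?_)⟩
  · by_cases h3 : a ∈ B
    · rw [if_pos h3, mem_union] at hu
      split_ifs with h2
      · exact h3
      · tauto
    · rw [if_neg h3] at hu
      split_ifs with h2
      · rcases hBm u hu with rfl | h4
        · exact hu
        · exact absurd h2 h4.2
      · exact hu
  · rw [mem_sdiff, mem_insert, mem_sdiff]
    by_cases h3 : a ∈ B
    · rw [if_pos h3, mem_union] at hw
      rw [if_neg (by tauto)]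
      tauto
    · rw [if_neg h3] at hw
      split_ifs with h2
      · exact ⟨Or.inl rfl, h3⟩
      · exact ⟨Or.inr ⟨hw.1, h2⟩, hw.2⟩
  · intro h2 h3
    by_cases h4 : a ∈ B
    · rw [if_pos h4, mem_union] at hw; tauto
    · rw [if_neg h4] at hu
      rcases hBm u hu with rfl | h5
      · exact h4 hu
      · exact h5.2 h2

theorem dd_ge {m : ℕ} {Q : Finset V} {μ : V → V → ℤ} {t : V → ℤ} {ν : Fin m → V → V → ℤ} (F : Fam μ ν) (hC : ∀ i, Conn Q (ν i))
    {A : Finset V} (hA : A ⊆ Q) (hne : A.Nonempty) (hAQ : A ≠ Q) : (m : ℤ) ≤ (ins Q μ t).dd A := by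
  rw [dd_ins]
  have h1 : ∀ i, 1 ≤ ee (ν i) A (Q \ A) := by
    intro i
    obtain ⟨u, hu, w, hw, h1⟩ := hC i A hA hne hAQ
    refine h1.trans ?_
    unfold ee
    refine (Finset.single_le_sum (f := fun w => ν i u w) (fun x _ => F.nn i u x) hw).trans ?_
    exact Finset.single_le_sum (f := fun u => ∑ w ∈ Q \ A, ν i u w)
      (fun x _ => Finset.sum_nonneg fun y _ => F.nn i x y) hu
  have h2 : ∑ i, ee (ν i) A (Q \ A) ≤ ee μ A (Q \ A) := by
    unfold ee
    rw [Finset.sum_comm]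
    refine Finset.sum_le_sum fun x _ => ?_
    rw [Finset.sum_comm]
    exact Finset.sum_le_sum fun y _ => F.le x y
  refine le_trans ?_ h2
  calc (m : ℤ) = ∑ i : Fin m, (1 : ℤ) := by simp
    _ ≤ _ := Finset.sum_le_sum fun i _ => h1 i

/-- solving the inner side of a small cut -/
theorem side_good {k : ℤ} (hk : 2 ≤ k) {I : Inst V} (h : I.Ok) {A : Finset V} {o' i' : V → ℤ} (hA : A ⊆ I.Q) 
    (H : ∀ v ∈ A, 0 ≤ o' v ∧ 0 ≤ i' v ∧ o' v + i' v = I.o v + I.i v + I.φ v + ∑ w ∈ I.Q \ A, I.μ v w)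
    (hnet : 2 * k ∣ sm i' A - sm o' A - I.tt A) (hD0 : 2 * k - 2 ≤ I.dd A) (hD1 : I.dd A ≤ 3 * k - 3)
    (hc : ∀ C ⊆ A, C.Nonempty → C ≠ A → 3 * k - 2 ≤ I.dd C) : (I.side A o' i').Good k ∅ := by
  have hS := side_of h hA H
  have htot := hS.tot
  obtain ⟨s, hs0, hs1, hs2, hs3⟩ : ∃ s : ℤ, 0 ≤ s ∧ s ≤ I.dd A ∧ k - 1 ≤ 2 * s - I.dd A ∧ 2 * s - I.dd A ≤ k :=
    ⟨(I.dd A + k) / 2, by omega, by omega, by omega, by omega⟩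
  obtain ⟨g, hg, hgs⟩ := split A (fun v => o' v + i' v) (fun v hv => by have := H v hv; omega) s hs0
    (by
      have := sm_add o' i' A
      unfold sm at this htot
      rw [this, htot]; exact hs1)
  have H' : ∀ v ∈ A, 0 ≤ o' v + i' v - g v ∧ 0 ≤ g v ∧
      (o' v + i' v - g v) + g v = I.o v + I.i v + I.φ v + ∑ w ∈ I.Q \ A, I.μ v w := by
    intro v hv
    have h1 := H v hv
    have h2 := hg v hv
    refine ⟨by linarith, h2.1, by linarith⟩
  have hS' := side_of h hA H'
  have hdd : ∀ C, (⟨A, I.μ, fun v => o' v + i' v - g v, g, fun _ => 0, fun v => I.t v + 2 * g v - 2 * i' v⟩ : Inst V).dd C =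
    (I.side A (fun v => o' v + i' v - g v) g).dd C := fun C => rfl
  have htt : sm (fun v => I.t v + 2 * g v - 2 * i' v) A = I.tt A + 2 * sm g A - 2 * sm i' A := by
    unfold tt sm
    rw [Finset.sum_sub_distrib, Finset.sum_add_distrib, ← Finset.mul_sum, ← Finset.mul_sum]
  have hgs' : sm g A = s := hgs
  have hnd : nd k (I.tt A + 2 * sm g A - 2 * sm i' A) = 2 * s - I.dd A := by
    rw [← nd_small hk (n := 2 * s - I.dd A) (by omega) (by omega)]
    apply nd_congr
    obtain ⟨q, hq⟩ := hnet
    exact ⟨-q, by linarith⟩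
  have G : (⟨A, I.μ, fun v => o' v + i' v - g v, g, fun _ => 0, fun v => I.t v + 2 * g v - 2 * i' v⟩ : Inst V).Good k ∅ := by
    refine T0_thm hk ?_ ⟨Or.inl rfl, fun _ _ => rfl, ?_, ?_, ?_, by simp⟩
    · refine ⟨h.symm, h.nn, h.diag, fun v hv => (H' v hv).1, fun v hv => (H' v hv).2.1, fun _ _ => le_rfl, fun v hv => ?_⟩
      change v ∈ A at hv
      rw [hdd, hS'.dd {v} (singleton_subset_iff.2 hv)]
      have := h.par v (hA hv)
      change 2 ∣ I.dd {v} - (I.t v + 2 * g v - 2 * i' v)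
      omega
    · intro C hC hne hCA _
      change C ⊆ A at hC
      rw [hdd, hS'.dd C hC]
      have := hc C hC hne hCA
      have := nd_le hk (tt (⟨A, I.μ, fun v => o' v + i' v - g v, g, fun _ => 0, fun v => I.t v + 2 * g v - 2 * i' v⟩ : Inst V) C)
      omega
    · rw [hdd]
      change (I.side A (fun v => o' v + i' v - g v) g).dd A ≤ 2 * k - 2 + nd k (sm (fun v => I.t v + 2 * g v - 2 * i' v) A)
      rw [hS'.dd A (Subset.refl A), htt, hnd]
      omega
    · change 2 * k ∣ sm g A - sm (fun v => o' v + i' v - g v) A - sm (fun v => I.t v + 2 * g v - 2 * i' v) A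
      rw [htt, sm_sub, sm_add]
      obtain ⟨q, hq⟩ := hnet
      exact ⟨q, by linarith⟩
  obtain ⟨r, ⟨f, p, F1, F2, F3⟩, h1, -⟩ := G
  refine ⟨fun v => r v - g v + i' v, ⟨f, p, F1, F2, fun v hv => ?_⟩, fun v hv => ?_, by simp⟩
  · have := F3 v hv
    change r v = ∑ u ∈ A, f v u + p v + g v at this
    change r v - g v + i' v = ∑ u ∈ A, f v u + p v + i' v
    linarith
  · change v ∈ A at hv
    obtain ⟨q, hq⟩ := h1 v hv
    rw [hdd, hS'.dd {v} (singleton_subset_iff.2 hv)] at hq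
    rw [hS.dd {v} (singleton_subset_iff.2 hv)]
    change _ - (I.t v + 2 * g v - 2 * i' v) = _ at hq
    change _ ∣ _ - _ - I.t v
    exact ⟨q, by linarith⟩

theorem TP_step {k : ℤ} {m n : ℕ} (hk : 2 ≤ k) (hm : (m : ℤ) = 2 * k - 2) (IH : TP V k m n) : TP V k m (n + 1) := by
  intro Q μ t ν h hn ht F hC
  by_cases hbig : ∀ A ⊆ Q, A.Nonempty → A ≠ Q → 3 * k - 2 ≤ (ins Q μ t).dd A
  · refine T0_thm hk h ⟨Or.inl rfl, fun _ _ => rfl, ?_, ?_, ?_, by simp⟩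
    · intro A hA hne hAQ _
      have := hbig A hA hne hAQ
      have := nd_le hk ((ins Q μ t).tt A)
      omega
    · rw [dd_full]
      have := nd_nonneg hk ((ins Q μ t).tt (ins Q μ t).Q)
      simp only [ins, sm_zero] at *
      omega
    · obtain ⟨q, hq⟩ := ht
      change 2 * k ∣ sm (fun _ => 0) Q - sm (fun _ => 0) Q - sm t Q
      rw [sm_zero]
      exact ⟨-q, by linarith⟩
  · push Not at hbig
    obtain ⟨A, hA, hne, hAQ, hd, hmin⟩ : ∃ A ⊆ Q, A.Nonempty ∧ A ≠ Q ∧ (ins Q μ t).dd A < 3 * k - 2 ∧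
        ∀ C ⊆ A, C.Nonempty → C ≠ A → 3 * k - 2 ≤ (ins Q μ t).dd C := by
      obtain ⟨A, hA, hmin⟩ := exists_min_image
        (Q.powerset.filter fun A => A.Nonempty ∧ A ≠ Q ∧ (ins Q μ t).dd A < 3 * k - 2) card (by
          obtain ⟨A, h1, h2, h3, h4⟩ := hbig
          exact ⟨A, mem_filter.2 ⟨mem_powerset.2 h1, h2, h3, h4⟩⟩)
      rw [mem_filter, mem_powerset] at hA
      refine ⟨A, hA.1, hA.2.1, hA.2.2.1, hA.2.2.2, fun C hCs hCne hCA => ?_⟩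
      by_contra hcon
      have hlt := card_lt_card (Finset.ssubset_iff_subset_ne.2 ⟨hCs, hCA⟩)
      have := hmin C (mem_filter.2 ⟨mem_powerset.2 (hCs.trans hA.1), hCne, ?_, not_le.1 hcon⟩)
      · omega
      · rintro rfl
        exact hCA (Subset.antisymm hCs hA.1)
    have hlt := card_lt_card (Finset.ssubset_iff_subset_ne.2 ⟨hA, hAQ⟩)
    have hpos := card_pos.2 hne
    by_cases hcard : A.card = 1
    · obtain ⟨v, rfl⟩ := card_eq_one.1 hcard
      have hv := singleton_subset_iff.1 hA
      rw [dd_ins1 h hv] at hd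
      have hF := F.sm v Q
      refine TP_rem hk IH hn (by omega) ht hv ((∑ i ∈ univ, (sm (ν i v) Q + 1)).toNat + 1) μ ν univ h F
        (fun i _ => hC i) (fun i hi => absurd (mem_univ i) hi) ?_ ?_
      · rw [Finset.sum_sub_distrib]
        simp only [sum_const, card_univ, Fintype.card_fin, nsmul_eq_mul, mul_one]
        omega
      · push_cast; omega
    · obtain ⟨a, ha⟩ := hne
      refine glue_good (S1 := ∅) (a := a) h hA ha (by simp) ?_ ?_
      · rw [con_ins]
        have ok := ok_con h (A := A) (a := a) hA ha
        rw [con_ins] at ok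
        refine IH _ _ _ (fun i => cn A a (ν i)) ok ?_ ?_ (F.cn A a) fun i => conn_cn (F.nn i) (hC i) hA ha
        · have e1 := card_insert_le a (Q \ A)
          rw [card_sdiff_of_subset hA] at e1
          omega
        · have hx := tt_con (I := ins Q μ t) (A := A) (a := a) ha (Subset.refl _)
          rw [ex_Q (I := ins Q μ t) hA ha] at hx
          rw [con_ins] at hx
          change sm (fun v => if v = a then sm t A else t v) (insert a (Q \ A)) = sm t Q at hx
          rw [hx]; exact ht
      · intro o' i' hS H hnet _
        have := dd_ge (t := t) F hC hA ⟨a, ha⟩ hAQ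
        exact side_good hk h hA H hnet (by omega) (by omega) hmin

theorem TP_all {k : ℤ} {m : ℕ} (hk : 2 ≤ k) (hm : (m : ℤ) = 2 * k - 2) (n : ℕ) : TP V k m n := by
  induction n with
  | zero => intro Q μ t ν h hn; omega
  | succ n ih => exact TP_step hk hm ih

/-- edge-connected version -/
theorem EC {k : ℤ} (hk : 2 ≤ k) {Q : Finset V} {μ : V → V → ℤ} {t : V → ℤ} (h : (ins Q μ t).Ok) (ht : 2 * k ∣ sm t Q)
    (hc : ∀ A ⊆ Q, A.Nonempty → A ≠ Q → 3 * k - 3 ≤ ee μ A (Q \ A)) : (ins Q μ t).Good k ∅ := by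
  refine T0_thm hk h ⟨Or.inl rfl, fun _ _ => rfl, ?_, ?_, ?_, by simp⟩
  · intro A hA hne hAQ _
    have h1 := hc A hA hne hAQ
    rw [← dd_ins (t := t)] at h1
    have h2 := nd_le hk ((ins Q μ t).tt A)
    have h3 := dd_par h hA
    have h4 := nd_par hk ((ins Q μ t).tt A)
    omega
  · rw [dd_full]
    have := nd_nonneg hk ((ins Q μ t).tt (ins Q μ t).Q)
    simp only [ins, sm_zero] at *
    omega
  · obtain ⟨q, hq⟩ := ht
    change 2 * k ∣ sm (fun _ => 0) Q - sm (fun _ => 0) Q - sm t Q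
    rw [sm_zero]
    exact ⟨-q, by linarith⟩

end Inst
end FR

open Finset
set_option linter.unusedSectionVars false
set_option linter.unnecessarySeqFocus false
namespace FR
section Link
variable {V : Type*} [DecidableEq V] {E : Type*}

/-- number of edges of `S` stored as the pair `(u, w)` -/
def nn (ends : E → V × V) (S : Finset E) (u w : V) : ℤ := ((S.filter fun e => ends e = (u, w)).card : ℤ)

/-- number of non-loop edges of `S` between `u` and `w` -/
def mm (ends : E → V × V) (S : Finset E) (u w : V) : ℤ := if u = w then 0 else nn ends S u w + nn ends S w u

theorem nn_nonneg (ends : E → V × V) (S : Finset E) (u w : V) : 0 ≤ nn ends S u w := by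
  unfold nn; omega

theorem card_AB (ends : E → V × V) (S : Finset E) (A B : Finset V) :
    ((S.filter fun e => (ends e).1 ∈ A ∧ (ends e).2 ∈ B).card : ℤ) = ∑ u ∈ A, ∑ w ∈ B, nn ends S u w := by
  rw [card_eq_sum_card_fiberwise (f := ends) (t := A ×ˢ B) (by
    intro e he
    have := (mem_filter.1 he).2
    exact mem_coe.2 (mem_product.2 this)), sum_product]
  push_cast
  refine sum_congr rfl fun u hu => sum_congr rfl fun w hw => ?_
  unfold nn
  congr 2
  ext e
  simp only [mem_filter]
  constructor
  · rintro ⟨⟨h1, -⟩, h2⟩; exact ⟨h1, h2⟩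
  · rintro ⟨h1, h2⟩; rw [h2]; exact ⟨⟨h1, hu, hw⟩, rfl⟩

theorem card_1 [Fintype V] (ends : E → V × V) (S : Finset E) (v : V) :
    ((S.filter fun e => (ends e).1 = v).card : ℤ) = ∑ w, nn ends S v w := by
  have := card_AB ends S {v} univ
  simpa using this

theorem card_2 [Fintype V] (ends : E → V × V) (S : Finset E) (v : V) :
    ((S.filter fun e => (ends e).2 = v).card : ℤ) = ∑ w, nn ends S w v := by
  have := card_AB ends S univ {v}
  simpa using this

theorem sum_mm [Fintype V] (ends : E → V × V) (S : Finset E) (v : V) :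
    ∑ w, mm ends S v w = ∑ w, nn ends S v w + ∑ w, nn ends S w v - 2 * nn ends S v v := by
  rw [← sum_add_distrib, ← Finset.add_sum_erase univ _ (mem_univ v),
    ← Finset.add_sum_erase univ (fun w => nn ends S v w + nn ends S w v) (mem_univ v)]
  rw [sum_congr rfl (g := fun w => nn ends S v w + nn ends S w v) fun w hw => by
    unfold mm; rw [if_neg (ne_of_mem_erase hw).symm]]
  unfold mm
  simp only [if_true]
  ring

theorem mdeg_eq [Fintype V] (ends : E → V × V) (S : Finset E) (v : V) :
    (mdeg ends S v : ℤ) = ∑ w, mm ends S v w + 2 * nn ends S v v := by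
  rw [sum_mm]; unfold mdeg; push_cast; rw [card_1, card_2]; ring

theorem mm_symm (ends : E → V × V) (S : Finset E) (u w : V) : mm ends S u w = mm ends S w u := by
  unfold mm
  by_cases h : u = w
  · subst h; rfl
  · rw [if_neg h, if_neg (Ne.symm h)]; ring

theorem mm_nonneg (ends : E → V × V) (S : Finset E) (u w : V) : 0 ≤ mm ends S u w := by
  unfold mm
  have := nn_nonneg ends S u w
  have := nn_nonneg ends S w u
  split_ifs <;> omega

theorem cut_eq [Fintype V] [Fintype E] (ends : E → V × V) (X : Finset V) :
    (cutCard ends X : ℤ) = ee (mm ends univ) X (univ \ X) := by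
  unfold cutCard
  classical
  rw [filter_or, card_union_of_disjoint (by
    rw [Finset.disjoint_left]; intro e; simp only [mem_filter]; tauto)]
  have h1 := card_AB ends univ X (univ \ X)
  have h2 := card_AB ends univ (univ \ X) X
  simp only [mem_sdiff, mem_univ, true_and] at h1 h2
  push_cast
  rw [h1, h2, sum_comm (s := univ \ X), ← sum_add_distrib]
  unfold ee
  refine sum_congr rfl fun u hu => ?_
  rw [← sum_add_distrib]
  refine sum_congr rfl fun w hw => ?_
  unfold mm
  rw [if_neg]
  rintro rfl
  exact (mem_sdiff.1 hw).2 hu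

theorem conn_tree [Fintype V] (ends : E → V × V) (T : Finset E)
    (h : ∀ a b : V, Relation.ReflTransGen (fun u w => ∃ e ∈ T, ends e = (u, w) ∨ ends e = (w, u)) a b) :
    Inst.Conn univ (mm ends T) := by
  intro A _ hne hA
  obtain ⟨a, ha⟩ := hne
  obtain ⟨b, hb⟩ : ∃ b, b ∉ A := by
    by_contra hcon; push Not at hcon
    exact hA (eq_univ_iff_forall.2 hcon)
  by_contra hcon
  push Not at hcon
  have key : ∀ b, Relation.ReflTransGen (fun u w => ∃ e ∈ T, ends e = (u, w) ∨ ends e = (w, u)) a b → b ∈ A := by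
    intro b hb
    induction hb with
    | refl => exact ha
    | tail _ h2 ih =>
      rename_i u w _
      by_contra hw
      obtain ⟨e, he, h3⟩ := h2
      have := hcon u ih w (by simp [hw])
      unfold mm at this
      rw [if_neg (by rintro rfl; exact hw ih)] at this
      have h4 := nn_nonneg ends T u w
      have h5 := nn_nonneg ends T w u
      rcases h3 with h3 | h3
      · have : 0 < (T.filter fun e => ends e = (u, w)).card := card_pos.2 ⟨e, by simp [he, h3]⟩
        unfold nn at *; omega
      · have : 0 < (T.filter fun e => ends e = (w, u)).card := card_pos.2 ⟨e, by simp [he, h3]⟩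
        unfold nn at *; omega
  exact hb (key b (h a b))

theorem fam_tree [Fintype E] (ends : E → V × V) {m : ℕ} (Ts : Fin m → Finset E)
    (h : ∀ i j, i ≠ j → Disjoint (Ts i) (Ts j)) : Inst.Fam (mm ends univ) (fun i => mm ends (Ts i)) := by
  classical
  refine ⟨fun i => mm_nonneg _ _, fun i => mm_symm _ _, fun x y => ?_⟩
  have key : ∀ x y, ∑ i, nn ends (Ts i) x y ≤ nn ends univ x y := by
    intro x y
    unfold nn
    rw [← Nat.cast_sum, ← card_biUnion]
    · norm_cast
      refine card_le_card fun e he => ?_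
      simp only [mem_biUnion, mem_filter] at he ⊢
      obtain ⟨i, -, -, h⟩ := he
      exact ⟨mem_univ _, h⟩
    · intro i _ j _ hij
      exact disjoint_filter_filter (h i j hij)
  unfold mm
  by_cases hxy : x = y
  · simp [hxy]
  · simp only [hxy, if_false, sum_add_distrib]
    have := key x y
    have := key y x
    omega

theorem orient_of [Fintype V] [Fintype E] (ends : E → V × V) (f : V → V → ℤ)
    (hf : ∀ u w, 0 ≤ f u w ∧ f u w + f w u = mm ends univ u w) :
    ∃ tl hd : E → V, (∀ e, ends e = (tl e, hd e) ∨ ends e = (hd e, tl e)) ∧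
      ∀ v, ((univ.filter fun e => tl e = v).card : ℤ) = ∑ w, f v w + nn ends univ v v := by
  classical
  let pr : V → V → Finset E := fun u w => univ.filter fun e => ends e = (u, w) ∨ ends e = (w, u)
  have hpr : ∀ u w, u ≠ w → ((pr u w).card : ℤ) = f u w + f w u := by
    intro u w hne
    rw [(hf u w).2]
    unfold mm nn
    rw [if_neg hne]
    simp only [pr]
    rw [filter_or, card_union_of_disjoint]
    · push_cast; rfl
    · rw [Finset.disjoint_left]; intro e h1 h2
      simp only [mem_filter, mem_univ, true_and] at h1 h2
      rw [h1] at h2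
      exact hne (Prod.ext_iff.1 h2).1
  have hprs : ∀ u w, pr u w = pr w u := by
    intro u w; ext e; simp only [pr, mem_filter]; tauto
  have hS : ∀ u w, ∃ S : Finset E, u ≠ w → S ⊆ pr u w ∧ (S.card : ℤ) = f u w := by
    intro u w
    by_cases hne : u = w
    · exact ⟨∅, fun h => absurd hne h⟩
    obtain ⟨S, h1, h2⟩ := exists_subset_card_eq (s := pr u w) (n := (f u w).toNat) (by
      have := hpr u w hne
      have := (hf u w).1
      have := (hf w u).1
      omega)
    exact ⟨S, fun _ => ⟨h1, by have := (hf u w).1; omega⟩⟩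
  choose S hS using hS
  let eV := Fintype.equivFin V
  let S' : V → V → Finset E := fun u w => if eV u < eV w then S u w else pr u w \ S w u
  have hS'1 : ∀ u w, u ≠ w → S' u w ⊆ pr u w := by
    intro u w hne
    simp only [S']
    split_ifs
    · exact (hS u w hne).1
    · exact sdiff_subset
  have hlt : ∀ u w, u ≠ w → (eV u < eV w ↔ ¬ eV w < eV u) := by
    intro u w hne
    have : eV u ≠ eV w := fun h => hne (eV.injective h)
    constructor
    · intro h h'; exact absurd h (lt_asymm h')
    · intro h; exact lt_of_le_of_ne (not_lt.1 h) this
  have hS'2 : ∀ u w, u ≠ w → ∀ e ∈ pr u w, (e ∈ S' u w ↔ e ∉ S' w u) := by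
    intro u w hne e he
    have he' : e ∈ pr w u := hprs u w ▸ he
    simp only [S']
    by_cases h : eV u < eV w
    · have h' := (hlt u w hne).1 h
      rw [if_pos h, if_neg h', mem_sdiff]
      tauto
    · have h' : eV w < eV u := by rw [hlt w u hne.symm]; exact h
      rw [if_neg h, if_pos h', mem_sdiff]
      tauto
  have hS'3 : ∀ u w, u ≠ w → ((S' u w).card : ℤ) = f u w := by
    intro u w hne
    simp only [S']
    split_ifs
    · exact (hS u w hne).2
    · have h1 := hS w u hne.symm
      have h2 := hpr u w hne
      rw [hprs w u] at h1
      have h3 := card_sdiff_add_card_eq_card h1.1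
      omega
  have hff : ∀ v, f v v = 0 := fun v => by
    have := (hf v v).2
    unfold mm at this
    simp at this
    omega
  refine ⟨fun e => if e ∈ S' (ends e).1 (ends e).2 then (ends e).1 else (ends e).2,
    fun e => if e ∈ S' (ends e).1 (ends e).2 then (ends e).2 else (ends e).1, fun e => ?_, fun v => ?_⟩
  · dsimp only
    split_ifs
    · left; rfl
    · right; rfl
  · rw [card_eq_sum_card_fiberwise (f := fun e => if e ∈ S' (ends e).1 (ends e).2 then (ends e).2 else (ends e).1)
      (t := univ) (by intro e _; exact mem_coe.2 (mem_univ _))]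
    push_cast
    rw [← Finset.add_sum_erase univ _ (mem_univ v), ← Finset.add_sum_erase univ (fun w => f v w) (mem_univ v), hff]
    have e1 : ∀ w, w ≠ v → filter (fun e => (if e ∈ S' (ends e).1 (ends e).2 then (ends e).2 else (ends e).1) = w)
        (filter (fun e => (if e ∈ S' (ends e).1 (ends e).2 then (ends e).1 else (ends e).2) = v) univ) = S' v w := by
      intro w hne
      ext e
      simp only [mem_filter, mem_univ, true_and]
      constructor
      · rintro ⟨h1, h2⟩
        split_ifs at h1 h2 with h3
        · rwa [h1, h2] at h3
        · rw [h1, h2] at h3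
          rw [hS'2 v w hne.symm]
          · exact h3
          · simp only [pr, mem_filter, mem_univ, true_and]
            right; rw [← h1, ← h2]
      · intro h1
        have h2 := hS'1 v w hne.symm h1
        have h3 := (hS'2 v w hne.symm e h2).1 h1
        simp only [pr, mem_filter, mem_univ, true_and] at h2
        rcases h2 with h2 | h2 <;> simp only [h2, h1, h3, if_true, if_false, and_self]
    have e2 : filter (fun e => (if e ∈ S' (ends e).1 (ends e).2 then (ends e).2 else (ends e).1) = v)
        (filter (fun e => (if e ∈ S' (ends e).1 (ends e).2 then (ends e).1 else (ends e).2) = v) univ) =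
        univ.filter fun e => ends e = (v, v) := by
      ext e
      simp only [mem_filter, mem_univ, true_and]
      constructor
      · rintro ⟨h1, h2⟩
        split_ifs at h1 h2 with h3
        · exact Prod.ext h1 h2
        · exact Prod.ext h2 h1
      · intro h; simp [h]
    rw [e2, sum_congr rfl (g := fun w => f v w) fun w hw => by
      rw [e1 w (ne_of_mem_erase hw)]; exact hS'3 v w (ne_of_mem_erase hw).symm]
    unfold nn
    ring

theorem orient [Fintype V] [Fintype E] (ends : E → V × V) (k r : ℕ) (hk : 2 ≤ k)
    (hdeg : ∀ v : V, ∃ j : ℕ, j ≤ k ∧ mdeg ends univ v = r * k + 2 * j)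
    (hpar : Even (r * Fintype.card V))
    (hconn : EdgeConn ends (3 * k - 3) ∨ TreeConn ends (2 * k - 2)) :
    ∃ tl hd : E → V, (∀ e, ends e = (tl e, hd e) ∨ ends e = (hd e, tl e)) ∧
      ∀ v, 2 * (k : ℤ) ∣ 2 * ((univ.filter fun e => tl e = v).card : ℤ) - mdeg ends univ v - r * k := by
  have hk' : (2 : ℤ) ≤ k := by exact_mod_cast hk
  have ok : (Inst.ins univ (mm ends univ) (fun _ : V => (r : ℤ) * k)).Ok := by
    refine Inst.ok_ins (mm_symm _ _) (mm_nonneg _ _) (fun x => by simp [mm]) fun v _ => ?_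
    obtain ⟨j, -, hj⟩ := hdeg v
    have h1 := mdeg_eq ends univ v
    rw [hj] at h1
    push_cast at h1
    unfold sm
    exact ⟨j - nn ends univ v v, by linarith⟩
  have ht : 2 * (k : ℤ) ∣ sm (fun _ : V => (r : ℤ) * k) univ := by
    obtain ⟨c, hc⟩ := hpar
    have hc' : (r : ℤ) * Fintype.card V = c + c := by exact_mod_cast hc
    refine ⟨c, ?_⟩
    unfold sm
    simp only [sum_const, card_univ, nsmul_eq_mul]
    linear_combination (k : ℤ) * hc'
  have G : (Inst.ins univ (mm ends univ) (fun _ : V => (r : ℤ) * k)).Good k ∅ := by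
    rcases hconn with hE | ⟨Ts, h1, h2⟩
    · refine Inst.EC hk' ok ht fun A _ hne hA => ?_
      rw [← cut_eq]
      have := hE A hne hA
      omega
    · exact Inst.TP_all (m := 2 * k - 2) hk' (by omega) (Fintype.card V + 1) univ _ _ (fun i => mm ends (Ts i)) ok
        (by rw [card_univ]; omega) ht (fam_tree ends Ts h1) fun i => conn_tree ends (Ts i) (h2 i).1
  obtain ⟨s, ⟨f, p, F1, F2, F3⟩, h1, -⟩ := G
  obtain ⟨tl, hd, h2, h3⟩ := orient_of ends f fun u w => F1 u (mem_univ u) w (mem_univ w)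
  refine ⟨tl, hd, h2, fun v => ?_⟩
  obtain ⟨q, hq⟩ := h1 v (mem_univ v)
  rw [Inst.dd_ins1 ok (mem_univ v)] at hq
  have e1 := F3 v (mem_univ v)
  have e2 := F2 v (mem_univ v)
  change 0 ≤ p v ∧ p v ≤ 0 at e2
  change s v = ∑ u, f v u + p v + 0 at e1
  change 2 * s v - ∑ w, mm ends univ v w - r * k = 2 * k * q at hq
  have e3 := mdeg_eq ends univ v
  have e4 : p v = 0 := by omega
  exact ⟨q, by rw [h3]; linarith⟩

end Link
end FR

open Finset
set_option linter.unusedSectionVars false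
set_option linter.unnecessarySeqFocus false
namespace FR
section Colour

/-- a regular bipartite multigraph has a proper edge colouring -/
theorem reg_col {E X Y : Type*} [DecidableEq E] [DecidableEq X] [DecidableEq Y] [Fintype X] [Fintype Y]
    (α : E → X) (β : E → Y) (k : ℕ) : ∀ S : Finset E, (∀ x, (S.filter fun e => α e = x).card = k) →
    (∀ y, (S.filter fun e => β e = y).card = k) →
    ∃ c : E → ℕ, (∀ e ∈ S, c e < k) ∧ (∀ x, ∀ i < k, (S.filter fun e => α e = x ∧ c e = i).card = 1) ∧
      ∀ y, ∀ i < k, (S.filter fun e => β e = y ∧ c e = i).card = 1 := by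
  induction k with
  | zero =>
    intro S h1 h2
    refine ⟨fun _ => 0, fun e he => ?_, by simp, by simp⟩
    have := card_eq_zero.1 (h1 (α e))
    have h3 : e ∈ S.filter fun e' => α e' = α e := by simp [he]
    rw [this] at h3; simp at h3
  | succ k ih =>
    intro S h1 h2
    have cA : ∀ A : Finset X, (S.filter fun e => α e ∈ A).card = A.card * (k + 1) := by
      intro A
      rw [card_eq_sum_card_fiberwise (f := α) (t := A) (by
        intro e he; exact mem_coe.2 (mem_filter.1 he).2)]
      rw [sum_congr rfl (g := fun _ => k + 1) fun x hx => ?_]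
      · simp
      · rw [← h1 x, filter_filter]
        congr 1; ext e; simp only [mem_filter]
        constructor
        · rintro ⟨a, b, c⟩; exact ⟨a, c⟩
        · rintro ⟨a, c⟩; exact ⟨a, c ▸ hx, c⟩
    have cB : ∀ A : Finset Y, (S.filter fun e => β e ∈ A).card = A.card * (k + 1) := by
      intro A
      rw [card_eq_sum_card_fiberwise (f := β) (t := A) (by
        intro e he; exact mem_coe.2 (mem_filter.1 he).2)]
      rw [sum_congr rfl (g := fun _ => k + 1) fun x hx => ?_]
      · simp
      · rw [← h2 x, filter_filter]
        congr 1; ext e; simp only [mem_filter]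
        constructor
        · rintro ⟨a, b, c⟩; exact ⟨a, c⟩
        · rintro ⟨a, c⟩; exact ⟨a, c ▸ hx, c⟩
    have hXY : Fintype.card X = Fintype.card Y := by
      have e1 := cA univ
      have e2 := cB univ
      simp only [mem_univ, filter_true, card_univ] at e1 e2
      exact Nat.eq_of_mul_eq_mul_right (Nat.succ_pos k) (e1.symm.trans e2)
    obtain ⟨g, hg, hgt⟩ := (all_card_le_biUnion_card_iff_exists_injective
      (fun x => (S.filter fun e => α e = x).image β)).1 (by
        intro A
        have : (S.filter fun e => α e ∈ A) ⊆
            S.filter fun e => β e ∈ A.biUnion fun x => (S.filter fun e => α e = x).image β := by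
          intro e he
          rw [mem_filter] at he ⊢
          refine ⟨he.1, mem_biUnion.2 ⟨α e, he.2, mem_image.2 ⟨e, ?_, rfl⟩⟩⟩
          simp [he.1]
        have := card_le_card this
        rw [cA, cB] at this
        exact Nat.le_of_mul_le_mul_right this (Nat.succ_pos k))
    have hgb : Function.Bijective g := (Fintype.bijective_iff_injective_and_card g).2 ⟨hg, hXY⟩
    have hm : ∀ x, ∃ e ∈ S, α e = x ∧ β e = g x := by
      intro x
      obtain ⟨e, he, h⟩ := mem_image.1 (hgt x)
      rw [mem_filter] at he
      exact ⟨e, he.1, he.2, h⟩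
    choose m hmS hmα hmβ using hm
    have fα : ∀ x, (S.filter fun e => α e = x ∧ e ∈ univ.image m) = {m x} := by
      intro x; ext e
      simp only [mem_filter, mem_image, mem_univ, true_and, mem_singleton]
      constructor
      · rintro ⟨-, h, y, rfl⟩
        rw [hmα] at h; rw [h]
      · rintro rfl; exact ⟨hmS x, hmα x, x, rfl⟩
    have fβ : ∀ x, (S.filter fun e => β e = g x ∧ e ∈ univ.image m) = {m x} := by
      intro x; ext e
      simp only [mem_filter, mem_image, mem_univ, true_and, mem_singleton]
      constructor
      · rintro ⟨-, h, y, rfl⟩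
        rw [hmβ] at h; rw [hg h]
      · rintro rfl; exact ⟨hmS x, hmβ x, x, rfl⟩
    have fβ' : ∀ y, (S.filter fun e => β e = y ∧ e ∈ univ.image m).card = 1 := by
      intro y
      obtain ⟨x, rfl⟩ := hgb.2 y
      rw [fβ, card_singleton]
    have spl : ∀ P : E → Prop, ∀ [DecidablePred P], (S.filter P).card =
        (S.filter fun e => P e ∧ e ∈ univ.image m).card + ((S \ univ.image m).filter P).card := by
      intro P _
      rw [← card_filter_add_card_filter_not (s := S.filter P) (fun e => e ∈ univ.image m), filter_filter, filter_filter]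
      congr 2
      ext e; simp only [mem_filter, mem_sdiff]; tauto
    obtain ⟨c, c1, c2, c3⟩ := ih (S \ univ.image m) (by
        intro x
        have := spl fun e => α e = x
        rw [h1, fα, card_singleton] at this
        omega) (by
        intro y
        have := spl fun e => β e = y
        rw [h2, fβ'] at this
        omega)
    have fin : ∀ P : E → Prop, ∀ [DecidablePred P], (S.filter fun e => P e ∧ e ∈ univ.image m).card = 1 →
        (∀ i < k, ((S \ univ.image m).filter fun e => P e ∧ c e = i).card = 1) → ∀ i < k + 1,
        (S.filter fun e => P e ∧ (if e ∈ univ.image m then k else c e) = i).card = 1 := by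
      intro P _ p1 p2 i hi
      by_cases hik : i = k
      · subst hik
        rw [← p1]
        congr 1; ext e; simp only [mem_filter]
        constructor
        · rintro ⟨a, b, d⟩
          refine ⟨a, b, ?_⟩
          by_contra hcon
          rw [if_neg hcon] at d
          have := c1 e (mem_sdiff.2 ⟨a, hcon⟩)
          omega
        · rintro ⟨a, b, d⟩; exact ⟨a, b, if_pos d⟩
      · rw [← p2 i (by omega)]
        congr 1; ext e; simp only [mem_filter, mem_sdiff]
        constructor
        · rintro ⟨a, b, d⟩
          split_ifs at d with hd
          · exact absurd d.symm hik
          · exact ⟨⟨a, hd⟩, b, d⟩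
        · rintro ⟨⟨a, a'⟩, b, d⟩
          exact ⟨a, b, by rw [if_neg a']; exact d⟩
    refine ⟨fun e => if e ∈ univ.image m then k else c e, ?_, ?_, ?_⟩
    · intro e he
      dsimp only
      split_ifs with h
      · omega
      · have := c1 e (mem_sdiff.2 ⟨he, h⟩); omega
    · intro x
      exact fin (fun e => α e = x) (by rw [fα, card_singleton]) (c2 x)
    · intro y
      exact fin (fun e => β e = y) (fβ' y) (c3 y)

theorem blocks {E : Type*} [DecidableEq E] (k s : ℕ) (q : ℕ) : ∀ F : Finset E, F.card = q * k + s →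
    ∃ b : E → Fin (q + 1), ∀ j, (F.filter fun e => b e = j).card = if j = Fin.last q then s else k := by
  induction q with
  | zero =>
    intro F hF
    refine ⟨fun _ => 0, fun j => ?_⟩
    have : j = 0 := Fin.ext (by have := j.2; simp only [Fin.val_zero]; omega)
    subst this
    simpa using hF
  | succ q ih =>
    intro F hF
    obtain ⟨G, hG, hGc⟩ := exists_subset_card_eq (s := F) (n := k) (by rw [hF]; nlinarith)
    obtain ⟨b, hb⟩ := ih (F \ G) (by
      rw [card_sdiff_of_subset hG, hF, hGc, Nat.succ_mul]; omega)
    refine ⟨fun e => if e ∈ G then 0 else (b e).succ, fun j => ?_⟩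
    refine Fin.cases ?_ (fun j => ?_) j
    · rw [if_neg (by simp [Fin.ext_iff]), ← hGc]
      congr 1; ext e; simp only [mem_filter]
      constructor
      · rintro ⟨a, h⟩
        by_contra hcon
        rw [if_neg hcon] at h
        exact Fin.succ_ne_zero _ h
      · intro h; exact ⟨hG h, if_pos h⟩
    · have e1 : (j.succ = Fin.last (q + 1)) = (j = Fin.last q) := by
        rw [← Fin.succ_last, Fin.succ_inj]
      simp only [e1]
      rw [← hb j]
      congr 1; ext e; simp only [mem_filter, mem_sdiff]
      constructor
      · rintro ⟨a, h⟩
        split_ifs at h with h'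
        · exact absurd h.symm (Fin.succ_ne_zero _)
        · exact ⟨⟨a, h'⟩, Fin.succ_injective _ h⟩
      · rintro ⟨⟨a, h'⟩, h⟩
        exact ⟨a, by rw [if_neg h', h]⟩

theorem card_sum {A B : Type*} [Fintype A] [Fintype B] (P : A ⊕ B → Prop) [DecidablePred P] :
    (univ.filter P).card = (univ.filter fun a => P (Sum.inl a)).card + (univ.filter fun b => P (Sum.inr b)).card := by
  rw [← Finset.univ_disjSum_univ, card_filter, card_filter, card_filter, Finset.sum_disjSum]

theorem card_sum' {A B : Type*} [Fintype A] [Fintype B] (P : A ⊕ B → Prop) [DecidablePred P]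
    (Q : A → Prop) [DecidablePred Q] (R : B → Prop) [DecidablePred R]
    (hQ : ∀ a, P (Sum.inl a) ↔ Q a) (hR : ∀ b, P (Sum.inr b) ↔ R b) :
    (univ.filter P).card = (univ.filter Q).card + (univ.filter R).card := by
  rw [card_sum]
  congr 2
  · ext a; simp only [mem_filter, mem_univ, true_and, hQ]
  · ext a; simp only [mem_filter, mem_univ, true_and, hR]

theorem card_sig {V : Type*} [Fintype V] [DecidableEq V] (n : V → ℕ) (v : V) :
    (univ.filter fun d : Σ v, Fin (n v) => d.1 = v).card = n v := by
  have : (univ.filter fun d : Σ v, Fin (n v) => d.1 = v) = univ.map (Function.Embedding.sigmaMk (β := fun v => Fin (n v)) v) := by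
    ext ⟨w, x⟩
    simp only [mem_filter, mem_univ, true_and, mem_map, Function.Embedding.sigmaMk_apply]
    constructor
    · rintro rfl; exact ⟨x, rfl⟩
    · rintro ⟨y, h⟩; rw [Sigma.mk.inj_iff] at h; exact h.1.symm
  rw [this, card_map, card_univ, Fintype.card_fin]

/-- counts on one side -/
theorem side_count {V E D : Type*} [Fintype V] [DecidableEq V] [Fintype E] [Fintype D] (q : V → ℕ) (tl : E → V) (dv : D → V)
    (b : ∀ v, E → Fin (q v + 1)) (c : E ⊕ D → ℕ) (i : ℕ)
    (h : ∀ x : Σ v, Fin (q v + 1), (univ.filter fun e : E ⊕ D =>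
      (Sum.elim (fun e => ⟨tl e, b (tl e) e⟩) (fun d => ⟨dv d, Fin.last _⟩) e : Σ v, Fin (q v + 1)) = x ∧ c e = i).card = 1) (v : V) :
    (univ.filter fun e => tl e = v ∧ c (Sum.inl e) = i).card + (univ.filter fun d => dv d = v ∧ c (Sum.inr d) = i).card = q v + 1
    ∧ (univ.filter fun e => (tl e = v ∧ b v e = Fin.last _) ∧ c (Sum.inl e) = i).card +
      (univ.filter fun d => dv d = v ∧ c (Sum.inr d) = i).card = 1 := by
  classical
  constructor
  · have e1 := card_sum' (fun e : E ⊕ D => (Sum.elim (fun e => ⟨tl e, b (tl e) e⟩) (fun d => ⟨dv d, Fin.last _⟩) e : Σ v, Fin (q v + 1)).1 = v ∧ c e = i)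
      (fun e => tl e = v ∧ c (Sum.inl e) = i) (fun d => dv d = v ∧ c (Sum.inr d) = i) (fun _ => Iff.rfl) (fun _ => Iff.rfl)
    refine e1.symm.trans ?_
    rw [card_eq_sum_card_fiberwise (f := fun e : E ⊕ D => (Sum.elim (fun e => ⟨tl e, b (tl e) e⟩) (fun d => ⟨dv d, Fin.last _⟩) e : Σ v, Fin (q v + 1)))
      (t := univ.filter fun x => x.1 = v) (by
        intro e he
        exact mem_coe.2 (mem_filter.2 ⟨mem_univ _, (mem_filter.1 he).2.1⟩))]
    rw [sum_congr rfl (g := fun _ => 1) fun x hx => ?_]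
    · rw [sum_const, card_sig]; simp
    · refine Eq.trans ?_ (h x)
      rw [filter_filter]
      congr 1; ext e; simp only [mem_filter, mem_univ, true_and] at hx ⊢
      constructor
      · rintro ⟨⟨a, b⟩, c⟩; exact ⟨c, b⟩
      · rintro ⟨a, b⟩; exact ⟨⟨by rw [a]; exact hx, b⟩, a⟩
  · refine Eq.trans (card_sum' _ _ _ ?_ ?_).symm (h ⟨v, Fin.last _⟩)
    · intro e
      constructor
      · rintro ⟨h1, h3⟩
        obtain ⟨h1, h2⟩ := Sigma.mk.inj_iff.1 h1
        subst h1
        exact ⟨⟨rfl, eq_of_heq h2⟩, h3⟩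
      · rintro ⟨⟨h1, h2⟩, h3⟩
        subst h1
        exact ⟨Sigma.mk.inj_iff.2 ⟨rfl, heq_of_eq h2⟩, h3⟩
    · intro d
      constructor
      · rintro ⟨h1, h3⟩
        exact ⟨(Sigma.mk.inj_iff.1 h1).1, h3⟩
      · rintro ⟨h1, h3⟩
        subst h1
        exact ⟨rfl, h3⟩

theorem side_reg {V E : Type*} [Fintype V] [DecidableEq V] [Fintype E] (k : ℕ) (q s : V → ℕ) (hs : ∀ v, s v ≤ k) (tl : E → V)
    (b : ∀ v, E → Fin (q v + 1))
    (hb : ∀ v j, ((univ.filter fun e => tl e = v).filter fun e => b v e = j).card = if j = Fin.last (q v) then s v else k)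
    (x : Σ v, Fin (q v + 1)) : (univ.filter fun e : E ⊕ (Σ v, Fin (k - s v)) =>
      (Sum.elim (fun e => ⟨tl e, b (tl e) e⟩) (fun d => ⟨d.1, Fin.last _⟩) e : Σ v, Fin (q v + 1)) = x).card = k := by
  classical
  obtain ⟨v, j⟩ := x
  rw [card_sum' _ (fun e => tl e = v ∧ b v e = j) (fun d : Σ v, Fin (k - s v) => d.1 = v ∧ j = Fin.last (q v)),
    ← filter_filter, hb]
  · by_cases hj : j = Fin.last (q v)
    · subst hj
      simp only [and_true, if_true]
      rw [card_sig]
      have := hs v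
      omega
    · simp [hj]
  · intro e
    constructor
    · intro h1
      obtain ⟨h1, h2⟩ := Sigma.mk.inj_iff.1 h1
      subst h1
      exact ⟨rfl, eq_of_heq h2⟩
    · rintro ⟨h1, h2⟩
      subst h1
      exact Sigma.mk.inj_iff.2 ⟨rfl, heq_of_eq h2⟩
  · intro d
    constructor
    · intro h1
      obtain ⟨h1, h2⟩ := Sigma.mk.inj_iff.1 h1
      subst h1
      exact ⟨rfl, (eq_of_heq h2).symm⟩
    · rintro ⟨h1, h2⟩
      subst h1
      exact Sigma.mk.inj_iff.2 ⟨rfl, heq_of_eq h2.symm⟩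

theorem colour {V E : Type*} [Fintype V] [DecidableEq V] [Fintype E] (k : ℕ) (tl hd : E → V) (q q' s : V → ℕ)
    (hs : ∀ v, s v ≤ k) (h1 : ∀ v, (univ.filter fun e => tl e = v).card = q v * k + s v)
    (h2 : ∀ v, (univ.filter fun e => hd e = v).card = q' v * k + s v) :
    ∃ c : E → Fin k, ∀ v i, ∃ D, D ≤ 1 ∧ (s v = 0 → D = 1) ∧
      (univ.filter fun e => tl e = v ∧ c e = i).card + D = q v + 1 ∧
      (univ.filter fun e => hd e = v ∧ c e = i).card + D = q' v + 1 := by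
  classical
  choose b hb using fun v => blocks k (s v) (q v) _ (h1 v)
  choose b' hb' using fun v => blocks k (s v) (q' v) _ (h2 v)
  obtain ⟨c, c1, c2, c3⟩ := reg_col 
    (Sum.elim (fun e => ⟨tl e, b (tl e) e⟩) (fun d => ⟨d.1, Fin.last _⟩) : E ⊕ (Σ v, Fin (k - s v)) → Σ v, Fin (q v + 1))
    (Sum.elim (fun e => ⟨hd e, b' (hd e) e⟩) (fun d => ⟨d.1, Fin.last _⟩) : E ⊕ (Σ v, Fin (k - s v)) → Σ v, Fin (q' v + 1)) k univ
    (side_reg k q s hs tl b hb) (side_reg k q' s hs hd b' hb')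
  refine ⟨fun e => ⟨c (Sum.inl e), c1 _ (mem_univ _)⟩, fun v i => ?_⟩
  have a1 := side_count q tl (fun d : Σ v, Fin (k - s v) => d.1) b c i (fun x => c2 x i i.2) v
  have a2 := side_count q' hd (fun d : Σ v, Fin (k - s v) => d.1) b' c i (fun x => c3 x i i.2) v
  refine ⟨(univ.filter fun d : Σ v, Fin (k - s v) => d.1 = v ∧ c (Sum.inr d) = i).card, ?_, ?_, ?_, ?_⟩
  · omega
  · intro h0
    have e1 := hb v (Fin.last _)
    rw [if_pos rfl, h0] at e1
    have e2 : (univ.filter fun e => (tl e = v ∧ b v e = Fin.last _) ∧ c (Sum.inl e) = i).card ≤ 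
        ((univ.filter fun e => tl e = v).filter fun e => b v e = Fin.last _).card := by
      refine card_le_card fun e he => ?_
      simp only [mem_filter, mem_univ, true_and] at he ⊢
      exact he.1
    omega
  · simpa only [Fin.ext_iff] using a1.1
  · simpa only [Fin.ext_iff] using a2.1

end Colour
end FR

open Finset
set_option linter.unusedSectionVars false
namespace FR
section Final

theorem mdeg_swap {V E : Type*} [DecidableEq V] (ends : E → V × V) (tl hd : E → V)
    (h : ∀ e, ends e = (tl e, hd e) ∨ ends e = (hd e, tl e)) (S : Finset E) (v : V) :
    mdeg ends S v = (S.filter fun e => tl e = v).card + (S.filter fun e => hd e = v).card := by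
  unfold mdeg
  rw [card_filter, card_filter, card_filter, card_filter, ← sum_add_distrib, ← sum_add_distrib]
  refine sum_congr rfl fun e _ => ?_
  rcases h e with h | h
  · rw [h]
  · rw [h]; exact Nat.add_comm _ _

theorem arith (k r j a b : ℕ) (hk : 0 < k) (hj : j ≤ k) (hab : a + b = r * k + 2 * j)
    (h : 2 * (k : ℤ) ∣ 2 * (a : ℤ) - ((a + b : ℕ) : ℤ) - r * k) :
    ∃ q q' s : ℕ, s ≤ k ∧ a = q * k + s ∧ b = q' * k + s ∧ (q + q' = r ∨ (s = 0 ∧ q + q' = r + 2)) := by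
  obtain ⟨n, hn⟩ := h
  have hab' : (a : ℤ) + b = r * k + 2 * j := by exact_mod_cast hab
  push_cast at hn
  have hk' : (0 : ℤ) < k := by exact_mod_cast hk
  have hj' : (j : ℤ) ≤ k := by exact_mod_cast hj
  have ha : (a : ℤ) = (r + n) * k + j := by linarith
  have hb : (b : ℤ) = (-n) * k + j := by linarith
  have ha0 : (0 : ℤ) ≤ a := by positivity
  have hb0 : (0 : ℤ) ≤ b := by positivity
  by_cases hjk : j = k
  · subst hjk
    have n1 : 0 ≤ (r : ℤ) + n + 1 := by
      by_contra hc; nlinarith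
    have n2 : 0 ≤ 1 - n := by
      by_contra hc; nlinarith
    obtain ⟨q, hq⟩ := Int.eq_ofNat_of_zero_le n1
    obtain ⟨q', hq'⟩ := Int.eq_ofNat_of_zero_le n2
    refine ⟨q, q', 0, Nat.zero_le _, ?_, ?_, Or.inr ⟨rfl, by omega⟩⟩
    · zify; rw [← hq, ha]; push_cast; ring
    · zify; rw [← hq', hb]; push_cast; ring
  · have hlt : (j : ℤ) < k := by
      have : j < k := lt_of_le_of_ne hj hjk
      exact_mod_cast this
    have n1 : 0 ≤ (r : ℤ) + n := by
      by_contra hc; nlinarith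
    have n2 : 0 ≤ - n := by
      by_contra hc; nlinarith
    obtain ⟨q, hq⟩ := Int.eq_ofNat_of_zero_le n1
    obtain ⟨q', hq'⟩ := Int.eq_ofNat_of_zero_le n2
    refine ⟨q, q', j, hj, ?_, ?_, Or.inl (by omega)⟩
    · zify; rw [← hq, ha]
    · zify; rw [← hq', hb]

theorem final {V E : Type*} [Fintype V] [Fintype E] [DecidableEq V]
    (ends : E → V × V) (k r : ℕ) (hk : 0 < k)
    (hdeg : ∀ v : V, ∃ j : ℕ, j ≤ k ∧ mdeg ends univ v = r * k + 2 * j)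
    (hpar : Even (r * Fintype.card V))
    (hconn : EdgeConn ends (3 * k - 3) ∨ TreeConn ends (2 * k - 2)) :
    ∃ c : E → Fin k, ∀ v : V, ∀ i : Fin k,
      mdeg ends (univ.filter fun e => c e = i) v = r ∨
      mdeg ends (univ.filter fun e => c e = i) v = r + 2 := by
  rcases Nat.lt_or_ge k 2 with h1 | h2
  · have : k = 1 := by omega
    subst this
    refine ⟨fun _ => 0, fun v i => ?_⟩
    have hf : (univ.filter fun _ : E => (0 : Fin 1) = i) = univ := by
      rw [filter_true_of_mem]; intro _ _; exact Subsingleton.elim _ _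
    rw [hf]
    obtain ⟨j, hj, h⟩ := hdeg v
    omega
  · obtain ⟨tl, hd, ht, hdv⟩ := orient ends k r h2 hdeg hpar hconn
    have key : ∀ v, ∃ q q' s : ℕ, s ≤ k ∧ (univ.filter fun e => tl e = v).card = q * k + s ∧
        (univ.filter fun e => hd e = v).card = q' * k + s ∧ (q + q' = r ∨ (s = 0 ∧ q + q' = r + 2)) := by
      intro v
      obtain ⟨j, hj, h⟩ := hdeg v
      have h3 := hdv v
      rw [mdeg_swap ends tl hd ht] at h h3
      exact arith k r j _ _ hk hj h h3
    choose q q' s a1 a2 a3 a4 using key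
    obtain ⟨c, hc⟩ := colour k tl hd q q' s a1 a2 a3
    refine ⟨c, fun v i => ?_⟩
    obtain ⟨D, d1, d2, d3, d4⟩ := hc v i
    rw [mdeg_swap ends tl hd ht, filter_filter, filter_filter]
    simp only [and_comm (a := c _ = i)]
    rcases a4 v with h | ⟨h, h'⟩
    · omega
    · have := d2 h
      omega

end Final
end FR

/-- Decomposition into `k` factors with degrees in `{r, r+2}`, for multigraphs whose
degrees lie in `{rk, rk+2, …, rk+2k}` with `r·|V|` even. -/
theorem factorization_r_rplus2 [Fintype V] [Fintype E] [DecidableEq V]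
    (ends : E → V × V) (k r : ℕ) (hk : 0 < k) (hr : 0 < r)
    (hdeg : ∀ v : V, ∃ j : ℕ, j ≤ k ∧ mdeg ends univ v = r * k + 2 * j)
    (hpar : Even (r * Fintype.card V))
    (hconn : EdgeConn ends (3 * k - 3) ∨ TreeConn ends (2 * k - 2)) :
    ∃ c : E → Fin k, ∀ v : V, ∀ i : Fin k,
      mdeg ends (univ.filter fun e => c e = i) v = r ∨
      mdeg ends (univ.filter fun e => c e = i) v = r + 2 := by
  exact FR.final ends k r hk hdeg hpar hconn
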